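/- arXiv:2504.01944 — 6 statements merged into one kernel-verified Lean document; each statement's English description precedes it below -/
import Mathlib

section
/- Every graphon game with a continuum of agents, i.e. with the Lebesgue interval ([0,1], Lebesgue σ-algebra, Lebesgue measure) as the space of agents, satisfying assumptions (A2)–(A6) has a Nash equilibrium. -/
open MeasureTheory Set Filter Topology

/-- A finite set `P` is dominant for a family of orders (given by ranking functions) if every
element lies weakly below all of `P` for one of the orders. -/
def IsDominant {I Y L : Type*} [LinearOrder L] (r : I → Y → L) (P : Finset Y) : Prop :=
  ∀ y, ∃ i, ∀ p ∈ P, r i y ≤ r i p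

theorem IsDominant.mono {I Y L : Type*} [LinearOrder L] {r : I → Y → L} {P Q : Finset Y}
    (hP : IsDominant r P) (h : Q ⊆ P) : IsDominant r Q :=
  fun y => (hP y).imp fun _ hi p hp => hi p (h hp)

theorem IsDominant.exists_eq_min {I Y L : Type*} [LinearOrder L] {r : I → Y → L}
    (hr : ∀ i, Function.Injective (r i)) {P : Finset Y}
    (hP : IsDominant r P) {m : I → Y} (hm : ∀ i, m i ∈ P) (hmin : ∀ i, ∀ p ∈ P, r i (m i) ≤ r i p)
    {p : Y} (hp : p ∈ P) : ∃ i, m i = p := by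
  obtain ⟨i, hi⟩ := hP p
  exact ⟨i, hr i (le_antisymm (hmin i p hp) (hi _ (hm i)))⟩

theorem exists_min_fun {I Y L : Type*} [LinearOrder L] (r : I → Y → L) {P : Finset Y}
    (hP : P.Nonempty) :
    ∃ m : I → Y, (∀ i, m i ∈ P) ∧ ∀ i, ∀ p ∈ P, r i (m i) ≤ r i p := by
  choose m hm hmin using fun i => Finset.exists_min_image P (r i) hP
  exact ⟨m, hm, hmin⟩

/-- The pivot step: raising the floor of `Q` in direction `i` produces a dominant superset. -/
theorem IsDominant.exists_pivot {I Y L : Type*} [Fintype Y] [LinearOrder L]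
    {r : I → Y → L} {Q : Finset Y} (hQ : IsDominant r Q) {m : I → Y}
    (hm : ∀ i, m i ∈ Q) (i : I)
    (hne : ∃ y, ∀ j, j ≠ i → r j (m j) < r j y) :
    ∃ x, (∀ j, j ≠ i → r j (m j) < r j x) ∧ (∀ p ∈ Q, r i x ≤ r i p) ∧
      ∀ y, (∀ j, j ≠ i → r j (m j) < r j y) → r i y ≤ r i x := by
  classical
  obtain ⟨x, hx, hmax⟩ := Finset.exists_max_image
    (Finset.univ.filter fun y => ∀ j, j ≠ i → r j (m j) < r j y) (r i)
    (by obtain ⟨y, hy⟩ := hne; exact ⟨y, by simpa using hy⟩)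
  simp only [Finset.mem_filter, Finset.mem_univ, true_and] at hx hmax
  refine ⟨x, hx, ?_, hmax⟩
  obtain ⟨j, hj⟩ := hQ x
  by_cases hji : j = i
  · subst hji; exact hj
  · exact absurd (hj _ (hm j)) (not_le.2 (hx j hji))

theorem IsDominant.insert_of_pivot {I Y L : Type*} [DecidableEq Y] [LinearOrder L]
    {r : I → Y → L} {Q : Finset Y} {m : I → Y}
    (hmin : ∀ i, ∀ p ∈ Q, r i (m i) ≤ r i p) {i : I} {x : Y}
    (hx : ∀ j, j ≠ i → r j (m j) < r j x) (hxQ : ∀ p ∈ Q, r i x ≤ r i p)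
    (hmax : ∀ y, (∀ j, j ≠ i → r j (m j) < r j y) → r i y ≤ r i x) :
    IsDominant r (insert x Q) := by
  intro y
  by_contra! hcon
  have hy : ∀ j, j ≠ i → r j (m j) < r j y := by
    intro j hj
    obtain ⟨p, hp, hlt⟩ := hcon j
    rcases Finset.mem_insert.1 hp with rfl | hp
    · exact (hx j hj).trans hlt
    · exact (hmin j p hp).trans_lt hlt
  obtain ⟨p, hp, hlt⟩ := hcon i
  rcases Finset.mem_insert.1 hp with rfl | hp
  · exact absurd (hmax y hy) (not_le.2 hlt)
  · exact absurd ((hmax y hy).trans (hxQ p hp)) (not_le.2 hlt)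

open Classical in
/-- A dominant set with one element less than the number of orders, and not reaching the extreme
elements, extends to a dominant set in exactly two ways. -/
theorem IsDominant.card_extensions {I Y L : Type*} [Fintype I] [Fintype Y]
    [LinearOrder L] {r : I → Y → L} (hr : ∀ i, Function.Injective (r i)) {Q : Finset Y}
    (hQ : IsDominant r Q) (hcard : Q.card + 1 = Fintype.card I) (hne : Q.Nonempty)
    (htop : ∀ i, ∃ y, ∀ j, j ≠ i → ∃ q ∈ Q, r j q < r j y) :
    (Finset.univ.filter fun x => x ∉ Q ∧ IsDominant r (insert x Q)).card = 2 := by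
  obtain ⟨m, hm, hmin⟩ := exists_min_fun r hne
  have hsurj : ∀ p ∈ Q, ∃ i, m i = p := fun p hp => hQ.exists_eq_min hr hm hmin hp
  obtain ⟨a, -, b, -, hab, hmab⟩ := Finset.exists_ne_map_eq_of_card_lt_of_maps_to
    (s := (Finset.univ : Finset I)) (t := Q) (f := m) (by rw [Finset.card_univ]; omega)
    (fun i _ => hm i)
  have himg : ∀ i, i = a ∨ i = b → ∀ p ∈ Q, ∃ j, j ≠ i ∧ m j = p := by
    intro i hi p hp
    obtain ⟨j, rfl⟩ := hsurj p hp
    rcases hi with rfl | rfl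
    · by_cases hj : j = i
      · exact ⟨b, hab.symm, by rw [hj, hmab]⟩
      · exact ⟨j, hj, rfl⟩
    · by_cases hj : j = i
      · exact ⟨a, hab, by rw [hj, hmab]⟩
      · exact ⟨j, hj, rfl⟩
  have hne' : ∀ i, ∃ y, ∀ j, j ≠ i → r j (m j) < r j y := fun i => by
    obtain ⟨y, hy⟩ := htop i
    refine ⟨y, fun j hj => ?_⟩
    obtain ⟨q, hq, hlt⟩ := hy j hj
    exact (hmin j q hq).trans_lt hlt
  obtain ⟨xa, hxa, hxaQ, hxamax⟩ := hQ.exists_pivot hm a (hne' a)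
  obtain ⟨xb, hxb, hxbQ, hxbmax⟩ := hQ.exists_pivot hm b (hne' b)
  have hnot : ∀ i x, (i = a ∨ i = b) → (∀ j, j ≠ i → r j (m j) < r j x) → x ∉ Q := by
    intro i x hi hx hxQ
    obtain ⟨j, hj, rfl⟩ := himg i hi x hxQ
    exact lt_irrefl _ (hx j hj)
  have hxab : xa ≠ xb := by
    rintro rfl
    exact absurd (hxa b hab.symm) (not_lt.2 (hxbQ _ (hm b)))
  rw [Finset.card_eq_two]
  refine ⟨xa, xb, hxab, ?_⟩
  ext x
  simp only [Finset.mem_filter, Finset.mem_univ, true_and, Finset.mem_insert,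
    Finset.mem_singleton]
  constructor
  · rintro ⟨hxQ, hdom⟩
    obtain ⟨m', hm', hmin'⟩ := exists_min_fun r (Finset.insert_nonempty x Q)
    obtain ⟨i, hi⟩ := hdom.exists_eq_min hr hm' hmin' (Finset.mem_insert_self x Q)
    have hinj : Function.Injective m' := by
      rw [← Set.injOn_univ, ← Finset.coe_univ, ← Finset.card_image_iff, Finset.card_univ]
      have : Finset.univ.image m' = insert x Q := by
        ext p
        simp only [Finset.mem_image, Finset.mem_univ, true_and]
        exact ⟨by rintro ⟨j, rfl⟩; exact hm' j, fun hp => hdom.exists_eq_min hr hm' hmin' hp⟩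
      rw [this, Finset.card_insert_of_notMem hxQ, hcard]
    have hmem : ∀ j, j ≠ i → m' j ∈ Q := fun j hj =>
      (Finset.mem_insert.1 (hm' j)).resolve_left fun h => hj (hinj (h.trans hi.symm))
    have hmm : ∀ j, j ≠ i → m' j = m j := fun j hj =>
      hr j (le_antisymm (hmin' j _ (Finset.mem_insert_of_mem (hm j))) (hmin j _ (hmem j hj)))
    have hiab : i = a ∨ i = b := by
      by_contra! h
      exact hab (hinj (by rw [hmm a h.1.symm, hmm b h.2.symm, hmab]))
    have hxM : ∀ j, j ≠ i → r j (m j) < r j x := by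
      intro j hj
      refine lt_of_le_of_ne ?_ fun h => hxQ (hr j h ▸ hm j)
      rw [← hmm j hj]
      exact hmin' j x (Finset.mem_insert_self x Q)
    have hxmax : ∀ y, (∀ j, j ≠ i → r j (m j) < r j y) → r i y ≤ r i x := by
      intro y hy
      obtain ⟨k, hk⟩ := hdom y
      by_cases hki : k = i
      · subst hki; exact hk x (Finset.mem_insert_self x Q)
      · exact absurd (hk _ (Finset.mem_insert_of_mem (hm k))) (not_le.2 (hy k hki))
    rcases hiab with rfl | rfl
    · exact Or.inl (hr i (le_antisymm (hxamax x hxM) (hxmax xa hxa)))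
    · exact Or.inr (hr i (le_antisymm (hxbmax x hxM) (hxmax xb hxb)))
  · rintro (rfl | rfl)
    · exact ⟨hnot a x (Or.inl rfl) hxa, IsDominant.insert_of_pivot hmin hxa hxaQ hxamax⟩
    · exact ⟨hnot b x (Or.inr rfl) hxb, IsDominant.insert_of_pivot hmin hxb hxbQ hxbmax⟩

/-- In a set whose colours miss a full palette, the number of elements whose removal leaves exactly
the colours different from `i₀` (each once) is even. -/
theorem even_card_erase_colors {I Y : Type*} [Fintype I] [DecidableEq I] [DecidableEq Y]
    (c : Y → I) (i₀ : I) {P : Finset Y}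
    (hP : P.card = Fintype.card I) (hfull : P.image c ≠ Finset.univ) :
    Even (P.filter fun x => (P.erase x).image c = Finset.univ.erase i₀).card := by
  classical
  rcases (P.filter fun x => (P.erase x).image c = Finset.univ.erase i₀).eq_empty_or_nonempty with
    h | ⟨x, hx⟩
  · simp [h]
  obtain ⟨hxP, hxc⟩ := Finset.mem_filter.1 hx
  have hcx : c x ≠ i₀ := by
    intro h
    apply hfull
    rw [← Finset.insert_erase hxP, Finset.image_insert, hxc, h,
      Finset.insert_erase (Finset.mem_univ _)]
  have hinj : ∀ z ∈ P, (P.erase z).image c = Finset.univ.erase i₀ →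
      Set.InjOn c (P.erase z : Finset Y) := by
    intro z hz h
    rw [← Finset.card_image_iff, h, Finset.card_erase_of_mem hz,
      Finset.card_erase_of_mem (Finset.mem_univ _), hP, Finset.card_univ]
  obtain ⟨x', hx', hcx'⟩ : ∃ x' ∈ P.erase x, c x' = c x := by
    have : c x ∈ (P.erase x).image c := by rw [hxc]; simp [hcx]
    simpa using this
  have hxx' : x' ≠ x := Finset.ne_of_mem_erase hx'
  have hx'P : x' ∈ P := Finset.mem_of_mem_erase hx'
  have : (P.filter fun z => (P.erase z).image c = Finset.univ.erase i₀) = {x, x'} := by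
    ext z
    simp only [Finset.mem_filter, Finset.mem_insert, Finset.mem_singleton]
    constructor
    · rintro ⟨hz, hzc⟩
      by_contra! h
      exact hxx' (hinj z hz hzc (by simp [h.2.symm, hx'P]) (by simp [h.1.symm, hxP]) hcx')
    · rintro (rfl | rfl)
      · exact ⟨hxP, hxc⟩
      · refine ⟨hx'P, ?_⟩
        rw [← hxc]
        ext k
        simp only [Finset.mem_image, Finset.mem_erase]
        constructor
        · rintro ⟨w, ⟨hw, hwP⟩, rfl⟩
          by_cases hwx : w = x
          · exact ⟨z, ⟨hxx', hx'P⟩, by rw [hwx, hcx']⟩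
          · exact ⟨w, ⟨hwx, hwP⟩, rfl⟩
        · rintro ⟨w, ⟨hw, hwP⟩, rfl⟩
          by_cases hwx : w = z
          · exact ⟨x, ⟨hxx'.symm, hxP⟩, by rw [hwx, hcx']⟩
          · exact ⟨w, ⟨hwx, hwP⟩, rfl⟩
  rw [this, Finset.card_pair hxx'.symm]
  exact even_two

/-- **Scarf's lemma** in Sperner form: with slack elements `s i` at the bottom of the `i`-th order
and at the top of all others, every colouring giving `s i` the colour `i` has a dominant set
carrying all colours. -/
theorem exists_isDominant_image_eq_univ {I Y L : Type*} [Fintype I] [DecidableEq I] [Fintype Y]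
    [LinearOrder L] {r : I → Y → L} (hr : ∀ i, Function.Injective (r i)) (s : I → Y)
    (hbot : ∀ i y, y ≠ s i → r i (s i) < r i y)
    (htop : ∀ i j y, j ≠ i → y ∉ Set.range s → r i y < r i (s j))
    (hX : ∃ y, y ∉ Set.range s) [Nonempty I] (c : Y → I) (hc : ∀ i, c (s i) = i) :
    ∃ P : Finset Y, IsDominant r P ∧ P.image c = Finset.univ := by
  classical
  by_contra! hcon
  obtain ⟨i₀⟩ := ‹Nonempty I›
  have hs : Function.Injective s := fun i j h => by rw [← hc i, h, hc]
  set Q₀ : Finset Y := (Finset.univ.erase i₀).image s with hQ₀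
  let rooms : Finset (Finset Y) :=
    Finset.univ.filter fun P => P.card = Fintype.card I ∧ IsDominant r P
  let doors : Finset (Finset Y) := Finset.univ.filter fun Q =>
    Q.card + 1 = Fintype.card I ∧ IsDominant r Q ∧ Q.image c = Finset.univ.erase i₀
  let T : Finset (Finset Y × Y) := Finset.univ.filter fun z =>
    z.1 ∈ rooms ∧ z.2 ∈ z.1 ∧ (z.1.erase z.2).image c = Finset.univ.erase i₀
  have hQ₀mem : ∀ i, s i ∈ Q₀ ↔ i ≠ i₀ := by
    intro i
    simp only [hQ₀, Finset.mem_image, Finset.mem_erase, Finset.mem_univ, and_true]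
    exact ⟨by rintro ⟨j, hj, h⟩; rwa [← hs h], fun h => ⟨i, h, rfl⟩⟩
  -- the exceptional door extends in one way only
  have hspecial : IsDominant r Q₀ ∧
      (Finset.univ.filter fun x => x ∉ Q₀ ∧ IsDominant r (insert x Q₀)).card = 1 := by
    obtain ⟨x, hx, hxmax⟩ := Finset.exists_max_image
      (Finset.univ.filter fun y => y ∉ Set.range s) (r i₀)
      (by obtain ⟨y, hy⟩ := hX; exact ⟨y, by simpa using hy⟩)
    simp only [Finset.mem_filter, Finset.mem_univ, true_and] at hx hxmax
    have hdom : IsDominant r (insert x Q₀) := by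
      intro y
      by_cases hy : y ∈ Set.range s
      · obtain ⟨j, rfl⟩ := hy
        refine ⟨j, fun p _ => ?_⟩
        by_cases hp : p = s j
        · rw [hp]
        · exact (hbot j p hp).le
      · refine ⟨i₀, fun p hp => ?_⟩
        rcases Finset.mem_insert.1 hp with rfl | hp
        · exact hxmax y hy
        · obtain ⟨j, hj, rfl⟩ := Finset.mem_image.1 hp
          exact (htop i₀ j y (Finset.ne_of_mem_erase hj) hy).le
    refine ⟨hdom.mono (Finset.subset_insert _ _), ?_⟩
    rw [Finset.card_eq_one]
    refine ⟨x, ?_⟩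
    ext z
    simp only [Finset.mem_filter, Finset.mem_univ, true_and, Finset.mem_singleton]
    constructor
    · rintro ⟨hz, hzdom⟩
      have key : ∀ y, y ∉ Set.range s → z ∉ Set.range s ∧ r i₀ y ≤ r i₀ z := by
        intro y hy
        obtain ⟨i, hi⟩ := hzdom y
        have hlt : r i (s i) < r i y := hbot i y fun h => hy ⟨i, h.symm⟩
        have hii : i = i₀ := by
          by_contra h
          exact absurd (hi _ (Finset.mem_insert_of_mem ((hQ₀mem i).2 h))) (not_le.2 hlt)
        subst hii
        refine ⟨?_, hi z (Finset.mem_insert_self _ _)⟩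
        rintro ⟨j, rfl⟩
        have hj : j = i := by
          by_contra h
          exact hz ((hQ₀mem j).2 h)
        subst hj
        exact absurd (hi _ (Finset.mem_insert_self _ _)) (not_le.2 hlt)
      exact hr i₀ (le_antisymm (hxmax z (key x hx).1) (key x hx).2)
    · rintro rfl
      refine ⟨fun h => hx ?_, hdom⟩
      obtain ⟨j, -, hj⟩ := Finset.mem_image.1 h
      exact ⟨j, hj⟩
  have hQ₀door : Q₀ ∈ doors := by
    simp only [doors, Finset.mem_filter, Finset.mem_univ, true_and]
    refine ⟨?_, hspecial.1, ?_⟩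
    · rw [hQ₀, Finset.card_image_of_injective _ hs, Finset.card_erase_of_mem (Finset.mem_univ _),
        Finset.card_univ]
      have : 0 < Fintype.card I := Fintype.card_pos_iff.2 ⟨i₀⟩
      omega
    · rw [hQ₀, Finset.image_image]
      have : c ∘ s = id := funext hc
      rw [this, Finset.image_id]
  have hother : ∀ Q ∈ doors, Q ≠ Q₀ →
      (Finset.univ.filter fun x => x ∉ Q ∧ IsDominant r (insert x Q)).card = 2 := by
    intro Q hQ hne
    simp only [doors, Finset.mem_filter, Finset.mem_univ, true_and] at hQ
    obtain ⟨hcard, hdom, hcol⟩ := hQ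
    have : ∃ q ∈ Q, q ∉ Set.range s := by
      by_contra! h
      apply hne
      have h1 : Q = (Q.image c).image s := by
        ext y
        simp only [Finset.mem_image, exists_exists_and_eq_and]
        constructor
        · intro hy
          obtain ⟨i, rfl⟩ := h y hy
          exact ⟨s i, hy, by rw [hc]⟩
        · rintro ⟨w, hw, rfl⟩
          obtain ⟨i, rfl⟩ := h w hw
          rwa [hc]
      rw [h1, hcol]
    obtain ⟨q, hq, hqs⟩ := this
    exact hdom.card_extensions hr hcard ⟨q, hq⟩ fun i =>
      ⟨s i, fun j hj => ⟨q, hq, htop j i q hj.symm hqs⟩⟩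
  have hT1 : T.card = ∑ P ∈ rooms, (T.filter fun z => z.1 = P).card :=
    Finset.card_eq_sum_card_fiberwise fun z hz => (Finset.mem_filter.1 hz).2.1
  have hT2 : T.card = ∑ Q ∈ doors, (T.filter fun z => z.1.erase z.2 = Q).card := by
    refine Finset.card_eq_sum_card_fiberwise fun z hz => ?_
    obtain ⟨-, h1, h2, h3⟩ := Finset.mem_filter.1 hz
    obtain ⟨-, h4, h5⟩ := Finset.mem_filter.1 h1
    refine Finset.mem_coe.2 (Finset.mem_filter.2 ⟨Finset.mem_univ _, ?_,
      h5.mono (Finset.erase_subset _ _), h3⟩)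
    rw [Finset.card_erase_add_one h2, h4]
  have heven : Even T.card := by
    rw [hT1]
    refine Finset.even_sum _ fun P hP => ?_
    obtain ⟨-, h1, h2⟩ := Finset.mem_filter.1 hP
    have := even_card_erase_colors c i₀ h1 (hcon P h2)
    refine Eq.subst (motive := fun n => Even n) (Eq.symm ?_) this
    refine Finset.card_bij (fun z _ => z.2) ?_ ?_ ?_
    · rintro ⟨P', x⟩ hz
      simp only [T, Finset.mem_filter, Finset.mem_univ, true_and] at hz
      obtain ⟨⟨-, h4, h5⟩, rfl⟩ := hz
      exact Finset.mem_filter.2 ⟨h4, h5⟩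
    · rintro ⟨P₁, x₁⟩ h₁ ⟨P₂, x₂⟩ h₂ h
      rw [Finset.mem_filter] at h₁ h₂
      exact Prod.ext (h₁.2.trans h₂.2.symm) h
    · intro x hx
      obtain ⟨h4, h5⟩ := Finset.mem_filter.1 hx
      exact ⟨(P, x), by simp [T, hP, h4, h5], rfl⟩
  have hfib : ∀ Q ∈ doors, (T.filter fun z => z.1.erase z.2 = Q).card =
      (Finset.univ.filter fun x => x ∉ Q ∧ IsDominant r (insert x Q)).card := by
    intro Q hQ
    obtain ⟨-, h1, h2, h3⟩ := Finset.mem_filter.1 hQ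
    refine Finset.card_bij (fun z _ => z.2) ?_ ?_ ?_
    · rintro ⟨P', x⟩ hz
      simp only [T, rooms, Finset.mem_filter, Finset.mem_univ, true_and] at hz
      obtain ⟨⟨⟨-, h4⟩, h5, -⟩, rfl⟩ := hz
      refine Finset.mem_filter.2 ⟨Finset.mem_univ _, Finset.notMem_erase _ _, ?_⟩
      rwa [Finset.insert_erase h5]
    · rintro ⟨P₁, x₁⟩ h₁ ⟨P₂, x₂⟩ h₂ h
      simp only [T, Finset.mem_filter, Finset.mem_univ, true_and] at h₁ h₂
      obtain rfl : x₁ = x₂ := h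
      refine Prod.ext ?_ rfl
      rw [← Finset.insert_erase h₁.1.2.1, ← Finset.insert_erase h₂.1.2.1, h₁.2, h₂.2]
    · intro x hx
      obtain ⟨-, h4, h5⟩ := Finset.mem_filter.1 hx
      refine ⟨(insert x Q, x), ?_, rfl⟩
      simp [T, rooms, h4, h5, h3, Finset.card_insert_of_notMem, h1]
  have hodd : Odd T.card := by
    rw [hT2, ← Finset.add_sum_erase _ _ hQ₀door, hfib Q₀ hQ₀door, hspecial.2]
    refine Odd.add_even odd_one (Finset.even_sum _ fun Q hQ => ?_)
    obtain ⟨h1, h2⟩ := Finset.mem_erase.1 hQ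
    rw [hfib Q h2, hother Q h2 h1]
    exact even_two
  exact (Nat.not_even_iff_odd.2 hodd) heven

/-- Approximate fixed points on the standard simplex, obtained from Scarf's lemma on a grid of
mesh `1 / N`. -/
theorem exists_approx_fixedPoint_stdSimplex {I : Type*} [Fintype I] [Nonempty I]
    {f : (I → ℝ) → I → ℝ} (hmaps : MapsTo f (stdSimplex ℝ I) (stdSimplex ℝ I))
    {N : ℕ} (hN : 0 < N) :
    ∃ x ∈ stdSimplex ℝ I, ∀ i, ∃ z ∈ stdSimplex ℝ I,
      (∀ j, |z j - x j| ≤ Fintype.card I / N) ∧ z i ≤ f z i + Fintype.card I / N := by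
  classical
  have hN' : (0 : ℝ) < N := by exact_mod_cast hN
  let X := {k : I → Fin (N + 1) // ∑ i, (k i : ℕ) = N}
  let pt : X → I → ℝ := fun k i => ((k.1 i : ℕ) : ℝ) / N
  have hpt : ∀ k, pt k ∈ stdSimplex ℝ I := by
    intro k
    refine ⟨fun i => by positivity, ?_⟩
    simp only [pt]
    rw [← Finset.sum_div, div_eq_one_iff_eq hN'.ne']
    exact_mod_cast k.2
  have hcol : ∀ k : X, ∃ i, pt k i ≤ f (pt k) i := by
    intro k
    by_contra! h
    have h1 := Finset.sum_lt_sum_of_nonempty (Finset.univ_nonempty (α := I)) fun i _ => h i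
    rw [(hpt k).2, (hmaps (hpt k)).2] at h1
    exact lt_irrefl _ h1
  choose col hcol using hcol
  let Y := X ⊕ I
  let c : Y → I := Sum.elim col id
  let v : I → Y → ℤ := fun i => Sum.elim (fun k => ((k.1 i : ℕ) : ℤ))
    (fun j => if j = i then -1 else N + 1)
  let e : Y ≃ Fin (Fintype.card Y) := Fintype.equivFin Y
  let r : I → Y → ℤ ×ₗ Fin (Fintype.card Y) := fun i y => toLex (v i y, e y)
  have hrv : ∀ i y y', r i y ≤ r i y' → v i y ≤ v i y' := by
    intro i y y' h
    rcases (Prod.Lex.le_iff).1 h with h | h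
    · exact le_of_lt h
    · exact h.1.le
  have hvr : ∀ i y y', v i y < v i y' → r i y < r i y' := fun i y y' h =>
    Prod.Lex.lt_iff.2 (Or.inl h)
  have hr : ∀ i, Function.Injective (r i) := by
    intro i y y' h
    have h2 : (v i y, e y) = (v i y', e y') := toLex.injective h
    exact e.injective (Prod.ext_iff.1 h2).2
  have hle : ∀ (k : X) i, ((k.1 i : ℕ) : ℤ) ≤ N := fun k i => by
    have := (k.1 i).2
    omega
  have mkX : ∀ g : I → ℕ, ∑ i, g i = N → ∃ k : X, ∀ i, (k.1 i : ℕ) = g i := by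
    intro g hg
    refine ⟨⟨fun i => ⟨g i, ?_⟩, by simpa using hg⟩, fun i => rfl⟩
    have := Finset.single_le_sum (f := g) (fun _ _ => Nat.zero_le _) (Finset.mem_univ i)
    omega
  obtain ⟨k₀, -⟩ : ∃ k : X, True := by
    obtain ⟨i₁⟩ := ‹Nonempty I›
    obtain ⟨k, -⟩ := mkX (fun i => if i = i₁ then N else 0) (by simp)
    exact ⟨k, trivial⟩
  obtain ⟨P, hdom, hPc⟩ := exists_isDominant_image_eq_univ (r := r) hr (Sum.inr : I → Y)
    (by
      rintro i (k | j) hy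
      · apply hvr
        simp only [v, Sum.elim_inr, Sum.elim_inl, if_true]
        omega
      · apply hvr
        have : j ≠ i := fun h => hy (by rw [h])
        simp only [v, Sum.elim_inr, if_true, this, if_false]
        omega)
    (by
      rintro i j (k | l) hj hy
      · apply hvr
        simp only [v, Sum.elim_inr, Sum.elim_inl, hj, if_false]
        have := hle k i
        omega
      · exact absurd ⟨l, rfl⟩ hy)
    ⟨Sum.inl k₀, by simp⟩ c (fun i => rfl)
  have hdomX : ∀ k : X, ∃ i, Sum.inr i ∉ P ∧ ∀ p ∈ P, v i (Sum.inl k) ≤ v i p := by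
    intro k
    obtain ⟨i, hi⟩ := hdom (Sum.inl k)
    refine ⟨i, fun h => ?_, fun p hp => hrv _ _ _ (hi p hp)⟩
    have := hrv _ _ _ (hi _ h)
    simp only [v, Sum.elim_inr, Sum.elim_inl, if_true] at this
    omega
  have hcolP : ∀ i, Sum.inr i ∉ P → ∃ k : X, Sum.inl k ∈ P ∧ col k = i := by
    intro i hi
    have : i ∈ P.image c := by rw [hPc]; exact Finset.mem_univ _
    obtain ⟨p, hp, hpi⟩ := Finset.mem_image.1 this
    rcases p with k | j
    · exact ⟨k, hp, hpi⟩
    · obtain rfl : j = i := hpi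
      exact absurd hp hi
  let A : Finset I := Finset.univ.filter fun i => Sum.inr i ∉ P
  obtain ⟨a, ha, -⟩ := hdomX k₀
  obtain ⟨x₀, hx₀, -⟩ := hcolP a ha
  choose m hm hmin using fun i => Finset.exists_min_image P (v i) ⟨_, hx₀⟩
  have hmin_nonneg : ∀ i ∈ A, 0 ≤ v i (m i) := by
    intro i hi
    have h1 : Sum.inr i ∉ P := by simpa [A] using hi
    rcases h2 : m i with k | j
    · simp [v]
    · have : j ≠ i := by
        rintro rfl
        exact h1 (h2 ▸ hm j)
      simp only [v, Sum.elim_inr, this, if_false]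
      omega
  have hmin_le : ∀ i, ∀ k : X, Sum.inl k ∈ P → v i (m i) ≤ ((k.1 i : ℕ) : ℤ) := fun i k hk =>
    hmin i _ hk
  have hsum : (N : ℤ) < ∑ i ∈ A, (v i (m i) + 1) := by
    by_contra! hcon
    have haA : a ∈ A := by simpa [A] using ha
    let R : ℤ := N - ∑ i ∈ A, (v i (m i) + 1)
    let g : I → ℕ := fun i => if i ∈ A then
      (v i (m i)).toNat + 1 + (if i = a then R.toNat else 0) else 0
    have hg : ∑ i, g i = N := by
      have : (∑ i, (g i : ℤ)) = N := by
        have h1 : ∀ i, (g i : ℤ) =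
            if i ∈ A then (v i (m i) + 1) + (if i = a then R else 0) else 0 := by
          intro i
          by_cases hi : i ∈ A
          · have h2 := hmin_nonneg i hi
            have h3 : 0 ≤ R := by simp only [R]; omega
            simp only [g, hi, if_true]
            split_ifs <;> push_cast <;> omega
          · simp [g, hi]
        simp_rw [h1]
        rw [Finset.sum_ite_mem, Finset.univ_inter, Finset.sum_add_distrib,
          Finset.sum_ite_eq' A a, if_pos haA]
        simp only [R]
        ring
      exact_mod_cast this
    obtain ⟨k, hk⟩ := mkX g hg
    obtain ⟨i, hi, hik⟩ := hdomX k
    have hiA : i ∈ A := by simpa [A] using hi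
    have h1 := hik _ (hm i)
    have h2 := hmin_nonneg i hiA
    have h3 : v i (Sum.inl k) = (g i : ℤ) := by simp only [v, Sum.elim_inl]; rw [hk]
    rw [h3] at h1
    simp only [g, hiA, if_true] at h1
    split_ifs at h1 <;> push_cast at h1 <;> omega
  have hA : (∑ i ∈ A, v i (m i)) + Fintype.card I > N := by
    rw [Finset.sum_add_distrib] at hsum
    have : (A.card : ℤ) ≤ Fintype.card I := by exact_mod_cast Finset.card_le_univ A
    simp only [Finset.sum_const, nsmul_eq_mul, mul_one] at hsum
    omega
  have hXsum : ∀ k : X, ∑ i, ((k.1 i : ℕ) : ℤ) = N := fun k => by exact_mod_cast k.2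
  have hin : ∀ k : X, Sum.inl k ∈ P → ∀ i ∈ A,
      ((k.1 i : ℕ) : ℤ) ≤ v i (m i) + Fintype.card I := by
    intro k hk i hi
    have h1 : ∑ j ∈ A, ((k.1 j : ℕ) : ℤ) ≤ N := by
      rw [← hXsum k]
      exact Finset.sum_le_sum_of_subset_of_nonneg (Finset.subset_univ _) fun _ _ _ => by positivity
    have h2 : ((k.1 i : ℕ) : ℤ) - v i (m i) ≤ ∑ j ∈ A, (((k.1 j : ℕ) : ℤ) - v j (m j)) :=
      Finset.single_le_sum (f := fun j => ((k.1 j : ℕ) : ℤ) - v j (m j))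
        (fun j _ => sub_nonneg.2 (hmin_le j k hk)) hi
    rw [Finset.sum_sub_distrib] at h2
    omega
  have hout : ∀ k : X, Sum.inl k ∈ P → ∀ i ∉ A, ((k.1 i : ℕ) : ℤ) ≤ Fintype.card I := by
    intro k hk i hi
    have h1 : ∑ j ∈ insert i A, ((k.1 j : ℕ) : ℤ) ≤ N := by
      rw [← hXsum k]
      exact Finset.sum_le_sum_of_subset_of_nonneg (Finset.subset_univ _) fun _ _ _ => by positivity
    rw [Finset.sum_insert hi] at h1
    have h2 : ∑ j ∈ A, v j (m j) ≤ ∑ j ∈ A, ((k.1 j : ℕ) : ℤ) :=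
      Finset.sum_le_sum fun j _ => hmin_le j k hk
    omega
  have hclose : ∀ k k' : X, Sum.inl k ∈ P → Sum.inl k' ∈ P → ∀ i,
      ((k.1 i : ℕ) : ℤ) - ((k'.1 i : ℕ) : ℤ) ≤ Fintype.card I := by
    intro k k' hk hk' i
    by_cases hi : i ∈ A
    · have := hin k hk i hi
      have := hmin_le i k' hk'
      omega
    · have := hout k hk i hi
      omega
  have hclose' : ∀ k k' : X, Sum.inl k ∈ P → Sum.inl k' ∈ P → ∀ i,
      |pt k i - pt k' i| ≤ Fintype.card I / N := by
    intro k k' hk hk' i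
    have h1 : (((k.1 i : ℕ) : ℝ) - ((k'.1 i : ℕ) : ℝ)) ≤ Fintype.card I := by
      exact_mod_cast hclose k k' hk hk' i
    have h2 : (((k'.1 i : ℕ) : ℝ) - ((k.1 i : ℕ) : ℝ)) ≤ Fintype.card I := by
      exact_mod_cast hclose k' k hk' hk i
    simp only [pt]
    rw [← sub_div, abs_div, abs_of_pos hN']
    gcongr
    exact abs_le.2 ⟨by linarith, h1⟩
  refine ⟨pt x₀, hpt x₀, fun i => ?_⟩
  by_cases hi : i ∈ A
  · obtain ⟨k, hk, hki⟩ := hcolP i (by simpa [A] using hi)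
    refine ⟨pt k, hpt k, hclose' k x₀ hk hx₀, ?_⟩
    have h1 : pt k i ≤ f (pt k) i := hki ▸ hcol k
    have h2 : (0 : ℝ) ≤ Fintype.card I / N := by positivity
    linarith
  · refine ⟨pt x₀, hpt x₀, hclose' x₀ x₀ hx₀ hx₀, ?_⟩
    have h1 : ((x₀.1 i : ℕ) : ℝ) ≤ Fintype.card I := by exact_mod_cast hout x₀ hx₀ i hi
    have h2 : pt x₀ i ≤ Fintype.card I / N := by
      simp only [pt]
      gcongr
    have h3 := (hmaps (hpt x₀)).1 i
    linarith

/-- **Brouwer's fixed point theorem** on the standard simplex. -/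
theorem exists_fixedPoint_stdSimplex {I : Type*} [Fintype I] [Nonempty I]
    {f : (I → ℝ) → I → ℝ} (hf : ContinuousOn f (stdSimplex ℝ I))
    (hmaps : MapsTo f (stdSimplex ℝ I) (stdSimplex ℝ I)) :
    ∃ x ∈ stdSimplex ℝ I, f x = x := by
  choose x hx z hz hzx hzf using fun N : ℕ =>
    exists_approx_fixedPoint_stdSimplex hmaps (Nat.succ_pos N)
  obtain ⟨a, ha, φ, hφ, hlim⟩ := (isCompact_stdSimplex ℝ I).tendsto_subseq hx
  have h0 : Tendsto (fun N => (Fintype.card I : ℝ) / ((φ N).succ : ℕ)) atTop (𝓝 0) :=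
    tendsto_const_nhds.div_atTop (tendsto_natCast_atTop_atTop.comp
      ((tendsto_add_atTop_nat 1).comp hφ.tendsto_atTop))
  have hzlim : ∀ i, Tendsto (fun N => z (φ N) i) atTop (𝓝 a) := by
    intro i
    rw [tendsto_pi_nhds]
    intro j
    have h1 : Tendsto (fun N => z (φ N) i j - x (φ N) j) atTop (𝓝 0) :=
      squeeze_zero_norm (fun N => by rw [Real.norm_eq_abs]; exact hzx (φ N) i j) h0
    simpa using h1.add ((tendsto_pi_nhds.1 hlim) j)
  have hle : ∀ i, a i ≤ f a i := by
    intro i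
    have h1 : Tendsto (fun N => f (z (φ N) i)) atTop (𝓝 (f a)) :=
      (hf a ha).tendsto.comp (tendsto_nhdsWithin_iff.2
        ⟨hzlim i, Eventually.of_forall fun N => hz _ _⟩)
    have h2 := ((tendsto_pi_nhds.1 h1) i).add h0
    rw [add_zero] at h2
    exact le_of_tendsto_of_tendsto' ((tendsto_pi_nhds.1 (hzlim i)) i) h2 fun N => hzf (φ N) i
  refine ⟨a, ha, ?_⟩
  have hsum : ∑ i, a i = ∑ i, f a i := by rw [ha.2, (hmaps ha).2]
  funext i
  exact (((Finset.sum_eq_sum_iff_of_le fun i _ => hle i).1 hsum) i (Finset.mem_univ i)).symm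

/-- A set-valued map with convex values in a compact set has, for every neighbourhood `O` of zero,
a point in the convex hull (tested by linear functionals) of the values at `O`-close points. -/
theorem exists_approx_fixedPoint_setValued {V : Type*} [AddCommGroup V] [Module ℝ V]
    [TopologicalSpace V] [IsTopologicalAddGroup V] [ContinuousSMul ℝ V] [T2Space V] [NormalSpace V]
    {K : Set V} (hK : IsCompact K) (hKc : Convex ℝ K) (hKne : K.Nonempty) {G : Set (V × V)}
    (hGK : ∀ x ∈ K, ∃ y ∈ K, (x, y) ∈ G) {O : Set V} (hO : O ∈ 𝓝 (0 : V)) :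
    ∃ y ∈ K, ∀ p : V →L[ℝ] ℝ, ∃ x ∈ K, ∃ b ∈ K, (x, b) ∈ G ∧ x - y ∈ O ∧ p y ≤ p b := by
  classical
  obtain ⟨O', hO'O, hO'open, hO'0⟩ := mem_nhds_iff.1 hO
  choose! β hβK hβG using hGK
  have hU : ∀ x, IsOpen {y : V | x - y ∈ O'} := fun x =>
    hO'open.preimage (continuous_const.sub continuous_id)
  obtain ⟨t, ht⟩ := hK.elim_nhds_subcover' (fun x _ => {y : V | x - y ∈ O'})
    (fun x _ => (hU x).mem_nhds (by simpa using hO'0))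
  have htne : Nonempty t := by
    obtain ⟨x, hx⟩ := hKne
    obtain ⟨i, hi, -⟩ := mem_iUnion₂.1 (ht hx)
    exact ⟨⟨i, hi⟩⟩
  obtain ⟨ρ, hρ⟩ := PartitionOfUnity.exists_isSubordinate_of_locallyFinite hK.isClosed
    (fun i : t => {y : V | (i : K).1 - y ∈ O'}) (fun i => hU _) (locallyFinite_of_finite _)
    (fun x hx => by
      obtain ⟨i, hi, h⟩ := mem_iUnion₂.1 (ht hx)
      exact mem_iUnion.2 ⟨⟨i, hi⟩, h⟩)
  let comb : (t → ℝ) → V := fun l => ∑ i, l i • β (i : K).1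
  have hcombK : ∀ l ∈ stdSimplex ℝ t, comb l ∈ K := fun l hl =>
    hKc.sum_mem (fun i _ => hl.1 i) hl.2 fun i _ => hβK _ (i : K).2
  have hcomb : Continuous comb :=
    continuous_finsetSum _ fun i _ => (continuous_apply i).smul continuous_const
  obtain ⟨l, hl, hfix⟩ := exists_fixedPoint_stdSimplex (I := t) (f := fun l i => ρ i (comb l))
    (continuous_pi fun i => (ρ i).continuous.comp hcomb).continuousOn
    (fun l hl => ⟨fun i => ρ.nonneg i _, by
      rw [← ρ.sum_eq_one (hcombK l hl), finsum_eq_sum_of_fintype]⟩)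
  refine ⟨comb l, hcombK l hl, fun p => ?_⟩
  have hpc : p (comb l) = ∑ i, l i * p (β (i : K).1) := by
    simp [comb, map_sum]
  by_contra! hcon
  have hlt : ∀ i : t, l i ≠ 0 → p (β (i : K).1) < p (comb l) := by
    intro i hi
    refine hcon _ (i : K).2 _ (hβK _ (i : K).2) (hβG _ (i : K).2) (hO'O ?_)
    have h1 : ρ i (comb l) ≠ 0 := by
      rw [← congrFun hfix i] at hi
      exact hi
    exact hρ i (subset_tsupport _ h1)
  obtain ⟨i, hi⟩ : ∃ i, l i ≠ 0 := by
    by_contra! h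
    have := hl.2
    simp [h] at this
  have : ∑ i, l i * p (β (i : K).1) < ∑ i, l i * p (comb l) := by
    refine Finset.sum_lt_sum (fun j _ => ?_) ⟨i, Finset.mem_univ _, ?_⟩
    · by_cases hj : l j = 0
      · simp [hj]
      · exact mul_le_mul_of_nonneg_left (hlt j hj).le (hl.1 j)
    · exact mul_lt_mul_of_pos_left (hlt i hi) (lt_of_le_of_ne (hl.1 i) hi.symm)
  rw [← hpc, ← Finset.sum_mul, hl.2, one_mul] at this
  exact lt_irrefl _ this

/-- The **Kakutani–Fan–Glicksberg fixed point theorem** in metrizable locally convex spaces; the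
set-valued map is given by its closed graph `G`. -/
theorem exists_fixedPoint_of_isClosed_graph {V : Type*} [AddCommGroup V] [Module ℝ V]
    [TopologicalSpace V] [IsTopologicalAddGroup V] [ContinuousSMul ℝ V] [LocallyConvexSpace ℝ V]
    [TopologicalSpace.MetrizableSpace V] {K : Set V} (hK : IsCompact K) (hKc : Convex ℝ K)
    (hKne : K.Nonempty) {G : Set (V × V)} (hG : IsClosed G)
    (hGK : ∀ x ∈ K, ∃ y ∈ K, (x, y) ∈ G)
    (hGc : ∀ x ∈ K, Convex ℝ {y | (x, y) ∈ G}) :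
    ∃ x ∈ K, (x, x) ∈ G := by
  let := TopologicalSpace.metrizableSpaceMetric V
  obtain ⟨O, hO⟩ := (𝓝 (0 : V)).exists_antitone_basis
  choose y hyK hy using fun n => exists_approx_fixedPoint_setValued hK hKc hKne hGK (hO.1.mem_of_mem
    (i := n) trivial)
  obtain ⟨a, haK, φ, hφ, hlim⟩ := hK.tendsto_subseq hyK
  refine ⟨a, haK, ?_⟩
  by_contra hna
  have hclosed : IsClosed {b | (a, b) ∈ G} := hG.preimage (by fun_prop : Continuous fun b => (a, b))
  obtain ⟨p, u, hpu, hup⟩ := geometric_hahn_banach_closed_point (hGc a haK) hclosed hna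
  choose x hxK b hbK hxb hxO hpb using fun n => hy n p
  obtain ⟨b', -, ψ, hψ, hblim⟩ := hK.tendsto_subseq fun n => hbK (φ n)
  have h1 : Tendsto (fun n => y (φ (ψ n))) atTop (𝓝 a) := hlim.comp hψ.tendsto_atTop
  have h2 : Tendsto (fun n => x (φ (ψ n)) - y (φ (ψ n))) atTop (𝓝 0) :=
    (hO.tendsto fun n => hxO n).comp (hφ.tendsto_atTop.comp hψ.tendsto_atTop)
  have h3 : Tendsto (fun n => x (φ (ψ n))) atTop (𝓝 a) := by simpa using h2.add h1
  have hmem : (a, b') ∈ G := hG.mem_of_tendsto (h3.prodMk_nhds hblim)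
    (Eventually.of_forall fun n => hxb _)
  have h4 : p a ≤ p b' := le_of_tendsto_of_tendsto' ((p.continuous.tendsto a).comp h1)
    ((p.continuous.tendsto b').comp hblim) fun n => hpb _
  exact absurd (hpu b' hmem) (not_lt.2 (hup.le.trans h4))

/-- Capacitability of continuous images of the Baire space: they are approximated in measure from
inside by compact sets. -/
theorem exists_isCompact_image_measure_le {X : Type*} [TopologicalSpace X]
    [MeasurableSpace X] {μ : Measure X} [μ.OuterRegular]
    {f : (ℕ → ℕ) → X} (hf : Continuous f) (hfin : μ (range f) ≠ ⊤) {ε : ENNReal} (hε : ε ≠ 0) :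
    ∃ C, IsCompact C ∧ C ⊆ range f ∧ μ (range f) ≤ μ C + ε := by
  obtain ⟨δ, hδ, hδε⟩ := ENNReal.exists_pos_sum_of_countable' hε ℕ
  have hstep : ∀ (B : Set (ℕ → ℕ)) (k : ℕ),
      ∃ m, μ (f '' B) ≤ μ (f '' (B ∩ {x | x k ≤ m})) + δ k := by
    intro B k
    have hmono : Monotone fun m : ℕ => f '' (B ∩ {x | x k ≤ m}) := fun m m' h =>
      image_mono (inter_subset_inter_right _ fun x hx => le_trans hx h)
    have hU : ⋃ m : ℕ, f '' (B ∩ {x | x k ≤ m}) = f '' B := by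
      rw [← image_iUnion, ← inter_iUnion]
      congr 1
      exact inter_eq_left.2 fun x _ => mem_iUnion.2 ⟨x k, le_refl (x k)⟩
    have hsup := hmono.measure_iUnion (μ := μ)
    rw [hU] at hsup
    have hfinB : μ (f '' B) ≠ ⊤ := ne_top_of_le_ne_top hfin (measure_mono (image_subset_range f B))
    by_contra! hcon
    rcases eq_or_ne (μ (f '' B)) 0 with h0 | h0
    · exact absurd (hcon 0) (by rw [h0]; exact not_lt_zero)
    · have h1 : μ (f '' B) ≤ μ (f '' B) - δ k := by
        conv_lhs => rw [hsup]
        exact iSup_le fun m => ENNReal.le_sub_of_add_le_right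
          (ne_top_of_lt ((ENNReal.le_tsum k).trans_lt hδε |>.trans_le le_top)) (hcon m).le
      exact absurd h1 (not_le.2 (ENNReal.sub_lt_self hfinB h0 (hδ k).ne'))
  choose m hm using hstep
  let B : ℕ → Set (ℕ → ℕ) := fun k => Nat.rec univ (fun k B => B ∩ {x | x k ≤ m B k}) k
  let n : ℕ → ℕ := fun k => m (B k) k
  have hBsucc : ∀ k, B (k + 1) = B k ∩ {x | x k ≤ n k} := fun k => rfl
  have hB : ∀ k x, x ∈ B k ↔ ∀ i < k, x i ≤ n i := by
    intro k
    induction k with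
    | zero => intro x; exact ⟨fun _ i hi => absurd hi (Nat.not_lt_zero i), fun _ => mem_univ x⟩
    | succ k ih =>
      intro x
      rw [hBsucc, mem_inter_iff, ih, Nat.forall_lt_succ_right]
      rfl
  have hle : ∀ k, μ (range f) ≤ μ (f '' B k) + ∑ i ∈ Finset.range k, δ i := by
    intro k
    induction k with
    | zero => simp [B]
    | succ k ih =>
      rw [Finset.sum_range_succ, add_comm _ (δ k), ← add_assoc]
      exact ih.trans (add_le_add_left (hm (B k) k) _)
  let box : Set (ℕ → ℕ) := univ.pi fun i => Iic (n i)
  have hbox : IsCompact box := isCompact_univ_pi fun i => (finite_Iic (n i)).isCompact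
  refine ⟨f '' box, hbox.image hf, image_subset_range _ _, ?_⟩
  rw [(f '' box).measure_eq_iInf_isOpen μ, ENNReal.iInf_add]
  refine le_iInf fun U => ?_
  rw [ENNReal.iInf_add]
  refine le_iInf fun hU => ?_
  rw [ENNReal.iInf_add]
  refine le_iInf fun hUo => ?_
  obtain ⟨k, hk⟩ : ∃ k, f '' B k ⊆ U := by
    by_contra! hcon
    have : ∀ k, ∃ x ∈ B k, f x ∉ U := fun k => by
      obtain ⟨_, ⟨x, hx, rfl⟩, h⟩ := not_subset.1 (hcon k)
      exact ⟨x, hx, h⟩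
    choose x hxB hxU using this
    obtain ⟨y, hy, φ, hφ, hlim⟩ := hbox.tendsto_subseq (x := fun k i => min (x k i) (n i))
      fun k i _ => (min_le_right (x k i) (n i) :)
    have hlim' : Tendsto (fun k => x (φ k)) atTop (𝓝 y) := by
      rw [tendsto_pi_nhds] at hlim ⊢
      intro i
      refine (hlim i).congr' ?_
      filter_upwards [hφ.tendsto_atTop.eventually_gt_atTop i] with k hk
      exact min_eq_left ((hB _ _).1 (hxB (φ k)) i hk)
    obtain ⟨k, hk⟩ := (hlim'.eventually ((hUo.preimage hf).mem_nhds (hU ⟨y, hy, rfl⟩))).exists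
    exact hxU _ hk
  calc μ (range f) ≤ μ (f '' B k) + ∑ i ∈ Finset.range k, δ i := hle k
    _ ≤ μ U + ε := add_le_add (measure_mono hk) ((ENNReal.sum_le_tsum _).trans hδε.le)

/-- Analytic sets are null measurable for finite measures. -/
theorem MeasureTheory.AnalyticSet.nullMeasurableSet {X : Type*} [TopologicalSpace X] [T2Space X]
    [MeasurableSpace X] [BorelSpace X] {μ : Measure X} [μ.OuterRegular] [IsFiniteMeasure μ]
    {s : Set X} (hs : AnalyticSet s) : NullMeasurableSet s μ := by
  rw [AnalyticSet] at hs
  rcases hs with rfl | ⟨f, hf, rfl⟩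
  · exact MeasurableSet.empty.nullMeasurableSet
  have hpos : ∀ n : ℕ, ((n : ENNReal) + 1)⁻¹ ≠ 0 := fun n => by simp
  choose C hC hCs hCμ using fun n : ℕ =>
    exists_isCompact_image_measure_le hf (measure_ne_top μ _) (hpos n)
  have hD : MeasurableSet (⋃ n, C n) := MeasurableSet.iUnion fun n => (hC n).measurableSet
  have hle : μ (range f) ≤ μ (⋃ n, C n) := by
    have h1 : Tendsto (fun n : ℕ => μ (⋃ n, C n) + ((n : ENNReal) + 1)⁻¹) atTop
        (𝓝 (μ (⋃ n, C n) + 0)) := by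
      refine tendsto_const_nhds.add ?_
      have := (tendsto_add_atTop_iff_nat 1).2 ENNReal.tendsto_inv_nat_nhds_zero
      simpa using this
    rw [add_zero] at h1
    exact ge_of_tendsto' h1 fun n => (hCμ n).trans
      (add_le_add_left (measure_mono (subset_iUnion _ _)) _)
  exact hD.nullMeasurableSet.congr (ae_eq_of_subset_of_measure_ge (iUnion_subset hCs) hle
    hD.nullMeasurableSet (measure_ne_top μ _))

/-- A continuous map on the Baire space has an almost everywhere defined measurable section. -/
theorem exists_measurable_section_ae {X : Type*} [TopologicalSpace X] [T2Space X]
    [MeasurableSpace X] [BorelSpace X] (μ : Measure X) [μ.OuterRegular] [IsFiniteMeasure μ]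
    {f : (ℕ → ℕ) → X} (hf : Continuous f) :
    ∃ s : X → ℕ → ℕ, Measurable s ∧ ∀ᵐ t ∂μ, t ∈ range f → f (s t) = t := by
  let A : List ℕ → Set X := fun l => f '' {x | PiNat.res x l.length = l}
  have hAnull : ∀ l, NullMeasurableSet (A l) μ := by
    intro l
    refine AnalyticSet.nullMeasurableSet ?_
    refine AnalyticSet.image_of_continuous (IsClosed.analyticSet ?_) hf
    by_cases h : ∃ y, PiNat.res y l.length = l
    · obtain ⟨y, hy⟩ := h
      have : {x : ℕ → ℕ | PiNat.res x l.length = l} = {x | ∀ i < l.length, x i = y i} := by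
        ext x
        rw [mem_ofPred_eq, mem_ofPred_eq]
        nth_rewrite 2 [← hy]
        rw [PiNat.res_eq_res]
      rw [this]
      simp only [ofPred_forall]
      exact isClosed_iInter fun i => isClosed_iInter fun _ =>
        isClosed_eq (continuous_apply i) continuous_const
    · have : {x : ℕ → ℕ | PiNat.res x l.length = l} = ∅ := by
        ext x
        simpa using fun hx => h ⟨x, hx⟩
      rw [this]
      exact isClosed_empty
  choose A' hA'A hA'm hA'eq using fun l => (hAnull l).exists_measurable_subset_ae_eq
  let first : List ℕ → X → ℕ := fun l t => sInf {m | t ∈ A' (m :: l)}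
  have hfirst : ∀ l m, MeasurableSet {t | first l t = m} := by
    intro l m
    have : {t | first l t = m} = (A' (m :: l) ∩ ⋂ k, ⋂ (_ : k < m), (A' (k :: l))ᶜ) ∪
        ((⋂ k, (A' (k :: l))ᶜ) ∩ {_t | m = 0}) := by
      ext t
      simp only [first, mem_ofPred_eq, mem_union, mem_inter_iff, mem_iInter, mem_compl_iff]
      constructor
      · intro h
        by_cases hne : {m | t ∈ A' (m :: l)}.Nonempty
        · left
          refine ⟨h ▸ Nat.sInf_mem hne, fun k hk => ?_⟩
          exact Nat.notMem_of_lt_sInf (h.symm ▸ hk)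
        · right
          rw [not_nonempty_iff_eq_empty] at hne
          exact ⟨fun k hk => (hne ▸ (show k ∈ {m | t ∈ A' (m :: l)} from hk) : k ∈ (∅ : Set ℕ)),
            by rw [← h, hne, Nat.sInf_empty]⟩
      · rintro (⟨h1, h2⟩ | ⟨h1, rfl⟩)
        · refine le_antisymm (Nat.sInf_le h1) (le_of_not_gt fun h => h2 _ h ?_)
          exact Nat.sInf_mem (s := {m | t ∈ A' (m :: l)}) ⟨m, h1⟩
        · have : {m | t ∈ A' (m :: l)} = ∅ := eq_empty_of_forall_notMem h1
          rw [this, Nat.sInf_empty]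
    rw [this]
    exact ((hA'm _).inter (MeasurableSet.iInter fun k => MeasurableSet.iInter fun _ =>
      (hA'm _).compl)).union ((MeasurableSet.iInter fun k => (hA'm _).compl).inter
        (MeasurableSet.const _))
  let L : X → ℕ → List ℕ := fun t k => Nat.rec [] (fun _ l => first l t :: l) k
  have hLsucc : ∀ t k, L t (k + 1) = first (L t k) t :: L t k := fun t k => rfl
  have hLlen : ∀ t k, (L t k).length = k := by
    intro t k
    induction k with
    | zero => rfl
    | succ k ih => rw [hLsucc, List.length_cons, ih]
  have hLm : ∀ k l, MeasurableSet {t | L t k = l} := by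
    intro k
    induction k with
    | zero => exact fun l => (MeasurableSet.const (([] : List ℕ) = l) :)
    | succ k ih =>
      intro l
      rcases l with _ | ⟨m, l⟩
      · simp [hLsucc]
      · have : {t | L t (k + 1) = m :: l} = {t | first l t = m} ∩ {t | L t k = l} := by
          ext t
          simp only [hLsucc, mem_ofPred_eq, List.cons.injEq, mem_inter_iff]
          constructor
          · rintro ⟨h1, h2⟩; rw [h2] at h1; exact ⟨h1, h2⟩
          · rintro ⟨h1, h2⟩; rw [h2]; exact ⟨h1, rfl⟩
        rw [this]
        exact (hfirst l m).inter (ih l)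
  refine ⟨fun t k => first (L t k) t, ?_, ?_⟩
  · refine measurable_pi_lambda _ fun k => measurable_to_countable' fun m => ?_
    have : (fun t => first (L t k) t) ⁻¹' {m} = ⋃ l, {t | first l t = m} ∩ {t | L t k = l} := by
      ext t
      simp
    rw [this]
    exact MeasurableSet.iUnion fun l => (hfirst l m).inter (hLm k l)
  · have hall : ∀ᵐ t ∂μ, ∀ l, t ∈ A l → t ∈ A' l := by
      rw [ae_all_iff]
      intro l
      filter_upwards [(hA'eq l).mem_iff] with t ht h using ht.2 h
    filter_upwards [hall] with t ht htf
    have hres : ∀ k, PiNat.res (fun k => first (L t k) t) k = L t k := by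
      intro k
      induction k with
      | zero => rfl
      | succ k ih => rw [PiNat.res_succ, ih, hLsucc]
    have hmem : ∀ k, t ∈ A (L t k) := by
      intro k
      induction k with
      | zero =>
        obtain ⟨x, hx⟩ := htf
        exact ⟨x, by simp [L], hx⟩
      | succ k ih =>
        obtain ⟨x, hx, hxt⟩ := ih
        have : t ∈ A' (x k :: L t k) := ht _ ⟨x, by
          rw [mem_ofPred_eq, hLlen] at hx
          rw [mem_ofPred_eq, List.length_cons, hLlen, PiNat.res_succ, hx], hxt⟩
        rw [hLsucc]
        exact hA'A _ (Nat.sInf_mem (s := {m | t ∈ A' (m :: L t k)}) ⟨_, this⟩)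
    choose x hx hxt using hmem
    have hlim : Tendsto x atTop (𝓝 fun k => first (L t k) t) := by
      rw [tendsto_pi_nhds]
      intro i
      refine tendsto_const_nhds.congr' ?_
      filter_upwards [eventually_gt_atTop i] with k hk
      have h1 := hx k
      rw [mem_ofPred_eq, hLlen, ← hres k, PiNat.res_eq_res] at h1
      exact (h1 hk).symm
    have h2 := (hf.tendsto _).comp hlim
    have h3 : f ∘ x = fun _ => t := funext hxt
    rw [h3] at h2
    exact tendsto_nhds_unique tendsto_const_nhds h2 |>.symm

/-- The **Jankov–von Neumann** measurable selection theorem, almost everywhere version. -/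
theorem exists_measurable_selection_ae {X E : Type*} [TopologicalSpace X] [PolishSpace X]
    [MeasurableSpace X] [BorelSpace X] [TopologicalSpace E] [PolishSpace E] [MeasurableSpace E]
    [BorelSpace E] [Nonempty E] (μ : Measure X) [μ.OuterRegular] [IsFiniteMeasure μ]
    {G : Set (X × E)} (hG : MeasurableSet G) :
    ∃ g : X → E, Measurable g ∧ ∀ᵐ t ∂μ, (∃ a, (t, a) ∈ G) → (t, g t) ∈ G := by
  have hG' := hG.analyticSet
  rw [AnalyticSet] at hG'
  rcases hG' with rfl | ⟨f, hf, rfl⟩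
  · obtain ⟨a⟩ := ‹Nonempty E›
    exact ⟨fun _ => a, measurable_const, by simp⟩
  obtain ⟨s, hs, hsf⟩ := exists_measurable_section_ae μ (continuous_fst.comp hf)
  refine ⟨fun t => (f (s t)).2, (continuous_snd.comp hf).measurable.comp hs, ?_⟩
  filter_upwards [hsf] with t ht
  rintro ⟨a, x, hx⟩
  have h1 : (f (s t)).1 = t := ht ⟨x, by simp [hx]⟩
  exact ⟨s t, Prod.ext h1 rfl⟩

/-- Measurable projection: the projection of a measurable set is null measurable. -/
theorem MeasurableSet.nullMeasurableSet_image_fst {X E : Type*} [TopologicalSpace X] [PolishSpace X]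
    [MeasurableSpace X] [BorelSpace X] [TopologicalSpace E] [PolishSpace E] [MeasurableSpace E]
    [BorelSpace E] {μ : Measure X} [μ.OuterRegular] [IsFiniteMeasure μ]
    {G : Set (X × E)} (hG : MeasurableSet G) : NullMeasurableSet (Prod.fst '' G) μ :=
  (hG.analyticSet.image_of_continuous continuous_fst).nullMeasurableSet

/-- The dual of a separable normed space contains a separating sequence. -/
theorem exists_seq_dual_separating (E : Type*) [NormedAddCommGroup E] [NormedSpace ℝ E]
    [TopologicalSpace.SeparableSpace E] :
    ∃ d : ℕ → E →L[ℝ] ℝ, ∀ a b, (∀ k, d k a = d k b) → a = b := by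
  choose g hg1 hg using fun x : E => exists_dual_vector'' ℝ x
  refine ⟨fun k => g (TopologicalSpace.denseSeq E k), fun a b hab => ?_⟩
  rw [← sub_eq_zero, ← norm_le_zero_iff]
  refine le_of_forall_pos_le_add fun ε hε => ?_
  obtain ⟨k, hk⟩ := (TopologicalSpace.denseRange_denseSeq E).exists_dist_lt (a - b) (half_pos hε)
  set x := TopologicalSpace.denseSeq E k
  rw [dist_eq_norm] at hk
  have h1 : g x (a - b) = 0 := by rw [map_sub, hab k, sub_self]
  have h2 : ‖x‖ ≤ ‖a - b - x‖ := by
    have h3 : g x (a - b - x) = -‖x‖ := by rw [map_sub, h1, hg, zero_sub]; rfl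
    have h4 := (g x).le_of_opNorm_le (hg1 x) (a - b - x)
    rw [h3, norm_neg, norm_norm, one_mul] at h4
    exact h4
  have h5 : ‖a - b‖ ≤ ‖a - b - x‖ + ‖x‖ := by simpa using norm_add_le (a - b - x) x
  linarith

/-- A map into a separable Banach space is a.e. measurable as soon as it is so when tested against
a separating sequence of functionals. -/
theorem aemeasurable_of_separating {X E : Type*} [MeasurableSpace X] {μ : Measure X}
    [NormedAddCommGroup E] [NormedSpace ℝ E] [CompleteSpace E]
    [TopologicalSpace.SeparableSpace E] [MeasurableSpace E] [BorelSpace E]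
    {d : ℕ → E →L[ℝ] ℝ} (hd : ∀ a b, (∀ k, d k a = d k b) → a = b)
    {g : X → E} (hg : ∀ k, AEMeasurable (fun t => d k (g t)) μ) : AEMeasurable g μ := by
  have hm : Measurable fun (a : E) (k : ℕ) => d k a :=
    measurable_pi_lambda _ fun k => (d k).continuous.measurable
  have hme : MeasurableEmbedding fun (a : E) (k : ℕ) => d k a :=
    hm.measurableEmbedding fun a b h => hd a b fun k => congrFun h k
  rw [← hme.aemeasurable_comp_iff]
  exact aemeasurable_pi_lambda _ hg

/-- A sequence of real numbers is the sequence of values of linear functionals at a point of a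
compact convex set as soon as it satisfies all rational support inequalities. -/
theorem exists_mem_forall_eq_of_forall_rat {X : Type*} [AddCommGroup X] [Module ℝ X]
    [TopologicalSpace X] {K : Set X} (hK : IsCompact K) (hKc : Convex ℝ K)
    {d : ℕ → X →ₗ[ℝ] ℝ} (hd : ∀ k, ContinuousOn (d k) K) {h : ℕ → ℝ}
    (hq : ∀ (m : ℕ) (q : Fin m → ℚ), ∃ a ∈ K, ∑ i, (q i : ℝ) * h i ≤ ∑ i, (q i : ℝ) * d i a) :
    ∃ a ∈ K, ∀ k, d k a = h k := by
  have hfin : ∀ m : ℕ, ∃ a ∈ K, ∀ i : Fin m, d i a = h i := by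
    intro m
    let D : X →ₗ[ℝ] (Fin m → ℝ) := LinearMap.pi fun i => d i
    have hDc : ContinuousOn D K := continuousOn_pi.2 fun i => hd i
    have hcomp : IsCompact (D '' K) := hK.image_of_continuousOn hDc
    by_contra! hcon
    have hnot : (fun i : Fin m => h i) ∉ D '' K := by
      rintro ⟨a, ha, hah⟩
      obtain ⟨i, hi⟩ := hcon a ha
      exact hi (congrFun hah i)
    obtain ⟨f, u, hfu, hub⟩ := geometric_hahn_banach_point_closed (hKc.linear_image D)
      hcomp.isClosed hnot
    have hf : ∀ y : Fin m → ℝ, f y = ∑ i, f (Pi.single i 1) * y i := by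
      intro y
      conv_lhs => rw [pi_eq_sum_univ' y]
      rw [map_sum]
      refine Finset.sum_congr rfl fun i _ => ?_
      rw [map_smul, smul_eq_mul, mul_comm]
    have hdense : DenseRange fun (q : Fin m → ℚ) (i : Fin m) => (q i : ℝ) :=
      DenseRange.piMap fun _ => Rat.denseRange_cast
    obtain ⟨c, hc, hclim⟩ := mem_closure_iff_seq_limit.1
      (hdense fun i => -f (Pi.single i 1))
    choose q hqc using hc
    choose a haK ha using fun n => hq m (q n)
    obtain ⟨b, hb, φ, hφ, hlim⟩ := hcomp.tendsto_subseq fun n => mem_image_of_mem D (haK n)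
    have hc2 := hclim.comp hφ.tendsto_atTop
    rw [tendsto_pi_nhds] at hc2 hlim
    have hle : ∑ i, -f (Pi.single i 1) * h i ≤ ∑ i, -f (Pi.single i 1) * b i := by
      refine le_of_tendsto_of_tendsto'
        (tendsto_finsetSum Finset.univ fun i _ => (hc2 i).mul_const (h i))
        (tendsto_finsetSum Finset.univ fun i _ => (hc2 i).mul (hlim i)) fun n => ?_
      have := ha (φ n)
      simp only [Function.comp_apply, ← hqc]
      exact this
    have h1 := hub b hb
    rw [hf] at hfu h1
    simp only [neg_mul, Finset.sum_neg_distrib] at hle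
    linarith
  let D : X → (ℕ → ℝ) := fun a k => d k a
  have hDc : ContinuousOn D K := continuousOn_pi.2 fun k => hd k
  have hcomp : IsCompact (D '' K) := hK.image_of_continuousOn hDc
  have hcl : ∀ m, IsClosed {y : ℕ → ℝ | ∀ i : Fin m, y i = h i} := fun m => by
    rw [Set.ofPred_forall]
    exact isClosed_iInter fun i => isClosed_eq (continuous_apply _) continuous_const
  obtain ⟨y, hy⟩ := IsCompact.nonempty_iInter_of_sequence_nonempty_isCompact_isClosed
    (fun m => D '' K ∩ {y : ℕ → ℝ | ∀ i : Fin m, y i = h i})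
    (fun m => inter_subset_inter_right _ fun y hy i => hy (Fin.castSucc i))
    (fun m => by
      obtain ⟨a, ha, hah⟩ := hfin m
      exact ⟨D a, mem_image_of_mem D ha, hah⟩)
    (hcomp.inter_right (hcl 0)) (fun m => hcomp.isClosed.inter (hcl m))
  rw [mem_iInter] at hy
  obtain ⟨a, ha, rfl⟩ := (hy 0).1
  exact ⟨a, ha, fun k => (hy (k + 1)).2 (Fin.last k)⟩

/-- Weak sequential compactness of order bounded sets in `L¹`, in ultrafilter form. -/
theorem exists_integrable_ultrafilter_limit {X : Type*} [MeasurableSpace X] {μ : Measure X}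
    [IsFiniteMeasure μ] {ψ : X → ℝ} (hψ : Integrable ψ μ) {u : ℕ → X → ℝ}
    (hu : ∀ n, AEStronglyMeasurable (u n) μ) (hb : ∀ n, ∀ᵐ t ∂μ, |u n t| ≤ ψ t)
    (𝒰 : Ultrafilter ℕ) :
    ∃ h : X → ℝ, Integrable h μ ∧ ∀ w : X → ℝ, AEStronglyMeasurable w μ →
      (∀ᵐ t ∂μ, |w t| ≤ 1) →
        Tendsto (fun n => ∫ t, w t * u n t ∂μ) 𝒰 (𝓝 (∫ t, w t * h t ∂μ)) := by
  let r : X → ℝ := fun t => √(1 + |ψ t|)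
  have hr0 : ∀ t, 0 < r t := fun t => Real.sqrt_pos.2 (by positivity)
  have hr2 : ∀ t, r t ^ 2 = 1 + |ψ t| := fun t => Real.sq_sqrt (by positivity)
  have hrm : AEStronglyMeasurable r μ :=
    (Real.continuous_sqrt.comp_aestronglyMeasurable
      (aestronglyMeasurable_const.add hψ.abs.aestronglyMeasurable))
  have hr2i : Integrable (fun t => r t ^ 2) μ := by
    simp only [hr2]
    exact (integrable_const 1).add hψ.abs
  have hF : ∀ n, MemLp (fun t => u n t / r t) 2 μ := by
    intro n
    have hm : AEStronglyMeasurable (fun t => u n t / r t) μ :=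
      ((hu n).aemeasurable.div hrm.aemeasurable).aestronglyMeasurable
    rw [memLp_two_iff_integrable_sq hm]
    refine hr2i.mono' (hm.pow 2) ?_
    filter_upwards [hb n] with t ht
    rw [Real.norm_of_nonneg (sq_nonneg _), div_pow, div_le_iff₀ (by have := hr0 t; positivity), hr2]
    have h1 : |u n t| ≤ 1 + |ψ t| := by linarith [le_abs_self (ψ t)]
    nlinarith [sq_abs (u n t), abs_nonneg (u n t)]
  have hFn : ∀ n, ‖(hF n).toLp‖ ^ 2 ≤ ∫ t, r t ^ 2 ∂μ := by
    intro n
    rw [← real_inner_self_eq_norm_sq, L2.inner_def]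
    refine integral_mono_ae (L2.integrable_inner _ _) hr2i ?_
    filter_upwards [hb n, (hF n).coeFn_toLp] with t ht h0
    rw [h0, real_inner_self_eq_norm_sq, Real.norm_eq_abs, sq_abs, div_pow,
      div_le_iff₀ (by have := hr0 t; positivity), hr2]
    have h1 : |u n t| ≤ 1 + |ψ t| := by linarith [le_abs_self (ψ t)]
    nlinarith [sq_abs (u n t), abs_nonneg (u n t)]
  let R : ℝ := √(∫ t, r t ^ 2 ∂μ)
  let T : ℕ → WeakDual ℝ (Lp ℝ 2 μ) := fun n =>
    StrongDual.toWeakDual (InnerProductSpace.toDual ℝ _ (hF n).toLp)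
  have hT : ∀ n, T n ∈ WeakDual.toStrongDual ⁻¹'
      Metric.closedBall (0 : StrongDual ℝ (Lp ℝ 2 μ)) R := by
    intro n
    rw [mem_preimage, mem_closedBall_zero_iff]
    have : ‖WeakDual.toStrongDual (T n)‖ = ‖(hF n).toLp‖ :=
      (InnerProductSpace.toDual ℝ _).norm_map _
    rw [this]
    exact Real.le_sqrt_of_sq_le (hFn n)
  obtain ⟨T₀, -, hT₀⟩ := (WeakDual.isCompact_closedBall
    (0 : StrongDual ℝ (Lp ℝ 2 μ)) R).ultrafilter_le_nhds
    (𝒰.map T) (le_principal_iff.2 (Filter.mem_map.2 (univ_mem' hT)))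
  let v : Lp ℝ 2 μ := (InnerProductSpace.toDual ℝ _).symm (WeakDual.toStrongDual T₀)
  have hrL : MemLp r 2 μ := (memLp_two_iff_integrable_sq hrm).2 hr2i
  refine ⟨fun t => r t * v t, hrL.integrable_mul (Lp.memLp v), fun w hw hw1 => ?_⟩
  have hwr : MemLp (fun t => w t * r t) 2 μ := by
    refine hrL.mono (hw.mul hrm) ?_
    filter_upwards [hw1] with t ht
    rw [norm_mul, Real.norm_eq_abs]
    exact mul_le_of_le_one_left (norm_nonneg _) ht
  have hlim : Tendsto (fun n => T n hwr.toLp) 𝒰 (𝓝 (T₀ hwr.toLp)) :=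
    ((WeakDual.eval_continuous hwr.toLp).tendsto T₀).comp hT₀
  have h1 : ∀ n, T n hwr.toLp = ∫ t, w t * u n t ∂μ := by
    intro n
    have : T n hwr.toLp = inner ℝ (hF n).toLp hwr.toLp := rfl
    rw [this, L2.inner_def]
    refine integral_congr_ae ?_
    filter_upwards [(hF n).coeFn_toLp, hwr.coeFn_toLp] with t h1 h2
    rw [h1, h2]
    have := (hr0 t).ne'
    rw [Real.inner_apply]
    field_simp
  have h2 : T₀ hwr.toLp = ∫ t, w t * (r t * v t) ∂μ := by
    have : T₀ hwr.toLp = inner ℝ v hwr.toLp := by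
      rw [InnerProductSpace.toDual_symm_apply]; rfl
    rw [this, L2.inner_def]
    refine integral_congr_ae ?_
    filter_upwards [hwr.coeFn_toLp] with t h2
    rw [h2, Real.inner_apply]
    ring
  rw [h2] at hlim
  exact hlim.congr h1

/-- A weak limit of integrable functions is a.e. bounded by the upper envelope of the tails. -/
theorem ae_forall_le_of_tendsto_setIntegral {X : Type*} [MeasurableSpace X] {μ : Measure X}
    [IsFiniteMeasure μ] {u : ℕ → X → ℝ} (hu : ∀ n, Measurable (u n))
    (hui : ∀ n, Integrable (u n) μ) {h : X → ℝ} (hh : Integrable h μ) {l : Filter ℕ} [l.NeBot]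
    (hl : l ≤ atTop)
    (hlim : ∀ A, MeasurableSet A → Tendsto (fun n => ∫ t in A, u n t ∂μ) l (𝓝 (∫ t in A, h t ∂μ))) :
    ∀ᵐ t ∂μ, ∀ (N : ℕ) (c : ℝ), (∀ n ≥ N, u n t ≤ c) → h t ≤ c := by
  have key : ∀ᵐ t ∂μ, ∀ (N : ℕ) (c : ℚ), (∀ n ≥ N, u n t ≤ c) → h t ≤ c := by
    rw [ae_all_iff]
    intro N
    rw [ae_all_iff]
    intro c
    let h' := hh.1.aemeasurable.mk h
    have hh' : h =ᵐ[μ] h' := hh.1.aemeasurable.ae_eq_mk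
    have hm' : Measurable h' := hh.1.aemeasurable.measurable_mk
    let A : Set X := (⋂ n, ⋂ (_ : n ≥ N), {t | u n t ≤ c}) ∩ {t | (c : ℝ) < h' t}
    have hA : MeasurableSet A :=
      (MeasurableSet.iInter fun n => MeasurableSet.iInter fun _ =>
        measurableSet_le (hu n) measurable_const).inter (measurableSet_lt measurable_const hm')
    have h1 : ∫ t in A, h t ∂μ ≤ ∫ _t in A, (c : ℝ) ∂μ := by
      refine le_of_tendsto (hlim A hA) (hl ?_)
      filter_upwards [eventually_ge_atTop N] with n hn
      refine setIntegral_mono_on (hui n).integrableOn (integrable_const _).integrableOn hA ?_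
      rintro t ⟨ht, -⟩
      exact mem_iInter₂.1 ht n hn
    have h2 : ∫ t in A, (h' t - c) ∂μ ≤ 0 := by
      have h3 : Integrable h' μ := hh.congr hh'
      rw [integral_sub h3.integrableOn (integrable_const _).integrableOn,
        ← integral_congr_ae (ae_restrict_of_ae hh')]
      linarith
    have h4 : 0 ≤ᵐ[μ.restrict A] fun t => h' t - c := by
      filter_upwards [ae_restrict_mem hA] with t ht
      exact sub_nonneg.2 (le_of_lt ht.2)
    have h5 : (fun t => h' t - c) =ᵐ[μ.restrict A] 0 := by
      rw [← integral_eq_zero_iff_of_nonneg_ae h4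
        ((hh.congr hh').sub (integrable_const _)).integrableOn]
      exact le_antisymm h2 (integral_nonneg_of_ae h4)
    have h6 := (ae_restrict_iff' hA).1 h5
    filter_upwards [h6, hh'] with t ht hth hN
    by_contra! hcon
    rw [hth] at hcon
    have := ht ⟨mem_iInter₂.2 hN, hcon⟩
    simp only [Pi.zero_apply] at this
    linarith
  filter_upwards [key] with t ht N c hc
  refine le_of_forall_gt_imp_ge_of_dense fun b hb => ?_
  obtain ⟨q, hq1, hq2⟩ := exists_rat_btwn hb
  exact (ht N q fun n hn => (hc n hn).trans hq1.le).trans hq2.le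

/-- Measurable almost everywhere selections of a correspondence. -/
def IsSelection {X E : Type*} [MeasurableSpace X] [MeasurableSpace E] (μ : Measure X)
    (S : X → Set E) (f : X → E) : Prop :=
  Measurable f ∧ ∀ᵐ t ∂μ, f t ∈ S t

theorem IsSelection.integrable {X E : Type*} [MeasurableSpace X] [MeasurableSpace E]
    [NormedAddCommGroup E] [SecondCountableTopology E] [BorelSpace E]
    {μ : Measure X} {S : X → Set E} {φ : X → ℝ} (hφ : Integrable φ μ)
    (hb : ∀ᵐ t ∂μ, ∀ a ∈ S t, ‖a‖ ≤ φ t) {f : X → E} (hf : IsSelection μ S f) :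
    Integrable f μ := by
  refine hφ.mono' hf.1.aestronglyMeasurable ?_
  filter_upwards [hf.2, hb] with t h1 h2 using h2 _ h1

/-- A continuous linear functional is weakly continuous. -/
theorem ContinuousLinearMap.continuous_comp_toWeakSpace_symm {E : Type*} [NormedAddCommGroup E]
    [NormedSpace ℝ E] (x : E →L[ℝ] ℝ) :
    Continuous fun a : WeakSpace ℝ E => x ((toWeakSpace ℝ E).symm a) :=
  WeakBilin.eval_continuous (topDualPairing ℝ E).flip x

/-- The support-inequality criterion in a weakly compact convex set. -/
theorem exists_mem_forall_eq_of_forall_rat_weak {E : Type*} [NormedAddCommGroup E]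
    [NormedSpace ℝ E] {K : Set E} (hK : IsCompact (toWeakSpace ℝ E '' K)) (hKc : Convex ℝ K)
    {d : ℕ → E →L[ℝ] ℝ} {h : ℕ → ℝ}
    (hq : ∀ (m : ℕ) (q : Fin m → ℚ), ∃ a ∈ K, ∑ i, (q i : ℝ) * h i ≤ ∑ i, (q i : ℝ) * d i a) :
    ∃ a ∈ K, ∀ k, d k a = h k := by
  obtain ⟨_, ⟨a, ha, rfl⟩, had⟩ := exists_mem_forall_eq_of_forall_rat (h := h)
    (d := fun k => (d k).toLinearMap ∘ₗ (toWeakSpace ℝ E).symm.toLinearMap) hK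
    (hKc.linear_image (toWeakSpace ℝ E).toLinearMap)
    (fun k => (d k).continuous_comp_toWeakSpace_symm.continuousOn) (fun m q => by
      obtain ⟨a, ha, h⟩ := hq m q
      exact ⟨_, mem_image_of_mem _ ha, by simpa using h⟩)
  exact ⟨a, ha, fun k => by simpa using had k⟩

theorem exists_isMaxOn_of_weakly_compact {E : Type*} [NormedAddCommGroup E]
    [NormedSpace ℝ E] {K : Set E} (hK : IsCompact (toWeakSpace ℝ E '' K)) (hne : K.Nonempty)
    {v : E → ℝ} (hv : ContinuousOn (fun a => v ((toWeakSpace ℝ E).symm a)) (toWeakSpace ℝ E '' K)) :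
    ∃ a ∈ K, ∀ b ∈ K, v b ≤ v a := by
  obtain ⟨_, ⟨a, ha, rfl⟩, hmax⟩ := hK.exists_isMaxOn (hne.image _) hv
  refine ⟨a, ha, fun b hb => ?_⟩
  simpa using hmax (mem_image_of_mem _ hb)

theorem setIntegral_eq_integral_indicator_one_mul {X : Type*} [MeasurableSpace X] {μ : Measure X}
    {A : Set X} (hA : MeasurableSet A) (u : X → ℝ) :
    ∫ t, A.indicator 1 t * u t ∂μ = ∫ t in A, u t ∂μ := by
  rw [← integral_indicator hA]
  congr 1 with t
  by_cases ht : t ∈ A <;> simp [ht]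

theorem abs_indicator_one_le {X : Type*} (A : Set X) (t : X) :
    |A.indicator (1 : X → ℝ) t| ≤ 1 := by
  by_cases ht : t ∈ A <;> simp [ht]

/-- Weak ultrafilter limits of selections, tested against a separating sequence of functionals. -/
theorem exists_isSelection_ultrafilter_limit_seq {X E : Type*} [MeasurableSpace X]
    {μ : Measure X} [IsFiniteMeasure μ] [NormedAddCommGroup E] [NormedSpace ℝ E] [CompleteSpace E]
    [TopologicalSpace.SeparableSpace E] [MeasurableSpace E] [BorelSpace E]
    {S : X → Set E} {φ : X → ℝ} (hφ : Integrable φ μ) (hb : ∀ᵐ t ∂μ, ∀ a ∈ S t, ‖a‖ ≤ φ t)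
    (hSc : ∀ᵐ t ∂μ, Convex ℝ (S t)) (hSk : ∀ᵐ t ∂μ, IsCompact (toWeakSpace ℝ E '' S t))
    {d : ℕ → E →L[ℝ] ℝ} (hd : ∀ a b, (∀ k, d k a = d k b) → a = b)
    {f : ℕ → X → E} (hf : ∀ n, IsSelection μ S (f n)) (𝒰 : Ultrafilter ℕ)
    (h𝒰 : (𝒰 : Filter ℕ) ≤ atTop) :
    ∃ g, IsSelection μ S g ∧ ∀ k, ∀ w : X → ℝ, AEStronglyMeasurable w μ →
      (∀ᵐ t ∂μ, |w t| ≤ 1) →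
        Tendsto (fun n => ∫ t, w t * d k (f n t) ∂μ) 𝒰 (𝓝 (∫ t, w t * d k (g t) ∂μ)) := by
  have hsc : SecondCountableTopology E := UniformSpace.secondCountable_of_separable E
  have hfi : ∀ n, Integrable (f n) μ := fun n => (hf n).integrable hφ hb
  have hlim := fun k => exists_integrable_ultrafilter_limit (hφ.const_mul ‖d k‖)
    (u := fun n t => d k (f n t))
    (fun n => ((d k).integrable_comp (hfi n)).aestronglyMeasurable)
    (fun n => by
      filter_upwards [(hf n).2, hb] with t h1 h2
      exact (d k).le_of_opNorm_le_of_le le_rfl (h2 _ h1)) 𝒰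
  choose h hhi hh using hlim
  have hrat : ∀ᵐ t ∂μ, ∀ (m : ℕ) (q : Fin m → ℚ), ∀ (N : ℕ) (c : ℝ),
      (∀ n ≥ N, ∑ i, (q i : ℝ) * d i (f n t) ≤ c) → ∑ i, (q i : ℝ) * h i t ≤ c := by
    rw [ae_all_iff]
    intro m
    rw [ae_all_iff]
    intro q
    have hi1 : ∀ (i : Fin m) n, Integrable (fun t => (q i : ℝ) * d i (f n t)) μ := fun i n =>
      ((d i).integrable_comp (hfi n)).const_mul _
    have hi2 : ∀ i : Fin m, Integrable (fun t => (q i : ℝ) * h i t) μ := fun i =>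
      (hhi i).const_mul _
    refine ae_forall_le_of_tendsto_setIntegral
      (u := fun n t => ∑ i, (q i : ℝ) * d i (f n t)) (l := 𝒰)
      (fun n => Finset.measurable_sum _ fun i _ =>
        ((d i).continuous.measurable.comp (hf n).1).const_mul _)
      (fun n => integrable_finsetSum _ fun i _ => hi1 i n)
      (integrable_finsetSum _ fun i _ => hi2 i) h𝒰 fun A hA => ?_
    simp only [integral_finsetSum _ fun i _ => (hi1 i _).integrableOn,
      integral_finsetSum _ fun i _ => (hi2 i).integrableOn, integral_const_mul]
    refine tendsto_finsetSum _ fun i _ => Tendsto.const_mul _ ?_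
    have := hh i (A.indicator 1) (measurable_one.indicator hA).aestronglyMeasurable
      (Eventually.of_forall (abs_indicator_one_le A))
    simpa only [setIntegral_eq_integral_indicator_one_mul hA] using this
  have hex : ∀ᵐ t ∂μ, ∃ a ∈ S t, ∀ k, d k a = h k t := by
    filter_upwards [hrat, hSc, hSk, ae_all_iff.2 fun n => (hf n).2] with t ht hc hk hft
    refine exists_mem_forall_eq_of_forall_rat_weak hk hc fun m q => ?_
    obtain ⟨a, ha, hmax⟩ := exists_isMaxOn_of_weakly_compact hk ⟨_, hft 0⟩
      (v := fun a => ∑ i, (q i : ℝ) * d i a)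
      (continuous_finsetSum _ fun (i : Fin m) _ =>
        (d i).continuous_comp_toWeakSpace_symm.const_mul (q i : ℝ)).continuousOn
    exact ⟨a, ha, ht m q 0 _ fun n _ => hmax _ (hft n)⟩
  classical
  let g₀ : X → E := fun t => if ht : ∃ a ∈ S t, ∀ k, d k a = h k t then ht.choose else 0
  have hg₀ : ∀ᵐ t ∂μ, g₀ t ∈ S t ∧ ∀ k, d k (g₀ t) = h k t := by
    filter_upwards [hex] with t ht
    simp only [g₀, dif_pos ht]
    exact ht.choose_spec
  have hg₀m : AEMeasurable g₀ μ := aemeasurable_of_separating hd fun k =>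
    (hhi k).aestronglyMeasurable.aemeasurable.congr (by
      filter_upwards [hg₀] with t ht using (ht.2 k).symm)
  have hgg := hg₀m.ae_eq_mk
  refine ⟨hg₀m.mk g₀, ⟨hg₀m.measurable_mk, ?_⟩, fun k w hw hw1 => ?_⟩
  · filter_upwards [hg₀, hgg] with t h1 h2
    rw [← h2]
    exact h1.1
  · have : ∫ t, w t * d k (hg₀m.mk g₀ t) ∂μ = ∫ t, w t * h k t ∂μ := by
      refine integral_congr_ae ?_
      filter_upwards [hg₀, hgg] with t h1 h2
      rw [← h2, h1.2 k]
    rw [this]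
    exact hh k w hw hw1

/-- Weak ultrafilter limits of selections. -/
theorem exists_isSelection_ultrafilter_limit {X E : Type*} [MeasurableSpace X]
    {μ : Measure X} [IsFiniteMeasure μ] [NormedAddCommGroup E] [NormedSpace ℝ E] [CompleteSpace E]
    [TopologicalSpace.SeparableSpace E] [MeasurableSpace E] [BorelSpace E]
    {S : X → Set E} {φ : X → ℝ} (hφ : Integrable φ μ) (hb : ∀ᵐ t ∂μ, ∀ a ∈ S t, ‖a‖ ≤ φ t)
    (hSc : ∀ᵐ t ∂μ, Convex ℝ (S t)) (hSk : ∀ᵐ t ∂μ, IsCompact (toWeakSpace ℝ E '' S t))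
    {f : ℕ → X → E} (hf : ∀ n, IsSelection μ S (f n)) (𝒰 : Ultrafilter ℕ)
    (h𝒰 : (𝒰 : Filter ℕ) ≤ atTop) :
    ∃ g, IsSelection μ S g ∧ ∀ (x : E →L[ℝ] ℝ) (w : X → ℝ), AEStronglyMeasurable w μ →
      (∀ᵐ t ∂μ, |w t| ≤ 1) →
        Tendsto (fun n => ∫ t, w t * x (f n t) ∂μ) 𝒰 (𝓝 (∫ t, w t * x (g t) ∂μ)) := by
  have hsc : SecondCountableTopology E := UniformSpace.secondCountable_of_separable E
  obtain ⟨d, hd⟩ := exists_seq_dual_separating E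
  obtain ⟨g, hg, hlim⟩ := exists_isSelection_ultrafilter_limit_seq hφ hb hSc hSk hd hf 𝒰 h𝒰
  refine ⟨g, hg, fun x w hw hw1 => ?_⟩
  let d' : ℕ → E →L[ℝ] ℝ := fun k => Nat.casesOn k x d
  obtain ⟨g', hg', hlim'⟩ := exists_isSelection_ultrafilter_limit_seq hφ hb hSc hSk (d := d')
    (fun a b hab => hd a b fun k => hab (k + 1)) hf 𝒰 h𝒰
  have heq : ∀ k, ∀ᵐ t ∂μ, d k (g t) = d k (g' t) := by
    intro k
    refine ((d k).integrable_comp (hg.integrable hφ hb)).ae_eq_of_forall_setIntegral_eq _ _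
      ((d k).integrable_comp (hg'.integrable hφ hb)) fun A hA _ => ?_
    have hw := (measurable_one.indicator hA : Measurable (A.indicator (1 : X → ℝ)))
    have hw1 : ∀ᵐ t ∂μ, |A.indicator (1 : X → ℝ) t| ≤ 1 :=
      Eventually.of_forall (abs_indicator_one_le A)
    have h1 := tendsto_nhds_unique (hlim k _ hw.aestronglyMeasurable hw1)
      (hlim' (k + 1) _ hw.aestronglyMeasurable hw1)
    simp only [setIntegral_eq_integral_indicator_one_mul hA] at h1
    exact h1
  have hgg : ∀ᵐ t ∂μ, g t = g' t := by
    filter_upwards [ae_all_iff.2 heq] with t ht using hd _ _ ht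
  have : ∫ t, w t * x (g t) ∂μ = ∫ t, w t * x (g' t) ∂μ := by
    refine integral_congr_ae ?_
    filter_upwards [hgg] with t ht
    rw [ht]
  rw [this]
  exact hlim' 0 w hw hw1

/-- Integrable functions on the line are determined by their integrals over rational half-lines. -/
theorem ae_eq_of_forall_setIntegral_Iic_rat_eq {μ : Measure ℝ} {u v : ℝ → ℝ}
    (hu : Integrable u μ) (hv : Integrable v μ)
    (h : ∀ q : ℚ, ∫ t in Iic (q : ℝ), u t ∂μ = ∫ t in Iic (q : ℝ), v t ∂μ) : u =ᵐ[μ] v := by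
  have htot : ∫ t, u t ∂μ = ∫ t, v t ∂μ := by
    have hlim : ∀ w : ℝ → ℝ, Integrable w μ →
        Tendsto (fun n : ℕ => ∫ t in Iic (((n : ℕ) : ℚ) : ℝ), w t ∂μ) atTop (𝓝 (∫ t, w t ∂μ)) := by
      intro w hw
      have hU : ⋃ n : ℕ, Iic (((n : ℕ) : ℚ) : ℝ) = univ := by
        refine eq_univ_of_forall fun t => mem_iUnion.2 ?_
        obtain ⟨n, hn⟩ := exists_nat_ge t
        exact ⟨n, by simpa using hn⟩
      have := tendsto_setIntegral_of_monotone (μ := μ) (f := w)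
        (s := fun n : ℕ => Iic (((n : ℕ) : ℚ) : ℝ)) (fun n => measurableSet_Iic)
        (fun a b hab => Iic_subset_Iic.2 (by exact_mod_cast hab)) hw.integrableOn
      rwa [hU, setIntegral_univ] at this
    refine tendsto_nhds_unique (hlim u hu) ?_
    simp only [h]
    exact hlim v hv
  refine hu.ae_eq_of_forall_setIntegral_eq _ _ hv fun A hA hlt => ?_
  clear hlt
  induction A, hA using MeasurableSpace.induction_on_inter
    (BorelSpace.measurable_eq.trans Real.borel_eq_generateFrom_Iic_rat) Real.isPiSystem_Iic_rat with
  | empty => simp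
  | basic A hA =>
    obtain ⟨q, hq⟩ := mem_iUnion.1 hA
    rw [mem_singleton_iff.1 hq]
    exact h q
  | compl A hA ih =>
    have h1 := integral_add_compl hA hu
    have h2 := integral_add_compl hA hv
    linarith
  | iUnion A hd hA ih =>
    rw [integral_iUnion hA hd hu.integrableOn, integral_iUnion hA hd hv.integrableOn]
    exact tsum_congr ih

/-- The coordinates of an integrable function in which weak convergence is tested. -/
noncomputable def weakCoord {E : Type*} [NormedAddCommGroup E] [NormedSpace ℝ E] (μ : Measure ℝ)
    (d : ℕ → E →L[ℝ] ℝ) (f : ℝ → E) : ℕ × ℚ → ℝ :=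
  fun p => ∫ t in Iic (p.2 : ℝ), d p.1 (f t) ∂μ

theorem ae_eq_of_weakCoord_eq {E : Type*} [NormedAddCommGroup E] [NormedSpace ℝ E] {μ : Measure ℝ}
    {d : ℕ → E →L[ℝ] ℝ} (hd : ∀ a b, (∀ k, d k a = d k b) → a = b) {f g : ℝ → E}
    (hf : Integrable f μ) (hg : Integrable g μ) (h : weakCoord μ d f = weakCoord μ d g) :
    f =ᵐ[μ] g := by
  have : ∀ k, ∀ᵐ t ∂μ, d k (f t) = d k (g t) := fun k =>
    ae_eq_of_forall_setIntegral_Iic_rat_eq ((d k).integrable_comp hf) ((d k).integrable_comp hg)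
      fun q => congrFun h (k, q)
  filter_upwards [ae_all_iff.2 this] with t ht using hd _ _ ht

theorem tendsto_weakCoord {E : Type*} [NormedAddCommGroup E] [NormedSpace ℝ E] {μ : Measure ℝ}
    (d : ℕ → E →L[ℝ] ℝ) {f : ℕ → ℝ → E} {g : ℝ → E} {l : Filter ℕ}
    (h : ∀ (x : E →L[ℝ] ℝ) (w : ℝ → ℝ), AEStronglyMeasurable w μ → (∀ᵐ t ∂μ, |w t| ≤ 1) →
      Tendsto (fun n => ∫ t, w t * x (f n t) ∂μ) l (𝓝 (∫ t, w t * x (g t) ∂μ))) :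
    Tendsto (fun n => weakCoord μ d (f n)) l (𝓝 (weakCoord μ d g)) := by
  rw [tendsto_pi_nhds]
  rintro ⟨k, q⟩
  have := h (d k) ((Iic (q : ℝ)).indicator 1)
    (measurable_one.indicator measurableSet_Iic).aestronglyMeasurable
    (Eventually.of_forall (abs_indicator_one_le _))
  simp only [setIntegral_eq_integral_indicator_one_mul measurableSet_Iic] at this
  exact this

/-- On selections, convergence of the coordinates is weak convergence. -/
theorem tendsto_integral_of_tendsto_weakCoord {E : Type*} {μ : Measure ℝ} [IsFiniteMeasure μ]
    [NormedAddCommGroup E] [NormedSpace ℝ E] [CompleteSpace E]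
    [TopologicalSpace.SeparableSpace E] [MeasurableSpace E] [BorelSpace E]
    {S : ℝ → Set E} {φ : ℝ → ℝ} (hφ : Integrable φ μ) (hb : ∀ᵐ t ∂μ, ∀ a ∈ S t, ‖a‖ ≤ φ t)
    (hSc : ∀ᵐ t ∂μ, Convex ℝ (S t)) (hSk : ∀ᵐ t ∂μ, IsCompact (toWeakSpace ℝ E '' S t))
    {d : ℕ → E →L[ℝ] ℝ} (hd : ∀ a b, (∀ k, d k a = d k b) → a = b)
    {f : ℕ → ℝ → E} (hf : ∀ n, IsSelection μ S (f n)) {g : ℝ → E} (hg : IsSelection μ S g)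
    (h : Tendsto (fun n => weakCoord μ d (f n)) atTop (𝓝 (weakCoord μ d g)))
    (x : E →L[ℝ] ℝ) {w : ℝ → ℝ} (hw : AEStronglyMeasurable w μ) (hw1 : ∀ᵐ t ∂μ, |w t| ≤ 1) :
    Tendsto (fun n => ∫ t, w t * x (f n t) ∂μ) atTop (𝓝 (∫ t, w t * x (g t) ∂μ)) := by
  have hsc : SecondCountableTopology E := UniformSpace.secondCountable_of_separable E
  rw [tendsto_iff_ultrafilter]
  intro 𝒰 h𝒰
  obtain ⟨g', hg', hlim⟩ := exists_isSelection_ultrafilter_limit hφ hb hSc hSk hf 𝒰 h𝒰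
  have heq : weakCoord μ d g = weakCoord μ d g' :=
    tendsto_nhds_unique (h.mono_left h𝒰) (tendsto_weakCoord d hlim)
  have hgg := ae_eq_of_weakCoord_eq hd (hg.integrable hφ hb) (hg'.integrable hφ hb) heq
  have : ∫ t, w t * x (g t) ∂μ = ∫ t, w t * x (g' t) ∂μ := by
    refine integral_congr_ae ?_
    filter_upwards [hgg] with t ht
    rw [ht]
  rw [this]
  exact hlim x w hw hw1

/-- The set of selections is weakly compact. -/
theorem isCompact_image_weakCoord {E : Type*} {μ : Measure ℝ} [IsFiniteMeasure μ]
    [NormedAddCommGroup E] [NormedSpace ℝ E] [CompleteSpace E]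
    [TopologicalSpace.SeparableSpace E] [MeasurableSpace E] [BorelSpace E]
    {S : ℝ → Set E} {φ : ℝ → ℝ} (hφ : Integrable φ μ) (hb : ∀ᵐ t ∂μ, ∀ a ∈ S t, ‖a‖ ≤ φ t)
    (hSc : ∀ᵐ t ∂μ, Convex ℝ (S t)) (hSk : ∀ᵐ t ∂μ, IsCompact (toWeakSpace ℝ E '' S t))
    (d : ℕ → E →L[ℝ] ℝ) : IsCompact (weakCoord μ d '' {f | IsSelection μ S f}) := by
  refine IsSeqCompact.isCompact fun y hy => ?_
  choose f hf hfy using hy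
  obtain ⟨g, hg, hlim⟩ := exists_isSelection_ultrafilter_limit hφ hb hSc hSk hf
    (hyperfilter ℕ) Nat.hyperfilter_le_atTop
  have h1 := tendsto_weakCoord d hlim
  simp only [hfy] at h1
  have h2 : MapClusterPt (weakCoord μ d g) atTop y :=
    (h1.mapClusterPt).mono Nat.hyperfilter_le_atTop
  obtain ⟨ψ, hψ, hψlim⟩ := h2.tendsto_subseq
  exact ⟨_, mem_image_of_mem _ hg, ψ, hψ, hψlim⟩

/-- Coordinates of a convex combination. -/
theorem weakCoord_add_smul {E : Type*} [NormedAddCommGroup E] [NormedSpace ℝ E] {μ : Measure ℝ}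
    (d : ℕ → E →L[ℝ] ℝ) {f g : ℝ → E} (hf : Integrable f μ) (hg : Integrable g μ) (a b : ℝ) :
    weakCoord μ d (fun t => a • f t + b • g t) = a • weakCoord μ d f + b • weakCoord μ d g := by
  ext ⟨k, q⟩
  simp only [weakCoord, map_add, map_smul, smul_eq_mul, Pi.add_apply, Pi.smul_apply]
  rw [integral_add (((d k).integrable_comp hf).const_mul a).integrableOn
    (((d k).integrable_comp hg).const_mul b).integrableOn, integral_const_mul, integral_const_mul]

/-- The maximizers of `v` on `K`. -/
def maximizers {E : Type*} (K : Set E) (v : E → ℝ) : Set E := {a | a ∈ K ∧ ∀ b ∈ K, v b ≤ v a}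

theorem convex_maximizers {E : Type*} [AddCommGroup E] [Module ℝ E] {K : Set E} {v : E → ℝ}
    (hv : QuasiconcaveOn ℝ K v) : Convex ℝ (maximizers K v) := by
  rintro a ⟨ha, ha'⟩ b ⟨hb, hb'⟩ s t hs ht hst
  have := hv (v a) ⟨ha, le_rfl⟩ ⟨hb, hb' a ha⟩ hs ht hst
  exact ⟨this.1, fun c hc => (ha' c hc).trans this.2⟩

theorem isCompact_maximizers {E : Type*} [NormedAddCommGroup E] [NormedSpace ℝ E] {K : Set E}
    (hK : IsCompact (toWeakSpace ℝ E '' K)) {v : E → ℝ}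
    (hv : ContinuousOn (fun a => v ((toWeakSpace ℝ E).symm a)) (toWeakSpace ℝ E '' K)) :
    IsCompact (toWeakSpace ℝ E '' maximizers K v) := by
  rcases K.eq_empty_or_nonempty with rfl | hne
  · simp [maximizers]
  obtain ⟨a, ha, hmax⟩ := exists_isMaxOn_of_weakly_compact hK hne hv
  have : toWeakSpace ℝ E '' maximizers K v =
      toWeakSpace ℝ E '' K ∩ (fun a => v ((toWeakSpace ℝ E).symm a)) ⁻¹' Ici (v a) := by
    ext y
    constructor
    · rintro ⟨b, hb, rfl⟩
      exact ⟨mem_image_of_mem _ hb.1, by simpa using hb.2 a ha⟩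
    · rintro ⟨⟨b, hb, rfl⟩, hb'⟩
      refine ⟨b, ⟨hb, fun c hc => (hmax c hc).trans (by simpa using hb')⟩, rfl⟩
  rw [this]
  exact hK.of_isClosed_subset (hv.preimage_isClosed_of_isClosed hK.isClosed isClosed_Ici)
    inter_subset_left

/-- Upper hemicontinuity of the set of maximizers, along weak limits that are only controlled by
the upper envelopes of rational functionals. -/
theorem mem_maximizers_of_tendsto {E : Type*} [NormedAddCommGroup E] [NormedSpace ℝ E] {K : Set E}
    (hK : IsCompact (toWeakSpace ℝ E '' K)) {v : E → E → ℝ}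
    (hv : ContinuousOn (fun p : WeakSpace ℝ E × WeakSpace ℝ E =>
      v ((toWeakSpace ℝ E).symm p.1) ((toWeakSpace ℝ E).symm p.2))
      ((toWeakSpace ℝ E '' K) ×ˢ univ))
    (hq : ∀ e, QuasiconcaveOn ℝ K fun a => v a e)
    {e : ℕ → E} {e₀ : E} (he : ∀ x : E →L[ℝ] ℝ, Tendsto (fun n => x (e n)) atTop (𝓝 (x e₀)))
    {b : ℕ → E} (hb : ∀ n, b n ∈ maximizers K fun a => v a (e n))
    {d : ℕ → E →L[ℝ] ℝ} (hd : ∀ a b, (∀ k, d k a = d k b) → a = b) {g : E}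
    (hg : ∀ (m : ℕ) (q : Fin m → ℚ) (N : ℕ) (c : ℝ),
      (∀ n ≥ N, ∑ i, (q i : ℝ) * d i (b n) ≤ c) → ∑ i, (q i : ℝ) * d i g ≤ c) :
    g ∈ maximizers K fun a => v a e₀ := by
  have hev : ∀ (e : E), ContinuousOn (fun a => v ((toWeakSpace ℝ E).symm a) e)
      (toWeakSpace ℝ E '' K) := fun e =>
    hv.comp (f := fun a => (a, toWeakSpace ℝ E e)) (by fun_prop) fun a ha => ⟨ha, mem_univ _⟩
  have hlimK : ∀ 𝒰 : Ultrafilter ℕ, (𝒰 : Filter ℕ) ≤ atTop →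
      ∃ a ∈ maximizers K fun a => v a e₀, ∀ x : E →L[ℝ] ℝ,
        Tendsto (fun n => x (b n)) 𝒰 (𝓝 (x a)) := by
    intro 𝒰 h𝒰
    obtain ⟨_, ⟨a, ha, rfl⟩, hlim⟩ := hK.ultrafilter_le_nhds
      (𝒰.map fun n => toWeakSpace ℝ E (b n))
      (le_principal_iff.2 (Filter.mem_map.2 (univ_mem' fun n => mem_image_of_mem _ (hb n).1)))
    have hlim' : Tendsto (fun n => toWeakSpace ℝ E (b n)) 𝒰 (𝓝 (toWeakSpace ℝ E a)) := hlim
    have he' : Tendsto (fun n => toWeakSpace ℝ E (e n)) 𝒰 (𝓝 (toWeakSpace ℝ E e₀)) := by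
      refine (WeakBilin.tendsto_iff_forall_eval_tendsto (topDualPairing ℝ E).flip ?_).2
        fun x => (he x).mono_left h𝒰
      exact fun a b hab => hd a b fun k => LinearMap.congr_fun hab (d k)
    refine ⟨a, ⟨ha, fun c hc => ?_⟩, fun x =>
      (x.continuous_comp_toWeakSpace_symm.tendsto _).comp hlim'⟩
    have h1 : Tendsto (fun n => v (b n) (e n)) 𝒰 (𝓝 (v a e₀)) :=
      (hv (toWeakSpace ℝ E a, toWeakSpace ℝ E e₀) ⟨mem_image_of_mem _ ha, mem_univ _⟩).tendsto.comp
        (tendsto_nhdsWithin_iff.2 ⟨hlim'.prodMk_nhds he', Eventually.of_forall fun n =>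
          ⟨mem_image_of_mem _ (hb n).1, mem_univ _⟩⟩)
    have h2 : Tendsto (fun n => v c (e n)) 𝒰 (𝓝 (v c e₀)) :=
      (hv (toWeakSpace ℝ E c, toWeakSpace ℝ E e₀) ⟨mem_image_of_mem _ hc, mem_univ _⟩).tendsto.comp
        (tendsto_nhdsWithin_iff.2 ⟨tendsto_const_nhds.prodMk_nhds he', Eventually.of_forall fun n =>
          ⟨mem_image_of_mem _ hc, mem_univ _⟩⟩)
    exact le_of_tendsto_of_tendsto' h2 h1 fun n => (hb n).2 c hc
  have hMk := isCompact_maximizers hK (v := fun a => v a e₀) (hev e₀)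
  obtain ⟨a, ha, hag⟩ := exists_mem_forall_eq_of_forall_rat_weak hMk (convex_maximizers (hq e₀))
    (d := d) (h := fun k => d k g) fun m q => by
      let x : E →L[ℝ] ℝ := ∑ i : Fin m, (q i : ℝ) • d i
      have hx : ∀ a, x a = ∑ i, (q i : ℝ) * d i a := fun a => by simp [x]
      have hne : (maximizers K fun a => v a e₀).Nonempty := by
        obtain ⟨a, ha, -⟩ := hlimK (hyperfilter ℕ) Nat.hyperfilter_le_atTop
        exact ⟨a, ha⟩
      obtain ⟨a, ha, hmax⟩ := exists_isMaxOn_of_weakly_compact hMk hne (v := x)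
        x.continuous_comp_toWeakSpace_symm.continuousOn
      refine ⟨a, ha, ?_⟩
      rw [← hx, ← hx]
      by_contra! hcon
      obtain ⟨c, hac, hcg⟩ := exists_between hcon
      have hfreq : ∃ᶠ n in atTop, c < x (b n) := by
        intro hev
        obtain ⟨N, hN⟩ := eventually_atTop.1 hev
        have := hg m q N c fun n hn => by
          rw [← hx]
          exact not_lt.1 (hN n hn)
        rw [← hx] at this
        exact absurd this (not_le.2 hcg)
      have hNe : (atTop ⊓ 𝓟 {n | c < x (b n)}).NeBot := frequently_mem_iff_neBot.1 hfreq
      obtain ⟨a', ha', hlim⟩ := hlimK (Ultrafilter.of (atTop ⊓ 𝓟 {n | c < x (b n)}))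
        ((Ultrafilter.of_le _).trans inf_le_left)
      have h1 : c ≤ x a' := ge_of_tendsto (hlim x) (by
        have : {n | c < x (b n)} ∈ (Ultrafilter.of (atTop ⊓ 𝓟 {n | c < x (b n)}) : Filter ℕ) :=
          Ultrafilter.of_le _ (mem_inf_of_right (mem_principal_self _))
        filter_upwards [this] with n hn using le_of_lt hn)
      exact absurd (hmax a' ha') (not_le.2 (hac.trans_le h1))
  rwa [← hd a g hag]

/-- Measurable selections of maximizers of a Carathéodory payoff. -/
theorem exists_measurable_maximizer {X E : Type*} [TopologicalSpace X] [PolishSpace X]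
    [MeasurableSpace X] [BorelSpace X] [TopologicalSpace E] [PolishSpace E] [MeasurableSpace E]
    [BorelSpace E] [Nonempty E] (μ : Measure X) [μ.OuterRegular] [IsFiniteMeasure μ]
    {T : Set X} (hT : MeasurableSet T) {S : X → Set E}
    (hS : MeasurableSet {p : X × E | p.1 ∈ T ∧ p.2 ∈ S p.1}) {v : X → E → ℝ}
    (hv : Measurable fun p : {p : X × E // p.1 ∈ T ∧ p.2 ∈ S p.1} => v p.1.1 p.1.2)
    (hmax : ∀ t ∈ T, ∃ a ∈ S t, ∀ b ∈ S t, v t b ≤ v t a) :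
    ∃ g : X → E, Measurable g ∧ ∀ᵐ t ∂μ, t ∈ T → g t ∈ maximizers (S t) (v t) := by
  classical
  choose! a haS ha using hmax
  let m : X → ℝ := fun t => if t ∈ T then v t (a t) else 0
  have hIoi : ∀ c, NullMeasurableSet (m ⁻¹' Ioi c) μ := by
    intro c
    have : m ⁻¹' Ioi c = Prod.fst '' ((fun p : {p : X × E // p.1 ∈ T ∧ p.2 ∈ S p.1} => p.1) ''
        ((fun p : {p : X × E // p.1 ∈ T ∧ p.2 ∈ S p.1} => v p.1.1 p.1.2) ⁻¹' Ioi c)) ∪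
        (Tᶜ ∩ {_t | c < 0}) := by
      ext t
      by_cases ht : t ∈ T
      · simp only [m, mem_preimage, mem_Ioi, mem_union, mem_inter_iff, mem_compl_iff,
          ht, not_true, false_and, or_false]
        constructor
        · intro h
          exact ⟨_, ⟨⟨(t, a t), ht, haS t ht⟩, h, rfl⟩, rfl⟩
        · rintro ⟨_, ⟨⟨⟨t', b⟩, ht', hb⟩, h, rfl⟩, rfl⟩
          exact lt_of_lt_of_le h (ha t' ht' b hb)
      · simp only [m, mem_preimage, mem_Ioi, mem_union, mem_inter_iff, mem_compl_iff,
          ht, not_false_iff, true_and, mem_ofPred_eq]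
        constructor
        · exact Or.inr
        · rintro (⟨_, ⟨⟨⟨t', b⟩, ht', hb⟩, h, rfl⟩, rfl⟩ | h)
          · exact absurd ht' ht
          · exact h
    rw [this]
    exact (MeasurableSet.nullMeasurableSet_image_fst (μ := μ)
      (hS.subtype_image (hv measurableSet_Ioi))).union
      (hT.compl.inter (MeasurableSet.const _)).nullMeasurableSet
  have hm : NullMeasurable m μ := measurable_of_Ioi (δ := NullMeasurableSpace X μ) hIoi
  obtain ⟨m', hm', hmm'⟩ := hm.aemeasurable
  have hG : MeasurableSet ((fun p : {p : X × E // p.1 ∈ T ∧ p.2 ∈ S p.1} => p.1) ''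
      {p | v p.1.1 p.1.2 = m' p.1.1}) :=
    hS.subtype_image (measurableSet_eq_fun hv
      (hm'.comp (measurable_fst.comp measurable_subtype_coe)))
  obtain ⟨g, hgm, hg⟩ := exists_measurable_selection_ae μ hG
  refine ⟨g, hgm, ?_⟩
  filter_upwards [hg, hmm'] with t h1 h2 ht
  obtain ⟨⟨⟨t', b⟩, ht', hb⟩, h, heq⟩ := h1 ⟨a t, ⟨⟨(t, a t), ht, haS t ht⟩, by
    simp only [mem_ofPred_eq]
    rw [← h2]
    simp only [m, if_pos ht], rfl⟩⟩
  obtain ⟨rfl, rfl⟩ := Prod.mk.inj heq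
  refine ⟨hb, fun c hc => ?_⟩
  have h' : v t' (g t') = m t' := (h : v t' (g t') = m' t').trans h2.symm
  rw [h']
  simp only [m, if_pos ht]
  exact ha t' ht c hc

/-- **Existence of Nash equilibria in graphon games with a continuum of agents**
(Corollary 2 of the paper). The agent space is the Lebesgue interval `[0,1]`
(formalized as `ℝ` with the measure `volume.restrict (Icc 0 1)`), and assumptions
(A2)–(A6) hold. Then the graphon game has a Nash equilibrium. -/
theorem graphon_game_continuum_existence
    {E : Type*} [NormedAddCommGroup E] [NormedSpace ℝ E] [CompleteSpace E]
    [TopologicalSpace.SeparableSpace E] [MeasurableSpace E] [BorelSpace E]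
    -- the graphon
    (W : ℝ → ℝ → ℝ) (hWmeas : Measurable (Function.uncurry W))
    (hW01 : ∀ t ∈ Set.Icc (0 : ℝ) 1, ∀ s ∈ Set.Icc (0 : ℝ) 1, W t s ∈ Set.Icc (0 : ℝ) 1)
    -- the strategy correspondence
    (S : ℝ → Set E)
    -- (A2) `S t` is nonempty, convex and weakly compact for all agents `t ∈ [0,1]`
    (hSne : ∀ t ∈ Set.Icc (0 : ℝ) 1, (S t).Nonempty)
    (hSconv : ∀ t ∈ Set.Icc (0 : ℝ) 1, Convex ℝ (S t))
    (hScomp : ∀ t ∈ Set.Icc (0 : ℝ) 1, IsCompact (toWeakSpace ℝ E '' S t))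
    -- (A3) `S` is graph measurable and integrably bounded
    (hSgraph : MeasurableSet {p : ℝ × E | p.1 ∈ Set.Icc (0 : ℝ) 1 ∧ p.2 ∈ S p.1})
    (hSbdd : ∃ φ : ℝ → ℝ, Integrable φ (volume.restrict (Set.Icc (0 : ℝ) 1)) ∧
      ∀ᵐ t ∂(volume.restrict (Set.Icc (0 : ℝ) 1)), ∀ a ∈ S t, ‖a‖ ≤ φ t)
    -- the utility function
    (U : ℝ → E → E → ℝ)
    -- (A4) `U t` is continuous on `S t × E` for the weak topologies
    (hA4 : ∀ t ∈ Set.Icc (0 : ℝ) 1, ContinuousOn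
      (fun p : WeakSpace ℝ E × WeakSpace ℝ E =>
        U t ((toWeakSpace ℝ E).symm p.1) ((toWeakSpace ℝ E).symm p.2))
      ((toWeakSpace ℝ E '' S t) ×ˢ (Set.univ : Set (WeakSpace ℝ E))))
    -- (A5) `U t · e` is quasi-concave on `S t`
    (hA5 : ∀ t ∈ Set.Icc (0 : ℝ) 1, ∀ e : E, QuasiconcaveOn ℝ (S t) (fun a => U t a e))
    -- (A6) `U · · e` is `Σ ⊗ B(E)`-measurable on the graph of `S`
    (hA6 : ∀ e : E, Measurable
      (fun p : {q : ℝ × E // q.1 ∈ Set.Icc (0 : ℝ) 1 ∧ q.2 ∈ S q.1} => U p.1.1 p.1.2 e)) :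
    ∃ f : ℝ → E, Integrable f (volume.restrict (Set.Icc (0 : ℝ) 1)) ∧
      (∀ᵐ t ∂(volume.restrict (Set.Icc (0 : ℝ) 1)), f t ∈ S t) ∧
      ∀ᵐ t ∂(volume.restrict (Set.Icc (0 : ℝ) 1)), ∀ a ∈ S t,
        U t a (∫ s in Set.Icc (0 : ℝ) 1, W t s • f s) ≤
          U t (f t) (∫ s in Set.Icc (0 : ℝ) 1, W t s • f s) := by
  obtain ⟨φ, hφ, hb⟩ := hSbdd
  obtain ⟨d, hd⟩ := exists_seq_dual_separating E
  have hsc : SecondCountableTopology E := UniformSpace.secondCountable_of_separable E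
  let μ : Measure ℝ := volume.restrict (Icc (0 : ℝ) 1)
  have hI : ∀ᵐ t ∂μ, t ∈ Icc (0 : ℝ) 1 := ae_restrict_mem measurableSet_Icc
  have hSc : ∀ᵐ t ∂μ, Convex ℝ (S t) := hI.mono hSconv
  have hSk : ∀ᵐ t ∂μ, IsCompact (toWeakSpace ℝ E '' S t) := hI.mono hScomp
  let e : (ℝ → E) → ℝ → E := fun f t => ∫ s, W t s • f s ∂μ
  have hWm : ∀ t, AEStronglyMeasurable (W t) μ := fun t =>
    (hWmeas.comp measurable_prodMk_left).aestronglyMeasurable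
  have hW1 : ∀ t ∈ Icc (0 : ℝ) 1, ∀ᵐ s ∂μ, |W t s| ≤ 1 := fun t ht => by
    filter_upwards [hI] with s hs
    exact abs_le.2 ⟨by linarith [(hW01 t ht s hs).1], (hW01 t ht s hs).2⟩
  have he_congr : ∀ {f g : ℝ → E}, f =ᵐ[μ] g → e f = e g := fun {f g} hfg => by
    ext1 t
    refine integral_congr_ae ?_
    filter_upwards [hfg] with s hs
    rw [hs]
  have he_apply : ∀ {f : ℝ → E}, IsSelection μ S f → ∀ t ∈ Icc (0 : ℝ) 1, ∀ x : E →L[ℝ] ℝ,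
      x (e f t) = ∫ s, W t s * x (f s) ∂μ := fun {f} hf t ht x => by
    have hint : Integrable (fun s => W t s • f s) μ :=
      (hf.integrable hφ hb).bdd_smul 1 (hWm t) (hW1 t ht)
    rw [← x.integral_comp_comm hint]
    simp only [map_smul, smul_eq_mul]
  have he_meas : ∀ {f : ℝ → E}, IsSelection μ S f → Measurable (e f) := fun {f} hf => by
    have : StronglyMeasurable (Function.uncurry fun t s => W t s • f s) :=
      (hWmeas.smul (hf.1.comp measurable_snd)).stronglyMeasurable
    exact this.integral_prod_right.measurable
  have hUe : ∀ t ∈ Icc (0 : ℝ) 1, ∀ c, ContinuousOn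
      (fun a => U t ((toWeakSpace ℝ E).symm a) c) (toWeakSpace ℝ E '' S t) := fun t ht c =>
    (hA4 t ht).comp (f := fun a => (a, toWeakSpace ℝ E c)) (by fun_prop)
      fun a ha => ⟨ha, mem_univ _⟩
  let best : (ℝ → E) → (ℝ → E) → Prop := fun f g =>
    ∀ᵐ t ∂μ, g t ∈ maximizers (S t) fun a => U t a (e f t)
  have hbest : ∀ {f : ℝ → E}, IsSelection μ S f → ∃ g, IsSelection μ S g ∧ best f g := by
    intro f hf
    have hUm : Measurable (Function.uncurry
        fun (c : E) (p : {q : ℝ × E // q.1 ∈ Icc (0 : ℝ) 1 ∧ q.2 ∈ S q.1}) =>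
          U p.1.1 p.1.2 c) := by
      refine measurable_uncurry_of_continuous_of_measurable (fun p => ?_) hA6
      have hc : Continuous fun c : E => (toWeakSpace ℝ E p.1.2, toWeakSpaceCLM ℝ E c) :=
        continuous_const.prodMk (toWeakSpaceCLM ℝ E).continuous
      exact (hA4 p.1.1 p.2.1).comp_continuous hc
        fun c => ⟨mem_image_of_mem _ p.2.2, mem_univ _⟩
    obtain ⟨g, hg, hgmax⟩ := exists_measurable_maximizer μ measurableSet_Icc hSgraph
      (v := fun t a => U t a (e f t))
      (hUm.comp (((he_meas hf).comp (measurable_fst.comp measurable_subtype_coe)).prodMk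
        measurable_id))
      fun t ht => exists_isMaxOn_of_weakly_compact (hScomp t ht) (hSne t ht)
        (v := fun a => U t a (e f t)) (hUe t ht _)
    have hg' : best f g := by
      filter_upwards [hgmax, hI] with t h1 h2 using h1 h2
    exact ⟨g, ⟨hg, hg'.mono fun t ht => ht.1⟩, hg'⟩
  have hKc := isCompact_image_weakCoord hφ hb hSc hSk d
  have hcomb : ∀ {f g : ℝ → E}, IsSelection μ S f → IsSelection μ S g → ∀ a b : ℝ, 0 ≤ a → 0 ≤ b →
      a + b = 1 → IsSelection μ S fun t => a • f t + b • g t := by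
    intro f g hf hg a b ha hb' hab
    refine ⟨(hf.1.const_smul a).add (hg.1.const_smul b), ?_⟩
    filter_upwards [hf.2, hg.2, hSc] with t h1 h2 h3 using h3 h1 h2 ha hb' hab
  let Γ : Set ((ℕ × ℚ → ℝ) × (ℕ × ℚ → ℝ)) := {p | ∃ f g, IsSelection μ S f ∧ IsSelection μ S g ∧
    best f g ∧ (weakCoord μ d f, weakCoord μ d g) = p}
  have hΓ : IsClosed Γ := by
    refine IsSeqClosed.isClosed fun p p₀ hp hlim => ?_
    choose f g hf hg hfg hpfg using hp
    have hlim1 : Tendsto (fun n => weakCoord μ d (f n)) atTop (𝓝 p₀.1) :=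
      ((continuous_fst.tendsto p₀).comp hlim).congr fun n => by simp [← hpfg n]
    have hlim2 : Tendsto (fun n => weakCoord μ d (g n)) atTop (𝓝 p₀.2) :=
      ((continuous_snd.tendsto p₀).comp hlim).congr fun n => by simp [← hpfg n]
    obtain ⟨f₀, hf₀, hpf⟩ := hKc.isClosed.mem_of_tendsto hlim1
      (Eventually.of_forall fun n => mem_image_of_mem _ (hf n))
    obtain ⟨g₀, hg₀, hpg⟩ := hKc.isClosed.mem_of_tendsto hlim2
      (Eventually.of_forall fun n => mem_image_of_mem _ (hg n))
    rw [← hpf] at hlim1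
    rw [← hpg] at hlim2
    have hwf := tendsto_integral_of_tendsto_weakCoord hφ hb hSc hSk hd hf hf₀ hlim1
    have hwg := tendsto_integral_of_tendsto_weakCoord hφ hb hSc hSk hd hg hg₀ hlim2
    refine ⟨f₀, g₀, hf₀, hg₀, ?_, Prod.ext hpf hpg⟩
    have henv : ∀ᵐ t ∂μ, ∀ (m : ℕ) (q : Fin m → ℚ) (N : ℕ) (c : ℝ),
        (∀ n ≥ N, ∑ i, (q i : ℝ) * d i (g n t) ≤ c) → ∑ i, (q i : ℝ) * d i (g₀ t) ≤ c := by
      rw [ae_all_iff]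
      intro m
      rw [ae_all_iff]
      intro q
      have hx : ∀ a, (∑ i : Fin m, (q i : ℝ) • d i) a = ∑ i, (q i : ℝ) * d i a := fun a => by simp
      simp only [← hx]
      generalize ∑ i : Fin m, (q i : ℝ) • d i = x
      refine ae_forall_le_of_tendsto_setIntegral (u := fun n t => x (g n t)) (l := atTop)
        (fun n => x.continuous.measurable.comp (hg n).1)
        (fun n => x.integrable_comp ((hg n).integrable hφ hb))
        (x.integrable_comp (hg₀.integrable hφ hb)) le_rfl fun A hA => ?_
      simpa only [setIntegral_eq_integral_indicator_one_mul hA] using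
        hwg x (measurable_one.indicator hA).aestronglyMeasurable
          (Eventually.of_forall (abs_indicator_one_le A))
    filter_upwards [henv, hI, ae_all_iff.2 hfg] with t h1 ht h2
    refine mem_maximizers_of_tendsto (hScomp t ht) (hA4 t ht) (hA5 t ht) (fun x => ?_) h2 hd h1
    rw [he_apply hf₀ t ht]
    exact (hwf x (hWm t) (hW1 t ht)).congr fun n => (he_apply (hf n) t ht x).symm
  obtain ⟨x, hx, f, g, hf, hg, hfg, hxx⟩ := exists_fixedPoint_of_isClosed_graph hKc
    (by
      rintro _ ⟨f, hf, rfl⟩ _ ⟨g, hg, rfl⟩ a b ha hb' hab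
      exact ⟨_, hcomb hf hg a b ha hb' hab,
        weakCoord_add_smul d (IsSelection.integrable hφ hb hf) (IsSelection.integrable hφ hb hg)
          a b⟩)
    (by
      obtain ⟨f, hfm, hf⟩ := exists_measurable_selection_ae μ hSgraph
      refine ⟨_, mem_image_of_mem _ (show IsSelection μ S f from ⟨hfm, ?_⟩)⟩
      filter_upwards [hf, hI] with t h1 ht
      obtain ⟨a, ha⟩ := hSne t ht
      exact (h1 ⟨a, ht, ha⟩).2) hΓ
    (by
      rintro _ ⟨f, hf, rfl⟩
      obtain ⟨g, hg, hfg⟩ := hbest hf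
      exact ⟨_, mem_image_of_mem _ hg, f, g, hf, hg, hfg, rfl⟩)
    (by
      rintro x - y ⟨f, g, hf, hg, hfg, h1⟩ z ⟨f', g', hf', hg', hfg', h2⟩ a b ha hb' hab
      obtain ⟨rfl, rfl⟩ := Prod.mk.inj h1
      obtain ⟨h5, rfl⟩ := Prod.mk.inj h2
      have hff' := he_congr (ae_eq_of_weakCoord_eq hd (hf'.integrable hφ hb)
        (hf.integrable hφ hb) h5)
      refine ⟨f, _, hf, hcomb hg hg' a b ha hb' hab, ?_, Prod.ext rfl
        (weakCoord_add_smul d (hg.integrable hφ hb) (hg'.integrable hφ hb) a b)⟩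
      filter_upwards [hfg, hfg', hI] with t h3 h4 ht
      rw [hff'] at h4
      exact convex_maximizers (hA5 t ht _) h3 h4 ha hb' hab)
  obtain ⟨h1, h2⟩ := Prod.mk.inj hxx
  have hae := ae_eq_of_weakCoord_eq hd (hf.integrable hφ hb) (hg.integrable hφ hb)
    (h1.trans h2.symm)
  refine ⟨f, hf.integrable hφ hb, hf.2, ?_⟩
  filter_upwards [hfg, hae] with t h3 h4
  rw [← h4] at h3
  exact h3.2
end

section
/- Assume λ‖W‖_∞ < 1, 1/(1−λ‖W‖_∞) ≤ L and λ/(1−λ‖W‖_∞) + 1 ≤ L. Then for every measurable g : [0,1] → [0,1], the function s_g defined by s_g(t) = g(t) + λ ∫₀¹ Γ(t,s,λ) g(s) ds takes values in [0,L] a.e. and is a Nash equilibrium of the graphon game: for a.e. t ∈ [0,1], u(s_g(t), e(t)) = max_{a∈[0,L]} u(a, e(t)), where e(t) = ∫₀¹ W(t,y) s_g(y) dy. -/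
open MeasureTheory Set Filter Topology

/-- The iterated kernels: `iterKernel W 0 = W₁ = W` and
`iterKernel W n t s = W_{n+1}(t,s) = ∫₀¹ W(t,x) · W_n(x,s) dx`. -/
noncomputable def iterKernel (W : ℝ → ℝ → ℝ) : ℕ → ℝ → ℝ → ℝ
  | 0 => W
  | n + 1 => fun t s => ∫ x in Set.Icc (0 : ℝ) 1, W t x * iterKernel W n x s

/-- `Γ(t,s,λ) = Σ_{n=1}^∞ λ^{n-1} W_n(t,s)`. -/
noncomputable def GammaKernel (W : ℝ → ℝ → ℝ) (lam t s : ℝ) : ℝ :=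
  ∑' n : ℕ, lam ^ n * iterKernel W n t s

/-- The common utility function of the example:
`u(a,e) = -½a² + λea` if `a < λe`; `½λ²e²` if `λe ≤ a ≤ λe + 1`;
`-½(a-1)² + λe(a-1)` if `a > λe + 1`. -/
noncomputable def uLQ (lam a e : ℝ) : ℝ :=
  if a < lam * e then -(1 / 2) * a ^ 2 + lam * e * a
  else if a ≤ lam * e + 1 then (1 / 2) * lam ^ 2 * e ^ 2
  else -(1 / 2) * (a - 1) ^ 2 + lam * e * (a - 1)

theorem uLQ_le (lam a e : ℝ) : uLQ lam a e ≤ 1 / 2 * lam ^ 2 * e ^ 2 := by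
  unfold uLQ
  split_ifs
  · nlinarith [sq_nonneg (a - lam * e)]
  · exact le_rfl
  · nlinarith [sq_nonneg (a - 1 - lam * e)]

theorem uLQ_eq_of_mem_Icc {lam a e : ℝ} (h : a ∈ Icc (lam * e) (lam * e + 1)) :
    uLQ lam a e = 1 / 2 * lam ^ 2 * e ^ 2 := by
  rw [uLQ, if_neg (not_lt.2 h.1), if_pos h.2]

theorem integrableOn_unit_of_bounded {f : ℝ → ℝ} (hf : Measurable f) {C : ℝ}
    (h : ∀ x ∈ Icc (0 : ℝ) 1, f x ∈ Icc 0 C) : IntegrableOn f (Icc (0 : ℝ) 1) := by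
  refine Measure.integrableOn_of_bounded (M := C) (by simp) hf.aestronglyMeasurable ?_
  filter_upwards [ae_restrict_mem measurableSet_Icc] with x hx
  rw [Real.norm_of_nonneg (h x hx).1]
  exact (h x hx).2

theorem setIntegral_unit_mem_Icc {f : ℝ → ℝ} (hf : Measurable f) {C : ℝ}
    (h : ∀ x ∈ Icc (0 : ℝ) 1, f x ∈ Icc 0 C) : ∫ x in Icc (0 : ℝ) 1, f x ∈ Icc 0 C := by
  refine ⟨setIntegral_nonneg measurableSet_Icc fun x hx => (h x hx).1, ?_⟩
  have := setIntegral_mono_on (integrableOn_unit_of_bounded hf h)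
    (integrableOn_const (C := C) (by simp))
    measurableSet_Icc (fun x hx => (h x hx).2)
  simpa using this

theorem hasSum_setIntegral_unit {F : ℕ → ℝ → ℝ} (hF : ∀ n, Measurable (F n)) {c : ℕ → ℝ}
    (hc : Summable c) (h : ∀ n, ∀ x ∈ Icc (0 : ℝ) 1, F n x ∈ Icc 0 (c n)) :
    HasSum (fun n => ∫ x in Icc (0 : ℝ) 1, F n x) (∫ x in Icc (0 : ℝ) 1, ∑' n, F n x) := by
  refine hasSum_integral_of_summable_integral_norm
    (fun n => integrableOn_unit_of_bounded (hF n) (h n)) ?_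
  refine Summable.of_nonneg_of_le (fun n => integral_nonneg fun _ => norm_nonneg _)
    (fun n => (setIntegral_unit_mem_Icc (hF n).norm fun x hx => ?_).2) hc
  rw [Real.norm_of_nonneg (h n x hx).1]
  exact h n x hx

theorem mul_mem_Icc_mul {a b A B : ℝ} (ha : a ∈ Icc 0 A) (hb : b ∈ Icc 0 B) :
    a * b ∈ Icc 0 (A * B) :=
  ⟨mul_nonneg ha.1 hb.1, mul_le_mul ha.2 hb.2 hb.1 (ha.1.trans ha.2)⟩

theorem measurable_iterKernel {W : ℝ → ℝ → ℝ} (hW : Measurable (Function.uncurry W)) (n : ℕ) :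
    Measurable (Function.uncurry (iterKernel W n)) := by
  induction n with
  | zero => exact hW
  | succ n ih =>
    have h : Measurable fun q : (ℝ × ℝ) × ℝ => W q.1.1 q.2 * iterKernel W n q.2 q.1.2 :=
      (hW.comp (measurable_fst.fst.prodMk measurable_snd)).mul
        (ih.comp (measurable_snd.prodMk measurable_fst.snd))
    exact (h.stronglyMeasurable.integral_prod_right'
      (ν := volume.restrict (Icc (0 : ℝ) 1))).measurable

theorem iterKernel_mem_Icc {W : ℝ → ℝ → ℝ} (hW : Measurable (Function.uncurry W)) {M : ℝ}
    (hWM : ∀ t ∈ Icc (0 : ℝ) 1, ∀ s ∈ Icc (0 : ℝ) 1, W t s ∈ Icc 0 M) (n : ℕ) :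
    ∀ t ∈ Icc (0 : ℝ) 1, ∀ s ∈ Icc (0 : ℝ) 1, iterKernel W n t s ∈ Icc 0 (M ^ (n + 1)) := by
  induction n with
  | zero => simpa [iterKernel] using hWM
  | succ n ih =>
    intro t ht s hs
    rw [pow_succ']
    exact setIntegral_unit_mem_Icc
      (hW.of_uncurry_left.mul (measurable_iterKernel hW n).of_uncurry_right)
      fun x hx => mul_mem_Icc_mul (hWM t ht x hx) (ih x hx s hs)

/-- The integral operator with kernel `iterKernel W n`, applied to `g`. -/
noncomputable def iterKernelAction (W : ℝ → ℝ → ℝ) (g : ℝ → ℝ) (n : ℕ) (t : ℝ) : ℝ :=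
  ∫ s in Icc (0 : ℝ) 1, iterKernel W n t s * g s

section Action

variable {W : ℝ → ℝ → ℝ} {g : ℝ → ℝ} {M : ℝ}

theorem measurable_iterKernelAction (hW : Measurable (Function.uncurry W)) (hg : Measurable g)
    (n : ℕ) : Measurable (iterKernelAction W g n) := by
  have h : Measurable fun q : ℝ × ℝ => iterKernel W n q.1 q.2 * g q.2 :=
    (measurable_iterKernel hW n).mul (hg.comp measurable_snd)
  exact (h.stronglyMeasurable.integral_prod_right'
    (ν := volume.restrict (Icc (0 : ℝ) 1))).measurable

theorem iterKernelAction_mem_Icc (hW : Measurable (Function.uncurry W)) (hg : Measurable g)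
    (hWM : ∀ t ∈ Icc (0 : ℝ) 1, ∀ s ∈ Icc (0 : ℝ) 1, W t s ∈ Icc 0 M)
    (hg01 : ∀ t ∈ Icc (0 : ℝ) 1, g t ∈ Icc (0 : ℝ) 1) (n : ℕ) {t : ℝ}
    (ht : t ∈ Icc (0 : ℝ) 1) : iterKernelAction W g n t ∈ Icc 0 (M ^ (n + 1)) := by
  refine setIntegral_unit_mem_Icc ((measurable_iterKernel hW n).of_uncurry_left.mul hg)
    fun s hs => ?_
  simpa using mul_mem_Icc_mul (iterKernel_mem_Icc hW hWM n t ht s hs) (hg01 s hs)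

theorem iterKernelAction_succ (hW : Measurable (Function.uncurry W)) (hg : Measurable g)
    (hWM : ∀ t ∈ Icc (0 : ℝ) 1, ∀ s ∈ Icc (0 : ℝ) 1, W t s ∈ Icc 0 M)
    (hg01 : ∀ t ∈ Icc (0 : ℝ) 1, g t ∈ Icc (0 : ℝ) 1) (n : ℕ) {t : ℝ}
    (ht : t ∈ Icc (0 : ℝ) 1) :
    iterKernelAction W g (n + 1) t =
      ∫ x in Icc (0 : ℝ) 1, W t x * iterKernelAction W g n x := by
  simp only [iterKernelAction, iterKernel, ← integral_mul_const, ← integral_const_mul]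
  rw [integral_integral_swap]
  · simp only [mul_assoc]
  · have hm : Measurable fun q : ℝ × ℝ => W t q.2 * iterKernel W n q.2 q.1 * g q.1 :=
      ((hW.of_uncurry_left.comp measurable_snd).mul
        ((measurable_iterKernel hW n).comp measurable_swap)).mul (hg.comp measurable_fst)
    rw [Measure.prod_restrict]
    refine Measure.integrableOn_of_bounded (M := M * M ^ (n + 1) * 1) ?_
      hm.aestronglyMeasurable ?_
    · rw [Measure.prod_prod]
      simp
    · filter_upwards [ae_restrict_mem (measurableSet_Icc.prod measurableSet_Icc)] with q hq
      have := mul_mem_Icc_mul (mul_mem_Icc_mul (hWM t ht q.2 hq.2)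
        (iterKernel_mem_Icc hW hWM n q.2 hq.2 q.1 hq.1)) (hg01 q.1 hq.1)
      simp only [Function.uncurry]
      rw [Real.norm_of_nonneg this.1]
      exact this.2

variable {lam : ℝ}

theorem pow_mul_mem_Icc_geometric (hlam : 0 ≤ lam) {a C : ℝ} (n : ℕ)
    (ha : a ∈ Icc 0 (C * M ^ n)) : lam ^ n * a ∈ Icc 0 (C * (lam * M) ^ n) := by
  have hn := pow_nonneg hlam n
  refine ⟨mul_nonneg hn ha.1, (mul_le_mul_of_nonneg_left ha.2 hn).trans_eq ?_⟩
  rw [mul_pow]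
  ring

theorem hasSum_integral_GammaKernel_mul (hW : Measurable (Function.uncurry W))
    (hg : Measurable g) (hWM : ∀ t ∈ Icc (0 : ℝ) 1, ∀ s ∈ Icc (0 : ℝ) 1, W t s ∈ Icc 0 M)
    (hg01 : ∀ t ∈ Icc (0 : ℝ) 1, g t ∈ Icc (0 : ℝ) 1) (hM : 0 ≤ M) (hlam : 0 ≤ lam)
    (hlamM : lam * M < 1) {t : ℝ} (ht : t ∈ Icc (0 : ℝ) 1) :
    HasSum (fun n => lam ^ n * iterKernelAction W g n t)
      (∫ s in Icc (0 : ℝ) 1, GammaKernel W lam t s * g s) := by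
  have h := hasSum_setIntegral_unit (F := fun n s => lam ^ n * (iterKernel W n t s * g s))
    (c := fun n => M * (lam * M) ^ n)
    (fun n => ((measurable_iterKernel hW n).of_uncurry_left.mul hg).const_mul _)
    ((summable_geometric_of_lt_one (mul_nonneg hlam hM) hlamM).mul_left M)
    (fun n s hs => pow_mul_mem_Icc_geometric hlam n (by
      simpa [pow_succ'] using
        mul_mem_Icc_mul (iterKernel_mem_Icc hW hWM n t ht s hs) (hg01 s hs)))
  simp only [integral_const_mul] at h
  simp only [← mul_assoc, tsum_mul_right] at h
  exact h

theorem integral_GammaKernel_mul_mem_Icc (hW : Measurable (Function.uncurry W))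
    (hg : Measurable g) (hWM : ∀ t ∈ Icc (0 : ℝ) 1, ∀ s ∈ Icc (0 : ℝ) 1, W t s ∈ Icc 0 M)
    (hg01 : ∀ t ∈ Icc (0 : ℝ) 1, g t ∈ Icc (0 : ℝ) 1) (hM : 0 ≤ M) (hlam : 0 ≤ lam)
    (hlamM : lam * M < 1) {t : ℝ} (ht : t ∈ Icc (0 : ℝ) 1) :
    ∫ s in Icc (0 : ℝ) 1, GammaKernel W lam t s * g s ∈ Icc 0 (M * (1 - lam * M)⁻¹) := by
  have h := hasSum_integral_GammaKernel_mul hW hg hWM hg01 hM hlam hlamM ht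
  have hb (n : ℕ) : lam ^ n * iterKernelAction W g n t ∈ Icc 0 (M * (lam * M) ^ n) :=
    pow_mul_mem_Icc_geometric hlam n (by
      simpa [pow_succ'] using iterKernelAction_mem_Icc hW hg hWM hg01 n ht)
  exact ⟨h.nonneg fun n => (hb n).1, hasSum_le (fun n => (hb n).2) h
    ((hasSum_geometric_of_lt_one (mul_nonneg hlam hM) hlamM).mul_left M)⟩

/-- The resolvent identity: the local aggregate of `g + λ Γ g` is `Γ g`. -/
theorem integral_mul_add_GammaKernel (hW : Measurable (Function.uncurry W))
    (hg : Measurable g) (hWM : ∀ t ∈ Icc (0 : ℝ) 1, ∀ s ∈ Icc (0 : ℝ) 1, W t s ∈ Icc 0 M)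
    (hg01 : ∀ t ∈ Icc (0 : ℝ) 1, g t ∈ Icc (0 : ℝ) 1) (hM : 0 ≤ M) (hlam : 0 ≤ lam)
    (hlamM : lam * M < 1) {t : ℝ} (ht : t ∈ Icc (0 : ℝ) 1) :
    ∫ y in Icc (0 : ℝ) 1,
        W t y * (g y + lam * ∫ s in Icc (0 : ℝ) 1, GammaKernel W lam y s * g s) =
      ∫ s in Icc (0 : ℝ) 1, GammaKernel W lam t s * g s := by
  set r : ℕ → ℝ → ℝ := fun n y => W t y *
    Nat.casesOn n (g y) fun m => lam ^ (m + 1) * iterKernelAction W g m y with hr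
  have hpt : ∀ y ∈ Icc (0 : ℝ) 1, HasSum (fun n => r n y)
      (W t y * (g y + lam * ∫ s in Icc (0 : ℝ) 1, GammaKernel W lam y s * g s)) := by
    intro y hy
    refine HasSum.mul_left _ ((hasSum_nat_add_iff' 1).1 ?_)
    have h := (hasSum_integral_GammaKernel_mul hW hg hWM hg01 hM hlam hlamM hy).mul_left lam
    simpa [pow_succ', mul_assoc] using h
  have hsum := hasSum_setIntegral_unit (F := r) (c := fun n => M * (lam * M) ^ n) (by
      rintro (_ | n)
      · exact hW.of_uncurry_left.mul hg
      · exact hW.of_uncurry_left.mul ((measurable_iterKernelAction hW hg n).const_mul _))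
    ((summable_geometric_of_lt_one (mul_nonneg hlam hM) hlamM).mul_left M) (by
      rintro (_ | n) y hy
      · simpa [hr] using mul_mem_Icc_mul (hWM t ht y hy) (hg01 y hy)
      · refine mul_mem_Icc_mul (hWM t ht y hy) ?_
        have := pow_mul_mem_Icc_geometric (C := 1) hlam (n + 1)
          (by simpa using iterKernelAction_mem_Icc hW hg hWM hg01 n hy)
        simpa using this)
  rw [setIntegral_congr_fun measurableSet_Icc fun y hy => (hpt y hy).tsum_eq] at hsum
  refine hsum.unique ?_
  convert hasSum_integral_GammaKernel_mul hW hg hWM hg01 hM hlam hlamM ht using 2 with n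
  cases n with
  | zero => simp [hr, iterKernelAction, iterKernel]
  | succ n =>
    rw [iterKernelAction_succ hW hg hWM hg01 n ht, ← integral_const_mul]
    exact integral_congr_ae (Eventually.of_forall fun y => mul_left_comm _ _ _)

end Action

/-- **Proposition 1, first part.** If `λ‖W‖_∞ < 1`, `1/(1-λ‖W‖_∞) ≤ L` and
`λ/(1-λ‖W‖_∞) + 1 ≤ L`, then for every measurable `g : [0,1] → [0,1]` the profile
`s_g(t) = g(t) + λ ∫₀¹ Γ(t,s,λ) g(s) ds` takes values in `[0,L]` a.e. and is a Nash
equilibrium of the graphon game with utility `uLQ`. -/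
theorem sg_is_nash_equilibrium
    (W : ℝ → ℝ → ℝ) (hWmeas : Measurable (Function.uncurry W))
    (hW01 : ∀ t ∈ Set.Icc (0 : ℝ) 1, ∀ s ∈ Set.Icc (0 : ℝ) 1, W t s ∈ Set.Icc (0 : ℝ) 1)
    (lam : ℝ) (hlam : 0 ≤ lam) (L : ℝ) (hL : 0 < L)
    -- `M = ‖W‖_∞`, the essential supremum of `W`, and `W(t,s) ≤ ‖W‖_∞` pointwise
    (M : ℝ)
    (hM : M = essSup (fun p : ℝ × ℝ => W p.1 p.2)
      (volume.restrict ((Set.Icc (0 : ℝ) 1) ×ˢ (Set.Icc (0 : ℝ) 1))))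
    (hWleM : ∀ t ∈ Set.Icc (0 : ℝ) 1, ∀ s ∈ Set.Icc (0 : ℝ) 1, W t s ≤ M)
    (hlamM : lam * M < 1)
    (hL1 : 1 / (1 - lam * M) ≤ L)
    (hL2 : lam / (1 - lam * M) + 1 ≤ L)
    (g : ℝ → ℝ) (hg : Measurable g)
    (hg01 : ∀ t ∈ Set.Icc (0 : ℝ) 1, g t ∈ Set.Icc (0 : ℝ) 1) :
    (∀ᵐ t ∂(volume.restrict (Set.Icc (0 : ℝ) 1)),
      (g t + lam * ∫ s in Set.Icc (0 : ℝ) 1, GammaKernel W lam t s * g s) ∈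
        Set.Icc (0 : ℝ) L) ∧
    (∀ᵐ t ∂(volume.restrict (Set.Icc (0 : ℝ) 1)),
      ∀ a ∈ Set.Icc (0 : ℝ) L,
        uLQ lam a (∫ y in Set.Icc (0 : ℝ) 1,
            W t y * (g y + lam * ∫ s in Set.Icc (0 : ℝ) 1, GammaKernel W lam y s * g s)) ≤
        uLQ lam (g t + lam * ∫ s in Set.Icc (0 : ℝ) 1, GammaKernel W lam t s * g s)
          (∫ y in Set.Icc (0 : ℝ) 1,
            W t y * (g y + lam * ∫ s in Set.Icc (0 : ℝ) 1, GammaKernel W lam y s * g s))) := by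
  have hWM : ∀ t ∈ Icc (0 : ℝ) 1, ∀ s ∈ Icc (0 : ℝ) 1, W t s ∈ Icc 0 M :=
    fun t ht s hs => ⟨(hW01 t ht s hs).1, hWleM t ht s hs⟩
  have h0 : (0 : ℝ) ∈ Icc (0 : ℝ) 1 := by simp
  have hM0 : 0 ≤ M := (hWM 0 h0 0 h0).1.trans (hWM 0 h0 0 h0).2
  refine ⟨?_, ?_⟩
  · filter_upwards [ae_restrict_mem measurableSet_Icc] with t ht
    have hΓ := integral_GammaKernel_mul_mem_Icc hWmeas hg hWM hg01 hM0 hlam hlamM ht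
    refine ⟨add_nonneg (hg01 t ht).1 (mul_nonneg hlam hΓ.1), le_trans ?_ hL1⟩
    have h1 := mul_le_mul_of_nonneg_left hΓ.2 hlam
    have h2 : 1 / (1 - lam * M) = 1 + lam * (M * (1 - lam * M)⁻¹) := by
      have : 1 - lam * M ≠ 0 := by linarith
      field_simp
      ring
    linarith [(hg01 t ht).2]
  · filter_upwards [ae_restrict_mem measurableSet_Icc] with t ht a _
    rw [integral_mul_add_GammaKernel hWmeas hg hWM hg01 hM0 hlam hlamM ht]
    refine (uLQ_le _ _ _).trans_eq (Eq.symm ?_)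
    exact uLQ_eq_of_mem_Icc ⟨by linarith [(hg01 t ht).1], by linarith [(hg01 t ht).2]⟩
end

section
/- Assume λ‖W‖_∞ < 1, 1/(1−λ‖W‖_∞) ≤ L and λ/(1−λ‖W‖_∞) + 1 ≤ L. Then the set NE of Nash equilibria of the graphon game, regarded as a subset of L¹([0,1]) (equivalence classes of a.e. equal functions), has the cardinality of the continuum: |NE| = 𝔠. -/
open MeasureTheory Set Filter Topology

/-- The set of Nash equilibria of the example's graphon game, regarded as a subset of
`L¹([0,1])` (equivalence classes of a.e. equal functions): those classes `F` with values
in the strategy set `[0,L]` a.e. that a.e. maximize the utility against their own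
local aggregate. -/
def NashSetL1 (W : ℝ → ℝ → ℝ) (lam L : ℝ) :
    Set (Lp ℝ 1 (volume.restrict (Set.Icc (0 : ℝ) 1))) :=
  {F | (∀ᵐ t ∂(volume.restrict (Set.Icc (0 : ℝ) 1)), F t ∈ Set.Icc (0 : ℝ) L) ∧
    (∀ᵐ t ∂(volume.restrict (Set.Icc (0 : ℝ) 1)), ∀ a ∈ Set.Icc (0 : ℝ) L,
      uLQ lam a (∫ y, W t y * F y ∂(volume.restrict (Set.Icc (0 : ℝ) 1))) ≤
        uLQ lam (F t) (∫ y, W t y * F y ∂(volume.restrict (Set.Icc (0 : ℝ) 1))))}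

/-- A separable metric space has at most continuum many points. -/
theorem mk_le_continuum_of_separableSpace (X : Type) [MetricSpace X]
    [TopologicalSpace.SeparableSpace X] : Cardinal.mk X ≤ Cardinal.continuum := by
  rcases isEmpty_or_nonempty X with _ | _
  · simp
  have hinj : Function.Injective
      (fun (x : X) (n : ℕ) => dist x (TopologicalSpace.denseSeq X n)) := by
    intro x y hxy
    have h : (fun z : X => dist x z) = fun z => dist y z :=
      Continuous.ext_on (TopologicalSpace.denseRange_denseSeq X) (by fun_prop) (by fun_prop)
        (by rintro _ ⟨n, rfl⟩; exact congrFun hxy n)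
    simpa using congrFun h y
  refine (Cardinal.mk_le_of_injective hinj).trans ?_
  simp [Cardinal.mk_real]

/-- If `K` is a nonnegative kernel bounded by `r < 1` on a probability space, the equation
`s = 1 + ∫ K s` has a measurable solution with values in `[1, 1 / (1 - r)]`. -/
theorem exists_eq_one_add_integral_kernel {α : Type*} [MeasurableSpace α] (μ : Measure α)
    [IsProbabilityMeasure μ] (K : α → α → ℝ) (hK : Measurable (Function.uncurry K)) (r : ℝ)
    (hr : r < 1) (hK0 : ∀ t y, 0 ≤ K t y) (hKr : ∀ t y, K t y ≤ r) :
    ∃ s : α → ℝ, Measurable s ∧ (∀ t, s t ∈ Set.Icc 1 (1 / (1 - r))) ∧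
      ∀ t, s t = 1 + ∫ y, K t y * s y ∂μ := by
  obtain ⟨t₀⟩ : Nonempty α := nonempty_of_isProbabilityMeasure μ
  have hr0 : 0 ≤ r := (hK0 t₀ t₀).trans (hKr t₀ t₀)
  have hr1 : 0 < 1 - r := by linarith
  set B := 1 / (1 - r) with hB
  have hB0 : 0 ≤ B := by positivity
  have hBeq : 1 + r * B = B := by rw [hB]; field_simp; ring
  let T : (α → ℝ) → α → ℝ := fun s t => 1 + ∫ y, K t y * s y ∂μ
  have hKt : ∀ t, Measurable (K t) := fun t => hK.of_uncurry_left
  have hTmeas : ∀ s, Measurable s → Measurable (T s) := by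
    intro s hs
    have h : Measurable (Function.uncurry fun t y => K t y * s y) :=
      hK.mul (hs.comp measurable_snd)
    exact (h.stronglyMeasurable.integral_prod_right).measurable.const_add 1
  have hbound : ∀ s : α → ℝ, (∀ y, s y ∈ Set.Icc 0 B) → ∀ t y, ‖K t y * s y‖ ≤ r * B := by
    intro s hs t y
    rw [Real.norm_of_nonneg (mul_nonneg (hK0 t y) (hs y).1)]
    exact mul_le_mul (hKr t y) (hs y).2 (hs y).1 hr0
  have hint : ∀ s : α → ℝ, Measurable s → (∀ y, s y ∈ Set.Icc 0 B) → ∀ t,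
      Integrable (fun y => K t y * s y) μ := fun s hm hs t =>
    Integrable.of_bound ((hKt t).mul hm).aestronglyMeasurable (r * B)
      (Eventually.of_forall (hbound s hs t))
  have hTIcc : ∀ s : α → ℝ, Measurable s → (∀ y, s y ∈ Set.Icc 0 B) → ∀ t,
      T s t ∈ Set.Icc 1 B := by
    intro s hm hs t
    have h0 : 0 ≤ ∫ y, K t y * s y ∂μ :=
      integral_nonneg fun y => mul_nonneg (hK0 t y) (hs y).1
    have h1 : ∫ y, K t y * s y ∂μ ≤ ∫ _, r * B ∂μ :=
      integral_mono (hint s hm hs t) (integrable_const _)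
        fun y => (le_abs_self _).trans (hbound s hs t y)
    simp only [integral_const, probReal_univ, one_smul] at h1
    exact ⟨by simp only [T]; linarith, by simp only [T]; linarith⟩
  let S : ℕ → α → ℝ := fun n => T^[n] 0
  have hSsucc : ∀ n, S (n + 1) = T (S n) := fun n => Function.iterate_succ_apply' T n 0
  have hS : ∀ n, Measurable (S n) ∧ ∀ y, S n y ∈ Set.Icc 0 B := by
    intro n
    induction n with
    | zero => exact ⟨measurable_const, fun y => ⟨le_rfl, hB0⟩⟩
    | succ n ih =>
      rw [hSsucc]
      exact ⟨hTmeas _ ih.1, fun y =>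
        ⟨zero_le_one.trans (hTIcc _ ih.1 ih.2 y).1, (hTIcc _ ih.1 ih.2 y).2⟩⟩
  have hstep : ∀ n y, S n y ≤ S (n + 1) y := by
    intro n
    induction n with
    | zero => exact fun y => ((hS 1).2 y).1
    | succ n ih =>
      intro t
      rw [hSsucc, hSsucc (n + 1)]
      exact add_le_add_right (integral_mono (hint _ (hS n).1 (hS n).2 t)
        (hint _ (hS (n + 1)).1 (hS (n + 1)).2 t)
        fun y => mul_le_mul_of_nonneg_left (ih y) (hK0 t y)) 1
  have hlim : ∀ y, ∃ l, Tendsto (fun n => S n y) atTop (𝓝 l) := fun y =>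
    ⟨_, tendsto_atTop_ciSup (monotone_nat_of_le_succ fun n => hstep n y)
      ⟨B, by rintro _ ⟨n, rfl⟩; exact ((hS n).2 y).2⟩⟩
  choose s hs using hlim
  have hsmeas : Measurable s :=
    measurable_of_tendsto_metrizable (fun n => (hS n).1) (tendsto_pi_nhds.2 hs)
  have hsIcc : ∀ y, s y ∈ Set.Icc 0 B := fun y =>
    isClosed_Icc.mem_of_tendsto (hs y) (Eventually.of_forall fun n => (hS n).2 y)
  have hfix : ∀ t, s t = T s t := by
    intro t
    have h1 : Tendsto (fun n => S (n + 1) t) atTop (𝓝 (s t)) :=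
      (hs t).comp (tendsto_add_atTop_nat 1)
    have h2 : Tendsto (fun n => S (n + 1) t) atTop (𝓝 (T s t)) := by
      simp only [hSsucc]
      exact (tendsto_integral_of_dominated_convergence (fun _ => r * B)
        (fun n => ((hKt t).mul (hS n).1).aestronglyMeasurable) (integrable_const _)
        (fun n => Eventually.of_forall (hbound _ (hS n).2 t))
        (Eventually.of_forall fun y => (hs y).const_mul (K t y))).const_add 1
    exact tendsto_nhds_unique h1 h2
  exact ⟨s, hsmeas, fun t => hfix t ▸ hTIcc s hsmeas hsIcc t, hfix⟩

/-- Every action in `[λe, λe + 1]` maximizes the utility against the local aggregate `e`. -/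
theorem uLQ_le_of_mem_Icc {lam e b : ℝ} (hb : b ∈ Set.Icc (lam * e) (lam * e + 1)) (a : ℝ) :
    uLQ lam a e ≤ uLQ lam b e := by
  have h : uLQ lam b e = (1 / 2) * lam ^ 2 * e ^ 2 := by
    rw [uLQ, if_neg hb.1.not_gt, if_pos hb.2]
  rw [h, uLQ]
  split_ifs
  · nlinarith [sq_nonneg (a - lam * e)]
  · exact le_rfl
  · nlinarith [sq_nonneg (a - 1 - lam * e)]

/-- **The set of Nash equilibria has the cardinality of the continuum.**
Under `λ‖W‖_∞ < 1`, `1/(1-λ‖W‖_∞) ≤ L` and `λ/(1-λ‖W‖_∞) + 1 ≤ L`, the set of Nash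
equilibria of the graphon game of the example, as a subset of `L¹([0,1])`, has
cardinality `𝔠`. -/
theorem nashSet_card_continuum
    (W : ℝ → ℝ → ℝ) (hWmeas : Measurable (Function.uncurry W))
    (hW01 : ∀ t ∈ Set.Icc (0 : ℝ) 1, ∀ s ∈ Set.Icc (0 : ℝ) 1, W t s ∈ Set.Icc (0 : ℝ) 1)
    (lam : ℝ) (hlam : 0 ≤ lam) (L : ℝ) (hL : 0 < L)
    (M : ℝ)
    (hM : M = essSup (fun p : ℝ × ℝ => W p.1 p.2)
      (volume.restrict ((Set.Icc (0 : ℝ) 1) ×ˢ (Set.Icc (0 : ℝ) 1))))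
    (hWleM : ∀ t ∈ Set.Icc (0 : ℝ) 1, ∀ s ∈ Set.Icc (0 : ℝ) 1, W t s ≤ M)
    (hlamM : lam * M < 1)
    (hL1 : 1 / (1 - lam * M) ≤ L)
    (hL2 : lam / (1 - lam * M) + 1 ≤ L) :
    Cardinal.mk (NashSetL1 W lam L) = Cardinal.continuum := by
  set μ := volume.restrict (Set.Icc (0 : ℝ) 1) with hμ
  have : IsProbabilityMeasure μ := ⟨by simp [hμ]⟩
  have hmem : ∀ᵐ t ∂μ, t ∈ Set.Icc (0 : ℝ) 1 := ae_restrict_mem measurableSet_Icc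
  have h0 : (0 : ℝ) ∈ Set.Icc (0 : ℝ) 1 := ⟨le_rfl, zero_le_one⟩
  have hM0 : 0 ≤ M := (hW01 0 h0 0 h0).1.trans (hWleM 0 h0 0 h0)
  have hr0 : 0 ≤ lam * M := mul_nonneg hlam hM0
  -- `λ W` truncated to `[0, λ M]`, which changes nothing on the unit square
  let K : ℝ → ℝ → ℝ := fun t y => max 0 (min (lam * M) (lam * W t y))
  have hK : Measurable (Function.uncurry K) :=
    measurable_const.max (measurable_const.min (hWmeas.const_mul lam))
  have hKW : ∀ t ∈ Set.Icc (0 : ℝ) 1, ∀ y ∈ Set.Icc (0 : ℝ) 1, K t y = lam * W t y := by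
    intro t ht y hy
    simp only [K]
    rw [min_eq_right (mul_le_mul_of_nonneg_left (hWleM t ht y hy) hlam),
      max_eq_right (mul_nonneg hlam (hW01 t ht y hy).1)]
  obtain ⟨s, hsm, hsB, hs⟩ := exists_eq_one_add_integral_kernel μ K hK (lam * M) hlamM
    (fun t y => le_max_left _ _) (fun t y => max_le hr0 (min_le_left _ _))
  have hLp : ∀ c : ℝ, MemLp (fun t => c * s t) 1 μ := fun c =>
    (MemLp.of_bound hsm.aestronglyMeasurable (1 / (1 - lam * M)) (Eventually.of_forall fun t =>
      abs_le.2 ⟨by linarith [(hsB t).1, (hsB t).2], (hsB t).2⟩)).const_mul c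
  have hagg : ∀ c : ℝ, ∀ t ∈ Set.Icc (0 : ℝ) 1,
      lam * ∫ y, W t y * (hLp c).toLp _ y ∂μ = c * s t - c := by
    intro c t ht
    calc lam * ∫ y, W t y * (hLp c).toLp _ y ∂μ
        = ∫ y, c * (K t y * s y) ∂μ := by
          rw [← integral_const_mul]
          refine integral_congr_ae ?_
          filter_upwards [(hLp c).coeFn_toLp, hmem] with y hy hyI
          rw [hy, hKW t ht y hyI]
          ring
      _ = c * s t - c := by
          rw [integral_const_mul, hs t]
          ring
  have hNash : ∀ c ∈ Set.Icc (0 : ℝ) 1, (hLp c).toLp _ ∈ NashSetL1 W lam L := by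
    intro c hc
    refine ⟨?_, ?_⟩
    · filter_upwards [(hLp c).coeFn_toLp] with t ht
      rw [ht]
      have hst : 0 ≤ s t := zero_le_one.trans (hsB t).1
      exact ⟨mul_nonneg hc.1 hst,
        (mul_le_of_le_one_left hst hc.2).trans ((hsB t).2.trans hL1)⟩
    · filter_upwards [(hLp c).coeFn_toLp, hmem] with t ht htI a _
      refine uLQ_le_of_mem_Icc ?_ a
      rw [hagg c t htI, ht]
      exact ⟨by linarith [hc.1], by linarith [hc.2]⟩
  refine le_antisymm ?_ ?_
  · have : Fact ((1 : ENNReal) ≠ ⊤) := ⟨ENNReal.one_ne_top⟩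
    exact (Cardinal.mk_set_le _).trans (mk_le_continuum_of_separableSpace _)
  · rw [← Cardinal.mk_Icc_real (zero_lt_one' ℝ)]
    refine Cardinal.mk_le_of_injective
      (f := fun c : Set.Icc (0 : ℝ) 1 => (⟨_, hNash c c.2⟩ : NashSetL1 W lam L)) ?_
    intro c d hcd
    have h := (MemLp.toLp_eq_toLp_iff (hLp c) (hLp d)).1 (Subtype.ext_iff.1 hcd)
    obtain ⟨t, ht⟩ := h.exists
    exact Subtype.ext (mul_right_cancel₀ (zero_lt_one.trans_le (hsB t).1).ne' ht)
end

section
/- Let E be a Banach space, C a nonempty closed convex subset of E, and f : (0,1] → C Bochner integrable with respect to Lebesgue measure. Then for any sequence {k_n} of positive integers with k_n → ∞, there exists a sequence {f_n} of functions such that each f_n is a k_n-step function from (0,1] to C and f_n(t) → f(t) in norm for a.e. t ∈ (0,1]. -/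
open MeasureTheory Set Filter Topology

/-- A function on `(0,1]` is a `k`-step function if it is constant on each interval
`((i-1)/k, i/k]` for `i = 1, …, k`. -/
def IsStepFunOn {X : Type*} (k : ℕ) (g : ℝ → X) : Prop :=
  ∀ i : ℕ, i < k →
    ∀ t₁ ∈ Set.Ioc ((i : ℝ) / k) (((i : ℝ) + 1) / k),
      ∀ t₂ ∈ Set.Ioc ((i : ℝ) / k) (((i : ℝ) + 1) / k), g t₁ = g t₂

/-- The half-open interval `((c - 1) / k, c / k]`, where `c = ⌈k t⌉`: the cell containing `t` of the
partition of the line into intervals of length `1 / k`. -/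
def stepCell (k : ℕ) (t : ℝ) : Set ℝ :=
  Ioc (((⌈k * t⌉ : ℝ) - 1) / k) ((⌈k * t⌉ : ℝ) / k)

lemma stepCell_eq {k : ℕ} (hk : 0 < k) {i : ℕ} {t : ℝ}
    (ht : t ∈ Ioc ((i : ℝ) / k) (((i : ℝ) + 1) / k)) :
    stepCell k t = Ioc ((i : ℝ) / k) (((i : ℝ) + 1) / k) := by
  have hk' : (0 : ℝ) < k := by exact_mod_cast hk
  obtain ⟨h1, h2⟩ := ht
  rw [div_lt_iff₀' hk'] at h1
  rw [le_div_iff₀' hk'] at h2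
  have hc : ⌈(k : ℝ) * t⌉ = (i : ℤ) + 1 := by
    rw [Int.ceil_eq_iff]
    push_cast
    constructor <;> linarith
  simp [stepCell, hc]

lemma mem_stepCell {k : ℕ} (hk : 0 < k) (t : ℝ) : t ∈ stepCell k t := by
  have hk' : (0 : ℝ) < k := by exact_mod_cast hk
  constructor
  · rw [div_lt_iff₀' hk']
    linarith [Int.ceil_lt_add_one ((k : ℝ) * t)]
  · rw [le_div_iff₀' hk']
    exact Int.le_ceil _

lemma stepCell_subset {k : ℕ} (hk : 0 < k) {t : ℝ} (ht : t ∈ Ioc (0 : ℝ) 1) :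
    stepCell k t ⊆ Ioc 0 1 := by
  have hk' : (0 : ℝ) < k := by exact_mod_cast hk
  have h1 : (1 : ℝ) ≤ ⌈(k : ℝ) * t⌉ := by
    exact_mod_cast Int.ceil_pos.2 (mul_pos hk' ht.1)
  have h2 : (⌈(k : ℝ) * t⌉ : ℝ) ≤ k := by
    have : ⌈(k : ℝ) * t⌉ ≤ (k : ℤ) :=
      Int.ceil_le.2 (by push_cast; nlinarith [ht.2])
    exact_mod_cast this
  apply Ioc_subset_Ioc
  · exact div_nonneg (by linarith) hk'.le
  · exact (div_le_one hk').2 h2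

lemma stepCell_ae_eq_closedBall (k : ℕ) (t : ℝ) :
    stepCell k t =ᵐ[volume]
      Metric.closedBall (((⌈k * t⌉ : ℝ) - 1 / 2) / k) (1 / 2 / k) := by
  rw [Real.closedBall_eq_Icc, ← sub_div, ← add_div, sub_sub, sub_add_cancel, add_halves]
  exact Ioc_ae_eq_Icc

lemma volume_stepCell_ne_zero {k : ℕ} (hk : 0 < k) (t : ℝ) : volume (stepCell k t) ≠ 0 := by
  have hk' : (0 : ℝ) < k := by exact_mod_cast hk
  rw [stepCell, Real.volume_Ioc, ← sub_div, sub_sub_cancel]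
  simpa using hk.ne'

/-- **Lebesgue differentiation theorem** along the partitions of the line into intervals of
length `1 / k n`. -/
lemma ae_tendsto_setAverage_stepCell {E : Type*} [NormedAddCommGroup E] [NormedSpace ℝ E]
    [CompleteSpace E] {g : ℝ → E} (hg : LocallyIntegrable g volume)
    {k : ℕ → ℕ} (hkpos : ∀ n, 0 < k n) (hk : Tendsto k atTop atTop) :
    ∀ᵐ t, Tendsto (fun n => ⨍ y in stepCell (k n) t, g y) atTop (𝓝 (g t)) := by
  filter_upwards [IsUnifLocDoublingMeasure.ae_tendsto_average volume hg 1] with t ht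
  have hδ : Tendsto (fun n => 1 / 2 / (k n : ℝ)) atTop (𝓝[>] 0) := by
    refine tendsto_nhdsWithin_iff.2
      ⟨(tendsto_natCast_atTop_atTop.comp hk).const_div_atTop _, Eventually.of_forall fun n => ?_⟩
    have : (0 : ℝ) < k n := by exact_mod_cast hkpos n
    exact mem_Ioi.2 (by positivity)
  refine (ht (fun n => ((⌈(k n : ℝ) * t⌉ : ℝ) - 1 / 2) / k n) _ hδ
    (Eventually.of_forall fun n => ?_)).congr fun n =>
      setAverage_congr (stepCell_ae_eq_closedBall (k n) t).symm
  rw [one_mul, Real.closedBall_eq_Icc, ← sub_div, ← add_div, sub_sub, sub_add_cancel, add_halves]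
  exact Ioc_subset_Icc_self (mem_stepCell (hkpos n) t)

/-- **Approximation of Bochner integrable functions by step functions**
(Lemma 2 of the paper). Let `C` be a nonempty closed convex subset of a Banach space
`E` and `f : (0,1] → C` Bochner integrable. For any sequence `k_n → ∞` of positive
integers there are `k_n`-step functions `f_n : (0,1] → C` with `f_n → f` a.e. -/
theorem step_approximation
    {E : Type*} [NormedAddCommGroup E] [NormedSpace ℝ E] [CompleteSpace E]
    (C : Set E) (hCne : C.Nonempty) (hCclosed : IsClosed C) (hCconv : Convex ℝ C)
    (f : ℝ → E) (hf : Integrable f (volume.restrict (Set.Ioc (0 : ℝ) 1)))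
    (hfC : ∀ t ∈ Set.Ioc (0 : ℝ) 1, f t ∈ C)
    (k : ℕ → ℕ) (hkpos : ∀ n, 0 < k n) (hk : Tendsto k atTop atTop) :
    ∃ F : ℕ → ℝ → E,
      (∀ n, IsStepFunOn (k n) (F n)) ∧
      (∀ n, ∀ t ∈ Set.Ioc (0 : ℝ) 1, F n t ∈ C) ∧
      ∀ᵐ t ∂(volume.restrict (Set.Ioc (0 : ℝ) 1)),
        Tendsto (fun n => F n t) atTop (𝓝 (f t)) := by
  refine ⟨fun n t => ⨍ y in stepCell (k n) t, f y, fun n i _ t₁ h₁ t₂ h₂ => ?_,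
    fun n t ht => ?_, ?_⟩
  · simp only [stepCell_eq (hkpos n) h₁, stepCell_eq (hkpos n) h₂]
  · have hsub := stepCell_subset (hkpos n) ht
    refine hCconv.set_average_mem hCclosed (volume_stepCell_ne_zero (hkpos n) t)
      measure_Ioc_lt_top.ne ?_ (IntegrableOn.mono_set hf hsub)
    exact ae_restrict_of_forall_mem measurableSet_Ioc fun y hy => hfC y (hsub hy)
  · have hg : Integrable ((Ioc (0 : ℝ) 1).indicator f) volume :=
      (integrable_indicator_iff measurableSet_Ioc).2 hf
    rw [ae_restrict_iff' measurableSet_Ioc]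
    filter_upwards [ae_tendsto_setAverage_stepCell hg.locallyIntegrable hkpos hk] with t h ht
    rw [indicator_of_mem ht] at h
    refine h.congr fun n => setAverage_congr_fun measurableSet_Ioc ?_
    exact Eventually.of_forall fun y hy =>
      indicator_of_mem (stepCell_subset (hkpos n) ht hy) f
end

section
/- For any graphon W (a Lebesgue measurable function W : (0,1]² → [0,1]), there exists a sequence {W_n} such that each W_n is an n-step graphon and W_n(t,s) → W(t,s) for a.e. (t,s) ∈ (0,1]². -/
open MeasureTheory Set Filter Topology

/-- A graphon `W : (0,1]² → [0,1]` is an `n`-step graphon if it is constant on each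
rectangle `((i-1)/n, i/n] × ((j-1)/n, j/n]` for `i, j = 1, …, n`. -/
def IsStepGraphon (n : ℕ) (W : ℝ → ℝ → ℝ) : Prop :=
  ∀ i : ℕ, i < n → ∀ j : ℕ, j < n →
    ∀ t₁ ∈ Set.Ioc ((i : ℝ) / n) (((i : ℝ) + 1) / n),
      ∀ t₂ ∈ Set.Ioc ((i : ℝ) / n) (((i : ℝ) + 1) / n),
        ∀ s₁ ∈ Set.Ioc ((j : ℝ) / n) (((j : ℝ) + 1) / n),
          ∀ s₂ ∈ Set.Ioc ((j : ℝ) / n) (((j : ℝ) + 1) / n), W t₁ s₁ = W t₂ s₂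

/-- The midpoint of the interval `((i - 1) / n, i / n]` containing `t`. -/
noncomputable def cellCenter (n : ℕ) (t : ℝ) : ℝ := (⌈(n : ℝ) * t⌉ - 1 / 2) / n

theorem cellCenter_eq_of_mem_Ioc {n i : ℕ} {t : ℝ} (hn : 0 < n)
    (ht : t ∈ Ioc ((i : ℝ) / n) (((i : ℝ) + 1) / n)) :
    cellCenter n t = ((i : ℝ) + 1 / 2) / n := by
  have hn' : (0 : ℝ) < n := Nat.cast_pos.2 hn
  have h : ⌈(n : ℝ) * t⌉ = (i : ℤ) + 1 := by
    rw [Int.ceil_eq_iff]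
    have h₁ := (div_lt_iff₀' hn').1 ht.1
    have h₂ := (le_div_iff₀' hn').1 ht.2
    push_cast
    constructor <;> linarith
  rw [cellCenter, h]
  push_cast
  ring

theorem dist_cellCenter_le {n : ℕ} (hn : 0 < n) (t : ℝ) :
    dist t (cellCenter n t) ≤ 1 / (2 * n) := by
  have hn' : (0 : ℝ) < n := Nat.cast_pos.2 hn
  have h₁ := Int.le_ceil ((n : ℝ) * t)
  have h₂ := Int.ceil_lt_add_one ((n : ℝ) * t)
  have h : t - cellCenter n t = (n * t - ⌈(n : ℝ) * t⌉ + 1 / 2) / n := by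
    rw [cellCenter]
    field_simp
    ring
  rw [Real.dist_eq, h, abs_div, abs_of_pos hn', ← div_div]
  gcongr
  rw [abs_le]
  constructor <;> linarith

theorem tendsto_one_div_two_mul_nat_nhdsGT :
    Tendsto (fun n : ℕ => 1 / (2 * (n : ℝ))) atTop (𝓝[>] 0) := by
  simp_rw [one_div]
  exact tendsto_inv_atTop_nhdsGT_zero.comp
    (tendsto_natCast_atTop_atTop.const_mul_atTop two_pos)

/-- The averages of `f` over the `n`-step cells: `cellAverage f n t s` is the average of `f` over
the square of side `1 / n` of the grid that contains `(t, s)`. -/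
noncomputable def cellAverage (f : ℝ × ℝ → ℝ) (n : ℕ) (t s : ℝ) : ℝ :=
  ⨍ y in Metric.closedBall (cellCenter n t, cellCenter n s) (1 / (2 * n)), f y

theorem isStepGraphon_cellAverage (f : ℝ × ℝ → ℝ) (n : ℕ) :
    IsStepGraphon n (cellAverage f n) := by
  intro i hi j hj t₁ ht₁ t₂ ht₂ s₁ hs₁ s₂ hs₂
  have hn : 0 < n := i.zero_le.trans_lt hi
  simp only [cellAverage, cellCenter_eq_of_mem_Ioc hn ht₁, cellCenter_eq_of_mem_Ioc hn ht₂,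
    cellCenter_eq_of_mem_Ioc hn hs₁, cellCenter_eq_of_mem_Ioc hn hs₂]

theorem cellAverage_mem_Icc {f : ℝ × ℝ → ℝ} (hf : Integrable f)
    (hf01 : ∀ x, f x ∈ Icc (0 : ℝ) 1) (n : ℕ) (t s : ℝ) :
    cellAverage f n t s ∈ Icc (0 : ℝ) 1 := by
  rw [cellAverage]
  set B := Metric.closedBall (cellCenter n t, cellCenter n s) (1 / (2 * (n : ℝ)))
  by_cases hB : (volume : Measure (ℝ × ℝ)) B = 0
  · simp [Measure.restrict_eq_zero.2 hB]
  · exact (convex_Icc 0 1).set_average_mem isClosed_Icc hB measure_closedBall_lt_top.ne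
      (Eventually.of_forall hf01) hf.integrableOn

theorem ae_tendsto_cellAverage {f : ℝ × ℝ → ℝ} (hf : LocallyIntegrable f) :
    ∀ᵐ p : ℝ × ℝ, Tendsto (fun n => cellAverage f n p.1 p.2) atTop (𝓝 (f p)) := by
  filter_upwards [IsUnifLocDoublingMeasure.ae_tendsto_average volume hf 1] with p hp
  refine hp (fun n : ℕ => (cellCenter n p.1, cellCenter n p.2)) _
    tendsto_one_div_two_mul_nat_nhdsGT ?_
  filter_upwards [eventually_gt_atTop 0] with n hn
  rw [one_mul, Metric.mem_closedBall, Prod.dist_eq]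
  exact max_le (dist_cellCenter_le hn p.1) (dist_cellCenter_le hn p.2)

/-- **Approximation of graphons by step graphons** (Lemma 1 of the paper, after
Borgs–Chayes–Lovász–Sós–Vesztergombi). For any graphon `W` there is a sequence
`{W_n}` such that `W_n` is an `n`-step graphon and `W_n → W` a.e. on `(0,1]²`. -/
theorem graphon_step_approximation
    (W : ℝ → ℝ → ℝ) (hWmeas : Measurable (Function.uncurry W))
    (hW01 : ∀ t ∈ Set.Ioc (0 : ℝ) 1, ∀ s ∈ Set.Ioc (0 : ℝ) 1, W t s ∈ Set.Icc (0 : ℝ) 1) :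
    ∃ Wn : ℕ → ℝ → ℝ → ℝ,
      (∀ n, IsStepGraphon n (Wn n)) ∧
      (∀ n, ∀ t ∈ Set.Ioc (0 : ℝ) 1, ∀ s ∈ Set.Ioc (0 : ℝ) 1, Wn n t s ∈ Set.Icc (0 : ℝ) 1) ∧
      ∀ᵐ p ∂(volume.restrict ((Set.Ioc (0 : ℝ) 1) ×ˢ (Set.Ioc (0 : ℝ) 1)) : Measure (ℝ × ℝ)),
        Tendsto (fun n => Wn n p.1 p.2) atTop (𝓝 (W p.1 p.2)) := by
  set S : Set (ℝ × ℝ) := Ioc (0 : ℝ) 1 ×ˢ Ioc (0 : ℝ) 1 with hS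
  have hSm : MeasurableSet S := measurableSet_Ioc.prod measurableSet_Ioc
  have hSfin : (volume : Measure (ℝ × ℝ)) S ≠ ⊤ := by
    rw [hS, Measure.volume_eq_prod, Measure.prod_prod]
    simp
  set f : ℝ × ℝ → ℝ := S.indicator (Function.uncurry W) with hf
  have hf01 : ∀ x, f x ∈ Icc (0 : ℝ) 1 := by
    intro x
    by_cases hx : x ∈ S
    · rw [hf, indicator_of_mem hx]
      exact hW01 x.1 hx.1 x.2 hx.2
    · simp [hf, indicator_of_notMem hx]
  have hfint : Integrable f := by
    rw [hf, integrable_indicator_iff hSm]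
    refine IntegrableOn.of_bound hSfin.lt_top hWmeas.aestronglyMeasurable 1 ?_
    filter_upwards [ae_restrict_mem hSm] with x hx
    obtain ⟨h₀, h₁⟩ := hW01 x.1 hx.1 x.2 hx.2
    rw [Function.uncurry, Real.norm_of_nonneg h₀]
    exact h₁
  refine ⟨cellAverage f, isStepGraphon_cellAverage f,
    fun n t _ s _ => cellAverage_mem_Icc hfint hf01 n t s, ?_⟩
  filter_upwards [ae_restrict_of_ae (ae_tendsto_cellAverage hfint.locallyIntegrable),
    ae_restrict_mem hSm] with p hp hpS
  rwa [hf, indicator_of_mem hpS] at hp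
end

section
/- Let (W,U) be a graphon game and f a strategy profile. Suppose {(W_n,U_n)} is a sequence of graphon games, {f_n} a sequence of strategy profiles, and {ε_n} a sequence of nonnegative reals such that: f_n is an ε_n-Nash equilibrium of (W_n,U_n) for every n; W_n → W a.e. on (0,1]²; U_n(t) → U(t) in the norm of C for a.e. t; f_n(t) → f(t) in norm for a.e. t; and ε_n → 0. Then f is a Nash equilibrium of (W,U). -/
open MeasureTheory Set Filter Topology

noncomputable section

variable {E : Type*} [NormedAddCommGroup E] [NormedSpace ℝ E]

/-- The common strategy set `S`, viewed as a subset of `E` with the weak topology. -/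
def weakS (S : Set E) : Set (WeakSpace ℝ E) := toWeakSpace ℝ E '' S

/-- The Banach space `C` of real-valued functions on `S × S` that are continuous for the
weak topology of `S`, with the supremum norm. (Since `S` is weakly compact, these are
exactly the bounded continuous functions on `S × S` with the weak topology.) -/
abbrev CGame (S : Set E) := BoundedContinuousFunction (↥(weakS S) × ↥(weakS S)) ℝ

/-- An element of `S`, as a point of `S` with the weak topology. -/
def memWeakS {S : Set E} {a : E} (ha : a ∈ S) : ↥(weakS S) :=
  ⟨toWeakSpace ℝ E a, a, ha, rfl⟩

/-- The agent space `(0,1]` with Lebesgue measure. -/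
def μ01 : Measure ℝ := volume.restrict (Set.Ioc (0 : ℝ) 1)

/-- Lebesgue measure on `(0,1]²`. -/
def μ01sq : Measure (ℝ × ℝ) := volume.restrict ((Set.Ioc (0 : ℝ) 1) ×ˢ (Set.Ioc (0 : ℝ) 1))

/-- The local aggregate `∫ W(t,s) f(s) dμ(s)` of a strategy profile `f`. -/
def agg (W : ℝ → ℝ → ℝ) (f : ℝ → E) (t : ℝ) : E := ∫ s, W t s • f s ∂μ01

/-- `(W, U)` is a graphon game: `W` is a graphon on `(0,1]` and `U` is a measurable map
from `(0,1]` to the closed unit ball `C₀` of `C`. -/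
def IsGraphonGame (S : Set E) (W : ℝ → ℝ → ℝ) (U : ℝ → CGame S) : Prop :=
  Measurable (Function.uncurry W) ∧
  (∀ t ∈ Set.Ioc (0 : ℝ) 1, ∀ s ∈ Set.Ioc (0 : ℝ) 1, W t s ∈ Set.Icc (0 : ℝ) 1) ∧
  StronglyMeasurable U ∧ (∀ t, ‖U t‖ ≤ 1)

/-- A strategy profile of a graphon game: a measurable function from agents to `S`. -/
def IsProfile (S : Set E) (f : ℝ → E) : Prop :=
  StronglyMeasurable f ∧ ∀ t, f t ∈ S

/-- `f` is a Nash equilibrium of the graphon game `(W, U)`: for a.e. agent `t`, `f t`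
maximizes `a ↦ U t (a, agg W f t)` over `S`. (The membership facts `f t ∈ S` and
`agg W f t ∈ S`, which always hold for strategy profiles since `S` is closed convex and
contains `0`, are quantified universally so that the utility can be evaluated.) -/
def IsNashEq (S : Set E) (W : ℝ → ℝ → ℝ) (U : ℝ → CGame S) (f : ℝ → E) : Prop :=
  ∀ᵐ t ∂μ01, ∀ (hft : f t ∈ S) (hag : agg W f t ∈ S), ∀ a, ∀ ha : a ∈ S,
    U t (memWeakS ha, memWeakS hag) ≤ U t (memWeakS hft, memWeakS hag)

/-- `f` is an `ε`-Nash equilibrium of the graphon game `(W, U)`: the set of agents whose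
strategy is `ε`-optimal has measure at least `1 - ε`. -/
def IsEpsNashEq (S : Set E) (W : ℝ → ℝ → ℝ) (U : ℝ → CGame S) (f : ℝ → E) (ε : ℝ) : Prop :=
  ENNReal.ofReal (1 - ε) ≤
    μ01 {t : ℝ | ∀ (hft : f t ∈ S) (hag : agg W f t ∈ S), ∀ a, ∀ ha : a ∈ S,
      U t (memWeakS ha, memWeakS hag) - ε ≤ U t (memWeakS hft, memWeakS hag)}

/-- A network game with `m` players, common strategy set `S`, adjacency matrix `A` with
entries in `[0,1]` and utility functions `v i` in the unit ball `C₀` of `C`. -/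
def IsNetworkGame (S : Set E) (m : ℕ) (A : Fin m → Fin m → ℝ) (v : Fin m → CGame S) : Prop :=
  0 < m ∧ (∀ i j, A i j ∈ Set.Icc (0 : ℝ) 1) ∧ (∀ i, ‖v i‖ ≤ 1)

/-- The local aggregate `m⁻¹ Σ_j A i j • s j` of player `i` in a network game. -/
def netAgg (m : ℕ) (A : Fin m → Fin m → ℝ) (s : Fin m → E) (i : Fin m) : E :=
  (m : ℝ)⁻¹ • ∑ j, A i j • s j

/-- `s` is an `ε`-Nash equilibrium of the network game `(m, A, v)`: the proportion of
players whose strategy is `ε`-optimal is at least `1 - ε`. -/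
def IsNetEpsNashEq (S : Set E) (m : ℕ) (A : Fin m → Fin m → ℝ) (v : Fin m → CGame S)
    (s : Fin m → E) (ε : ℝ) : Prop :=
  1 - ε ≤ (({i : Fin m | ∀ (hsi : s i ∈ S) (hag : netAgg m A s i ∈ S), ∀ a, ∀ ha : a ∈ S,
      v i (memWeakS ha, memWeakS hag) - ε ≤ v i (memWeakS hsi, memWeakS hag)}.ncard : ℝ)) / m

/-- The `m`-step function on `(0,1]` determined by the values `g i` on the intervals
`(i/m, (i+1)/m]`, with default value `x₀` outside `(0,1]`. -/
def stepOf {X : Type*} (m : ℕ) (g : Fin m → X) (x₀ : X) (t : ℝ) : X :=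
  if h : ∃ i : Fin m, t ∈ Set.Ioc ((i : ℝ) / m) (((i : ℝ) + 1) / m) then g h.choose else x₀

/-- The `m`-step graphon `W_A` associated with the adjacency matrix `A`. -/
def stepGraphonOf (m : ℕ) (A : Fin m → Fin m → ℝ) : ℝ → ℝ → ℝ :=
  fun t s => stepOf m (fun i => stepOf m (fun j => A i j) 0 s) 0 t

/-- The `m`-step utility profile `U_v` associated with the utilities `v`. -/
def stepUtilOf {S : Set E} (m : ℕ) (v : Fin m → CGame S) : ℝ → CGame S := stepOf m v 0

/-- The `m`-step strategy profile `f_s` associated with the strategies `s`. -/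
def stepProfileOf (m : ℕ) (s : Fin m → E) : ℝ → E := stepOf m s 0

/-- A sequence of network games `(m n, A n, v n)` converges to the graphon game `(W, U)`:
`W_{A_n} → W` a.e. on `(0,1]²`, `U_{v_n}(t) → U(t)` in the norm of `C` for a.e. `t`, and
the number of players tends to infinity. -/
def NetGamesTendsto (S : Set E) (m : ℕ → ℕ) (A : ∀ n, Fin (m n) → Fin (m n) → ℝ)
    (v : ∀ n, Fin (m n) → CGame S) (W : ℝ → ℝ → ℝ) (U : ℝ → CGame S) : Prop :=
  (∀ᵐ p ∂μ01sq, Tendsto (fun n => stepGraphonOf (m n) (A n) p.1 p.2) atTop (𝓝 (W p.1 p.2))) ∧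
  (∀ᵐ t ∂μ01, Tendsto (fun n => stepUtilOf (m n) (v n) t) atTop (𝓝 (U t))) ∧
  Tendsto m atTop atTop

end

section Strategies

variable {E : Type*} [NormedAddCommGroup E] [NormedSpace ℝ E] {S : Set E}

lemma isClosed_of_isCompact_weakS (hS : IsCompact (weakS S)) : IsClosed S := by
  have h : S = toWeakSpaceCLM ℝ E ⁻¹' weakS S :=
    (preimage_image_eq S (toWeakSpace ℝ E).injective).symm
  rw [h]
  exact hS.isClosed.preimage (toWeakSpaceCLM ℝ E).continuous

/-- Weakly compact sets are norm bounded. -/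
lemma exists_norm_le_of_isCompact_weakS (hS : IsCompact (weakS S)) :
    ∃ C : ℝ, ∀ x ∈ S, ‖x‖ ≤ C := by
  have hpt : ∀ l : StrongDual ℝ E, ∃ C, ∀ x : S,
      ‖NormedSpace.inclusionInDoubleDual ℝ E x l‖ ≤ C := by
    intro l
    have hl : Continuous fun x : WeakSpace ℝ E => l ((toWeakSpace ℝ E).symm x) :=
      WeakBilin.eval_continuous _ l
    obtain ⟨C, hC⟩ := hS.exists_bound_of_continuousOn hl.continuousOn
    exact ⟨C, fun x => by simpa using hC (toWeakSpace ℝ E x) ⟨x, x.2, rfl⟩⟩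
  obtain ⟨C, hC⟩ := banach_steinhaus hpt
  refine ⟨C, fun x hx => ?_⟩
  rw [← (NormedSpace.inclusionInDoubleDualLi (E := E) ℝ).norm_map x]
  exact hC ⟨x, hx⟩

lemma continuous_memWeakS : Continuous fun x : S => memWeakS x.2 :=
  ((toWeakSpaceCLM ℝ E).continuous.comp continuous_subtype_val).subtype_mk _

/-- The largest gain that an agent with utility `q.1` facing the aggregate `q.2.1` can achieve
by deviating from the strategy `q.2.2`. -/
noncomputable def regret (q : CGame S × S × S) : ℝ :=
  sSup ((fun a => q.1 (a, memWeakS q.2.1.2) - q.1 (memWeakS q.2.2.2, memWeakS q.2.1.2)) '' univ)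

lemma continuous_regret (hS : IsCompact (weakS S)) : Continuous (regret (S := S)) := by
  have : CompactSpace (weakS S) := isCompact_iff_compactSpace.mp hS
  have h1 : Continuous fun p : (CGame S × S × S) × weakS S => memWeakS p.1.2.1.2 :=
    continuous_memWeakS.comp (by fun_prop)
  have h2 : Continuous fun p : (CGame S × S × S) × weakS S => memWeakS p.1.2.2.2 :=
    continuous_memWeakS.comp (by fun_prop)
  have h3 : Continuous fun p : (CGame S × S × S) × weakS S => p.1.1 := by fun_prop
  exact isCompact_univ.continuous_sSup
    ((h3.eval (continuous_snd.prodMk h1)).sub (h3.eval (h2.prodMk h1)))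

lemma regret_le_iff (q : CGame S × S × S) (r : ℝ) :
    regret q ≤ r ↔ ∀ a, ∀ ha : a ∈ S, q.1 (memWeakS ha, memWeakS q.2.1.2) - r ≤
      q.1 (memWeakS q.2.2.2, memWeakS q.2.1.2) := by
  have hbdd : BddAbove ((fun a => q.1 (a, memWeakS q.2.1.2) -
      q.1 (memWeakS q.2.2.2, memWeakS q.2.1.2)) '' univ) := by
    refine ⟨‖q.1‖ + ‖q.1‖, ?_⟩
    rintro _ ⟨a, -, rfl⟩
    have h1 := abs_le.mp (q.1.norm_coe_le_norm (a, memWeakS q.2.1.2))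
    have h2 := abs_le.mp (q.1.norm_coe_le_norm (memWeakS q.2.2.2, memWeakS q.2.1.2))
    dsimp only
    linarith [h1.2, h2.1]
  rw [regret, csSup_le_iff hbdd ⟨_, memWeakS q.2.2.2, mem_univ _, rfl⟩]
  constructor
  · intro h a ha
    linarith [h _ ⟨memWeakS ha, mem_univ _, rfl⟩]
  · rintro h _ ⟨⟨_, a, ha, rfl⟩, -, rfl⟩
    have := h a ha
    simp only [memWeakS] at this ⊢
    linarith

lemma regret_nonneg (q : CGame S × S × S) : 0 ≤ regret q := by
  have h := (regret_le_iff q (regret q)).mp le_rfl q.2.2 q.2.2.2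
  linarith

end Strategies

instance : IsProbabilityMeasure μ01 := ⟨by simp [μ01]⟩

lemma ae_mem_Ioc_μ01 : ∀ᵐ t ∂μ01, t ∈ Ioc (0 : ℝ) 1 := ae_restrict_mem measurableSet_Ioc

lemma μ01sq_eq_prod : μ01sq = μ01.prod μ01 := by
  rw [μ01, Measure.prod_restrict]; rfl

section Aggregates

variable {E : Type*} [NormedAddCommGroup E] [NormedSpace ℝ E] {S : Set E}
  {W : ℝ → ℝ → ℝ} {U : ℝ → CGame S} {f : ℝ → E}

lemma IsGraphonGame.norm_smul_le (hG : IsGraphonGame S W U) (hf : IsProfile S f) {C : ℝ}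
    (hC : ∀ x ∈ S, ‖x‖ ≤ C) {t : ℝ} (ht : t ∈ Ioc (0 : ℝ) 1) :
    ∀ᵐ s ∂μ01, ‖W t s • f s‖ ≤ C := by
  filter_upwards [ae_mem_Ioc_μ01] with s hs
  have hW := hG.2.1 t ht s hs
  rw [norm_smul, Real.norm_of_nonneg hW.1]
  exact (mul_le_of_le_one_left (norm_nonneg _) hW.2).trans (hC _ (hf.2 s))

lemma IsGraphonGame.stronglyMeasurable_smul (hG : IsGraphonGame S W U) (hf : IsProfile S f) :
    StronglyMeasurable (Function.uncurry fun t s => W t s • f s) :=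
  hG.1.stronglyMeasurable.smul (hf.1.comp_measurable measurable_snd)

lemma IsGraphonGame.aestronglyMeasurable_smul (hG : IsGraphonGame S W U) (hf : IsProfile S f)
    (t : ℝ) : AEStronglyMeasurable (fun s => W t s • f s) μ01 :=
  ((hG.stronglyMeasurable_smul hf).comp_measurable
    measurable_prodMk_left).aestronglyMeasurable

lemma IsGraphonGame.agg_mem [CompleteSpace E] (hS0 : (0 : E) ∈ S) (hSconv : Convex ℝ S)
    (hS : IsCompact (weakS S)) (hG : IsGraphonGame S W U) (hf : IsProfile S f) {t : ℝ}
    (ht : t ∈ Ioc (0 : ℝ) 1) : agg W f t ∈ S := by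
  obtain ⟨C, hC⟩ := exists_norm_le_of_isCompact_weakS hS
  refine hSconv.integral_mem (isClosed_of_isCompact_weakS hS) ?_
    (Integrable.of_bound (hG.aestronglyMeasurable_smul hf t) C (hG.norm_smul_le hf hC ht))
  filter_upwards [ae_mem_Ioc_μ01] with s hs
  exact hSconv.smul_mem_of_zero_mem hS0 (hf.2 s) (hG.2.1 t ht s hs)

/-- The aggregate of a profile agrees on `(0,1]` with a measurable map into `S`. -/
lemma IsGraphonGame.exists_stronglyMeasurable_agg [CompleteSpace E]
    [TopologicalSpace.SeparableSpace E] (hS0 : (0 : E) ∈ S) (hSconv : Convex ℝ S)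
    (hS : IsCompact (weakS S)) (hG : IsGraphonGame S W U) (hf : IsProfile S f) :
    ∃ g : ℝ → S, StronglyMeasurable g ∧ ∀ t ∈ Ioc (0 : ℝ) 1, (g t : E) = agg W f t := by
  borelize E
  have := UniformSpace.secondCountable_of_separable E
  have hmem : ∀ t, (Ioc (0 : ℝ) 1).indicator (agg W f) t ∈ S := by
    intro t
    by_cases ht : t ∈ Ioc (0 : ℝ) 1
    · rw [indicator_of_mem ht]
      exact hG.agg_mem hS0 hSconv hS hf ht
    · rwa [indicator_of_notMem ht]
  have hmeas : StronglyMeasurable (agg W f) :=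
    (hG.stronglyMeasurable_smul hf).integral_prod_right
  exact ⟨fun t => ⟨_, hmem t⟩,
    ((hmeas.indicator measurableSet_Ioc).measurable.subtype_mk).stronglyMeasurable,
    fun t ht => indicator_of_mem ht _⟩

/-- Every graphon game with a profile has a measurable regret function, through which
approximate optimality of agents can be tested. -/
lemma IsGraphonGame.exists_regret [CompleteSpace E]
    [TopologicalSpace.SeparableSpace E] (hS0 : (0 : E) ∈ S) (hSconv : Convex ℝ S)
    (hS : IsCompact (weakS S)) (hG : IsGraphonGame S W U) (hf : IsProfile S f) :
    ∃ g : ℝ → S, StronglyMeasurable (fun t => regret (U t, g t, ⟨f t, hf.2 t⟩)) ∧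
      (∀ t ∈ Ioc (0 : ℝ) 1, (g t : E) = agg W f t) ∧
      ∀ t ∈ Ioc (0 : ℝ) 1, ∀ r, regret (U t, g t, ⟨f t, hf.2 t⟩) ≤ r ↔
        ∀ (hft : f t ∈ S) (hag : agg W f t ∈ S), ∀ a, ∀ ha : a ∈ S,
          U t (memWeakS ha, memWeakS hag) - r ≤ U t (memWeakS hft, memWeakS hag) := by
  obtain ⟨g, hg, hgeq⟩ := hG.exists_stronglyMeasurable_agg hS0 hSconv hS hf
  borelize E
  have := UniformSpace.secondCountable_of_separable E
  have hfS : StronglyMeasurable fun t => (⟨f t, hf.2 t⟩ : S) :=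
    (hf.1.measurable.subtype_mk).stronglyMeasurable
  refine ⟨g, (continuous_regret hS).comp_stronglyMeasurable
    (hG.2.2.1.prodMk (hg.prodMk hfS)), hgeq, fun t ht r => ?_⟩
  have hgt : g t = ⟨agg W f t, hgeq t ht ▸ (g t).2⟩ := Subtype.ext (hgeq t ht)
  rw [regret_le_iff, hgt]
  exact ⟨fun h _ _ => h, fun h => h _ _⟩

end Aggregates

/-- A sequence of nonnegative measurable functions with `g n ≤ ε n` outside a set of measure
at most `ε n → 0` converges to `0` in measure. -/
lemma tendstoInMeasure_zero_of_measure_le {Ω : Type*} [MeasurableSpace Ω] {P : Measure Ω}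
    [IsProbabilityMeasure P] {g : ℕ → Ω → ℝ} (hg : ∀ n, StronglyMeasurable (g n))
    (hg0 : ∀ n t, 0 ≤ g n t) {ε : ℕ → ℝ} (hε : Tendsto ε atTop (𝓝 0))
    (h : ∀ n, ENNReal.ofReal (1 - ε n) ≤ P {t | g n t ≤ ε n}) :
    TendstoInMeasure P g atTop 0 := by
  rw [tendstoInMeasure_iff_dist]
  intro δ hδ
  have hlim : Tendsto (fun n => 1 - ENNReal.ofReal (1 - ε n)) atTop (𝓝 0) := by
    have h1 : Tendsto (fun n => ENNReal.ofReal (1 - ε n)) atTop (𝓝 1) := by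
      simpa using ENNReal.tendsto_ofReal (hε.const_sub 1)
    simpa using ENNReal.Tendsto.sub tendsto_const_nhds h1 (Or.inl ENNReal.one_ne_top)
  refine tendsto_of_tendsto_of_tendsto_of_le_of_le' tendsto_const_nhds hlim
    (Eventually.of_forall fun _ => zero_le) ?_
  filter_upwards [hε.eventually_lt_const hδ] with n hn
  calc P {t | δ ≤ dist (g n t) ((0 : Ω → ℝ) t)} ≤ P {t | g n t ≤ ε n}ᶜ := by
        refine measure_mono fun t ht => ?_
        simp only [mem_ofPred_eq, Pi.zero_apply, Real.dist_eq, sub_zero,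
          abs_of_nonneg (hg0 n t)] at ht
        simpa using hn.trans_le ht
    _ = 1 - P {t | g n t ≤ ε n} :=
        prob_compl_eq_one_sub ((hg n).measurable measurableSet_Iic)
    _ ≤ 1 - ENNReal.ofReal (1 - ε n) := tsub_le_tsub_left (h n) 1

/-- **Limits of asymptotic Nash equilibria are Nash equilibria** (Theorem 2 of the
paper). If a sequence of graphon games converges to a graphon game `(W, U)`, then any
convergent sequence of asymptotic Nash equilibria converges to a Nash equilibrium of
`(W, U)`. -/
theorem limit_of_asymptotic_nash_is_nash
    {E : Type*} [NormedAddCommGroup E] [NormedSpace ℝ E] [CompleteSpace E]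
    [TopologicalSpace.SeparableSpace E]
    (S : Set E) (hS0 : (0 : E) ∈ S) (hSconv : Convex ℝ S) (hScomp : IsCompact (weakS S))
    (W : ℝ → ℝ → ℝ) (U : ℝ → CGame S) (hG : IsGraphonGame S W U)
    (f : ℝ → E) (hf : IsProfile S f)
    (Wn : ℕ → ℝ → ℝ → ℝ) (Un : ℕ → ℝ → CGame S)
    (hGn : ∀ n, IsGraphonGame S (Wn n) (Un n))
    (fn : ℕ → ℝ → E) (hfn : ∀ n, IsProfile S (fn n))
    (ε : ℕ → ℝ) (hεnonneg : ∀ n, 0 ≤ ε n)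
    (hNash : ∀ n, IsEpsNashEq S (Wn n) (Un n) (fn n) (ε n))
    (hWconv : ∀ᵐ p ∂μ01sq, Tendsto (fun n => Wn n p.1 p.2) atTop (𝓝 (W p.1 p.2)))
    (hUconv : ∀ᵐ t ∂μ01, Tendsto (fun n => Un n t) atTop (𝓝 (U t)))
    (hfconv : ∀ᵐ t ∂μ01, Tendsto (fun n => fn n t) atTop (𝓝 (f t)))
    (hεconv : Tendsto ε atTop (𝓝 0)) :
    IsNashEq S W U f := by
  choose gn hgn_meas hgn_eq hgn_iff using fun n =>
    (hGn n).exists_regret hS0 hSconv hScomp (hfn n)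
  obtain ⟨g, hg_meas, hg_eq, hg_iff⟩ := hG.exists_regret hS0 hSconv hScomp hf
  obtain ⟨C, hC⟩ := exists_norm_le_of_isCompact_weakS hScomp
  have hzero : TendstoInMeasure μ01
      (fun n t => regret (Un n t, gn n t, ⟨fn n t, (hfn n).2 t⟩)) atTop 0 := by
    refine tendstoInMeasure_zero_of_measure_le hgn_meas (fun _ _ => regret_nonneg _) hεconv
      fun n => (hNash n).trans (measure_mono_ae ?_)
    filter_upwards [ae_mem_Ioc_μ01] with t ht h
    exact (hgn_iff n t ht (ε n)).mpr h
  rw [μ01sq_eq_prod] at hWconv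
  have hlim : TendstoInMeasure μ01
      (fun n t => regret (Un n t, gn n t, ⟨fn n t, (hfn n).2 t⟩)) atTop
      (fun t => regret (U t, g t, ⟨f t, hf.2 t⟩)) := by
    refine tendstoInMeasure_of_tendsto_ae (fun n => (hgn_meas n).aestronglyMeasurable) ?_
    filter_upwards [ae_mem_Ioc_μ01, Measure.ae_ae_of_ae_prod hWconv, hUconv, hfconv]
      with t ht hWt hUt hft
    have hagg : Tendsto (fun n => agg (Wn n) (fn n) t) atTop (𝓝 (agg W f t)) := by
      refine tendsto_integral_of_dominated_convergence (fun _ => C)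
        (fun n => (hGn n).aestronglyMeasurable_smul (hfn n) t) (integrable_const C)
        (fun n => (hGn n).norm_smul_le (hfn n) hC ht) ?_
      filter_upwards [hWt, hfconv] with s hWs hfs
      exact hWs.smul hfs
    have hg_lim : Tendsto (fun n => gn n t) atTop (𝓝 (g t)) := by
      rw [tendsto_subtype_rng, hg_eq t ht]
      exact hagg.congr fun n => (hgn_eq n t ht).symm
    exact ((continuous_regret hScomp).tendsto _).comp
      (hUt.prodMk_nhds (hg_lim.prodMk_nhds (tendsto_subtype_rng.mpr hft)))
  filter_upwards [ae_mem_Ioc_μ01, tendstoInMeasure_ae_unique hlim hzero]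
    with t ht h hft hag a ha
  simpa using (hg_iff t ht 0).mp h.le hft hag a ha
end
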